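/- Let $K$ be an algebraically closed field and let $\Gamma$ be a Brauer tree with $n$ edges and multiplicity one, i.e. a finite tree with $n$ edges together with a cyclic ordering of the edges around each vertex. Let $A$ be the basic Brauer tree algebra of $\Gamma$ over $K$: the path algebra $KQ_\Gamma/I$, where the vertices of $Q_\Gamma$ are the edges of $\Gamma$, where for each vertex $x$ of $\Gamma$ and each edge $i$ at $x$ there is an arrow from $i$ to the edge that follows $i$ around $x$ (so that each vertex $x$ of $\Gamma$ gives an oriented cycle, a loop if $x$ is a leaf), and where $I$ is generated by the products of two composable arrows from different cycles and, for every edge $i$ of $\Gamma$, by the difference of the two cycles that start and end at $i$. Then there is a complex $T$ of finitely generated projective $A$-modules, concentrated in the degrees $0$ and $1$, such that 1. $T$ is a tilting complex: $\mathrm{Hom}_{D^b(A)}(T,T[i])=0$ for all $i\neq 0$, and $T$ generates the perfect complexes (the bounded complexes of finitely generated projective $A$-modules) as a triangulated category, i.e. the smallest full triangulated subcategory of the derived category of $A$ that contains $T$ and is closed under direct summands contains all perfect complexes; 2. the $K$-algebra $\mathrm{End}_{K^b(A)}(T)$ of endomorphisms of $T$ in the bounded homotopy category of finitely generated projective $A$-modules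 is isomorphic to the Brauer star algebra with $n$ edges, i.e. to the Brauer tree algebra over $K$ of the star (the tree with $n$ edges all incident to one vertex) with multiplicity one. -/

import Mathlib

open CategoryTheory CategoryTheory.Limits

universe w v u

/-! ### Brauer trees of multiplicity one -/

/-- A Brauer tree (of multiplicity one) with vertex set `V`: a finite tree with a cyclic ordering
of the edges around each vertex.  An edge together with a choice of one of its end points `x` is a
dart `d` of the graph with `d.fst = x`.  The cyclic orderings are recorded by the permutation
`next` of the darts, which takes the edge `d.edge`, seen from `d.fst`, to the edge that follows it
around `d.fst`: it fixes the base vertex of a dart, and all darts based at one vertex form a single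
cycle of `next`. -/
structure BrauerTree (V : Type v) where
  finite : Finite V
  graph : SimpleGraph V
  isTree : graph.IsTree
  next : Equiv.Perm graph.Dart
  next_fst : ∀ d, (next d).fst = d.fst
  next_sameCycle : ∀ d d' : graph.Dart, d.fst = d'.fst → next.SameCycle d d'

namespace BrauerTree

variable {V : Type v} (Γ : BrauerTree V)

/-- The edges of the Brauer tree; they are the vertices of the Brauer quiver. -/
abbrev Edge : Type v := Γ.graph.edgeSet

/-- The number of edges. -/
noncomputable def numEdges : ℕ := Nat.card Γ.Edge

/-- The edge underlying a dart. -/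
def edgeOf (d : Γ.graph.Dart) : Γ.Edge := ⟨d.edge, d.edge_mem⟩

end BrauerTree

/-! ### The algebra of a Brauer tree -/

namespace BrauerTreeAlgebra

variable (K : Type u) [Field K] {V : Type v} (Γ : BrauerTree V)

/-- The free algebra on the vertices and the arrows of the Brauer quiver.  The vertices of this
quiver are the edges of `Γ`.  Its arrows are indexed by the darts of `Γ`: the dart `d` gives the
arrow from `d.edge` to the edge that follows it around `d.fst` (a loop, if `d.fst` is a leaf). -/
abbrev Free : Type (max u v) := FreeAlgebra K (Γ.Edge ⊕ Γ.graph.Dart)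

/-- The trivial path at a vertex of the quiver, in the free algebra. -/
def e (i : Γ.Edge) : Free K Γ := FreeAlgebra.ι K (Sum.inl i)

/-- The arrow of a dart, in the free algebra. -/
def a (d : Γ.graph.Dart) : Free K Γ := FreeAlgebra.ι K (Sum.inr d)

/-- The oriented cycle of arrows around the vertex `d.fst` of `Γ`, passed through once, starting
with the arrow of `d`; products of arrows are written from left to right. -/
noncomputable def cyc (d : Γ.graph.Dart) : Free K Γ :=
  ((List.range (Function.minimalPeriod Γ.next d)).map fun k => a K Γ (Γ.next^[k] d)).prod

/-- The relations of the Brauer tree algebra. -/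
inductive Rel : Free K Γ → Free K Γ → Prop
  -- the relations of the path algebra of the quiver:
  | idem (i : Γ.Edge) : Rel (e K Γ i * e K Γ i) (e K Γ i)
  | orth (i j : Γ.Edge) (h : i ≠ j) : Rel (e K Γ i * e K Γ j) 0
  | sum : Rel (∑ᶠ i, e K Γ i) 1
  | source (d : Γ.graph.Dart) : Rel (e K Γ (Γ.edgeOf d) * a K Γ d) (a K Γ d)
  | target (d : Γ.graph.Dart) : Rel (a K Γ d * e K Γ (Γ.edgeOf (Γ.next d))) (a K Γ d)
  -- the product of two composable arrows from the cycles of different vertices of `Γ` is zero: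
  | zero (d : Γ.graph.Dart) : Rel (a K Γ d * a K Γ (Γ.next d).symm) 0
  -- the two cycles through a vertex of the quiver coincide:
  | cycle (d : Γ.graph.Dart) : Rel (cyc K Γ d) (cyc K Γ d.symm)

end BrauerTreeAlgebra

/-- The basic Brauer tree algebra over `K` of the Brauer tree `Γ` with multiplicity one: the path
algebra of the Brauer quiver modulo the Brauer tree relations. -/
abbrev BrauerTreeAlgebra (K : Type u) [Field K] {V : Type v} (Γ : BrauerTree V) :
    Type (max u v) :=
  RingQuot (BrauerTreeAlgebra.Rel K Γ)

/-! ### The Brauer star -/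

namespace BrauerTree

/-- The darts of the star with centre `none` and leaves `some i`: `inl i` is the edge to `some i`
seen from the centre, `inr i` is the same edge seen from the leaf. -/
def starDartEquiv (n : ℕ) :
    (Fin n ⊕ Fin n) ≃ (SimpleGraph.starGraph (none : Option (Fin n))).Dart where
  toFun
    | .inl i => ⟨(none, some i), by simp⟩
    | .inr i => ⟨(some i, none), by simp⟩
  invFun
    | ⟨(none, some i), _⟩ => .inl i
    | ⟨(some i, none), _⟩ => .inr i
    | ⟨(none, none), h⟩ => (by simp at h : False).elim
    | ⟨(some i, some j), h⟩ => (by simp at h : False).elim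
  left_inv := by rintro (i | i) <;> rfl
  right_inv := by
    rintro ⟨⟨_ | i, _ | j⟩, h⟩
    · simp at h
    · rfl
    · rfl
    · simp at h

theorem sameCycle_finRotate (n : ℕ) (i j : Fin n) : (finRotate n).SameCycle i j := by
  match n, i, j with
  | 0, i, _ => exact i.elim0
  | 1, i, j => rw [Subsingleton.elim i j]
  | n + 2, i, j =>
    have h : ∀ x : Fin (n + 2), finRotate (n + 2) x ≠ x := fun x => by
      rw [← Equiv.Perm.mem_support, support_finRotate]
      exact Finset.mem_univ x
    exact isCycle_finRotate.sameCycle (h i) (h j)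

/-- The cyclic ordering of the star: the edges at the centre are permuted cyclically, and the only
edge at a leaf follows itself. -/
def starNext (n : ℕ) : Equiv.Perm (SimpleGraph.starGraph (none : Option (Fin n))).Dart :=
  (starDartEquiv n).permCongr (Equiv.Perm.sumCongr (finRotate n) 1)

/-- The Brauer star with `n` edges. -/
def star (n : ℕ) : BrauerTree (Option (Fin n)) where
  finite := inferInstance
  graph := SimpleGraph.starGraph none
  isTree := SimpleGraph.isTree_starGraph none
  next := starNext n
  next_fst d := by
    obtain ⟨x, rfl⟩ := (starDartEquiv n).surjective d
    rcases x with i | i <;> simp [starNext, Equiv.permCongr_apply] <;> rfl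
  next_sameCycle d d' h := by
    obtain ⟨x, rfl⟩ := (starDartEquiv n).surjective d
    obtain ⟨y, rfl⟩ := (starDartEquiv n).surjective d'
    have key : ∀ k : ℕ, ∀ z, ((starNext n) ^ k) (starDartEquiv n z)
        = starDartEquiv n (((Equiv.Perm.sumCongr (finRotate n) 1) ^ k) z) := by
      intro k
      induction k with
      | zero => intro z; rfl
      | succ k ih =>
        intro z
        rw [pow_succ, pow_succ, Equiv.Perm.mul_apply, Equiv.Perm.mul_apply, ← ih]
        simp [starNext, Equiv.permCongr_apply]
    rcases x with i | i <;> rcases y with j | j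
    · obtain ⟨k, hk⟩ := (sameCycle_finRotate n i j).exists_nat_pow_eq
      refine ⟨k, ?_⟩
      rw [zpow_natCast, key]
      congr 1
      rw [← hk]
      clear hk key h
      induction k with
      | zero => rfl
      | succ k ih => rw [pow_succ', pow_succ', Equiv.Perm.mul_apply, ih]; rfl
    · exact absurd h (by simp [starDartEquiv])
    · exact absurd h (by simp [starDartEquiv])
    · have hij : i = j := by simpa [starDartEquiv] using h
      rw [hij]

end BrauerTree

/-! ### Tilting complexes -/

namespace TwoTermTilting

variable {A : Type w} [Ring A]

/-- Bounded complexes of finitely generated projective `A`-modules. -/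
def IsPerfectComplex (T : CochainComplex (ModuleCat.{w} A) ℤ) : Prop :=
  (∀ i, Module.Finite A (T.X i) ∧ Module.Projective A (T.X i)) ∧
    ∃ b c : ℤ, ∀ i, i < b ∨ c < i → IsZero (T.X i)

/-- Complexes concentrated in the degrees `0` and `1`. -/
def IsTwoTerm (T : CochainComplex (ModuleCat.{w} A) ℤ) : Prop :=
  ∀ i : ℤ, i ≠ 0 → i ≠ 1 → IsZero (T.X i)

variable (A) in
/-- The perfect complexes, as a class of objects of the derived category. -/
def perf [HasDerivedCategory.{v} (ModuleCat.{w} A)] :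
    ObjectProperty (DerivedCategory (ModuleCat.{w} A)) :=
  fun X => ∃ C : CochainComplex (ModuleCat.{w} A) ℤ, IsPerfectComplex C ∧
    Nonempty (X ≅ DerivedCategory.Q.obj C)

/-- Tilting complexes: perfect complexes `T` with `Hom(T, T[i]) = 0` in the derived category for
`i ≠ 0` that generate the perfect complexes as a triangulated category, i.e. the smallest full
triangulated subcategory that is closed under direct summands and contains `T` contains all
perfect complexes. -/
def IsTilting [HasDerivedCategory.{v} (ModuleCat.{w} A)]
    (T : CochainComplex (ModuleCat.{w} A) ℤ) : Prop :=
  IsPerfectComplex T ∧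
  (∀ i : ℤ, i ≠ 0 → ∀ f : DerivedCategory.Q.obj T ⟶ (DerivedCategory.Q.obj T)⟦i⟧, f = 0) ∧
  perf A ≤ (ObjectProperty.singleton (DerivedCategory.Q.obj T)).triangEnvelope

/-- The endomorphism ring of `T` in the homotopy category; for a perfect complex `T` this is its
endomorphism ring in the full subcategory of bounded complexes of finitely generated projective
modules. -/
abbrev EndHomotopy (T : CochainComplex (ModuleCat.{w} A) ℤ) : Type w :=
  End ((HomotopyCategory.quotient (ModuleCat.{w} A) (ComplexShape.up ℤ)).obj T)

end TwoTermTilting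

/-! ### Rooted trees -/

/-- A finite rooted tree, given by its parent function, together with an injective numbering of
the children of every vertex. -/
structure PlaneTree (W : Type) where
  root : W
  parent : W → W
  depth : W → ℕ
  pos : W → ℕ
  depth_root : depth root = 0
  depth_parent : ∀ a, a ≠ root → depth a = depth (parent a) + 1
  pos_inj : ∀ a b, a ≠ root → b ≠ root → parent a = parent b → pos a = pos b → a = b

namespace PlaneTree

variable {W : Type} (R : PlaneTree W)

/-- `b` is the parent of `a`. -/
def Par (a b : W) : Prop := a ≠ R.root ∧ R.parent a = b

/-- `a` and `b` are distinct children of the same vertex. -/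
def Sib (a b : W) : Prop := a ≠ R.root ∧ b ≠ R.root ∧ a ≠ b ∧ R.parent a = R.parent b

/-- `a` is an ancestor of `w`, or equal to it. -/
def Anc (a w : W) : Prop := Relation.ReflTransGen R.Par w a

variable {R}

lemma Par.depth {a b : W} (h : R.Par a b) : R.depth a = R.depth b + 1 := by
  rw [R.depth_parent a h.1, h.2]

lemma Par.anc {a b : W} (h : R.Par a b) : R.Anc b a := Relation.ReflTransGen.single h

lemma Par.unique {a b c : W} (h : R.Par a b) (h' : R.Par a c) : b = c := h.2.symm.trans h'.2

lemma par_parent {a : W} (h : a ≠ R.root) : R.Par a (R.parent a) := ⟨h, rfl⟩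

lemma Sib.symm {a b : W} (h : R.Sib a b) : R.Sib b a := ⟨h.2.1, h.1, h.2.2.1.symm, h.2.2.2.symm⟩

lemma Sib.depth {a b : W} (h : R.Sib a b) : R.depth a = R.depth b := by
  rw [R.depth_parent a h.1, R.depth_parent b h.2.1, h.2.2.2]

lemma Sib.pos_ne {a b : W} (h : R.Sib a b) : R.pos a ≠ R.pos b :=
  fun h' => h.2.2.1 (R.pos_inj a b h.1 h.2.1 h.2.2.2 h')

lemma Par.sib {a b u : W} (ha : R.Par a u) (hb : R.Par b u) (h : a ≠ b) : R.Sib a b :=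
  ⟨ha.1, hb.1, h, ha.2.trans hb.2.symm⟩

lemma Sib.par {a b u : W} (h : R.Sib a b) (ha : R.Par a u) : R.Par b u :=
  ⟨h.2.1, h.2.2.2.symm.trans ha.2⟩

lemma Anc.refl (a : W) : R.Anc a a := Relation.ReflTransGen.refl

lemma Anc.trans {a b c : W} (h : R.Anc a b) (h' : R.Anc b c) : R.Anc a c :=
  Relation.ReflTransGen.trans h' h

lemma Anc.depth_le {a w : W} (h : R.Anc a w) : R.depth a ≤ R.depth w := by
  induction h with
  | refl => exact le_rfl
  | tail _ h ih => have := h.depth; omega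

lemma Anc.eq_of_depth_le {a w : W} (h : R.Anc a w) (h' : R.depth w ≤ R.depth a) : a = w := by
  induction h with
  | refl => rfl
  | tail h₁ h₂ _ =>
    have h₃ := h₂.depth
    have h₄ := Anc.depth_le h₁
    omega

lemma Anc.total {a b w : W} (ha : R.Anc a w) (hb : R.Anc b w) : R.Anc a b ∨ R.Anc b a :=
  (Relation.ReflTransGen.total_of_right_unique (r := R.Par)
    (fun _ _ _ (h : R.Par _ _) (h' : R.Par _ _) => h.unique h') ha hb).symm

lemma Anc.of_depth_le {a b w : W} (ha : R.Anc a w) (hb : R.Anc b w)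
    (h : R.depth a ≤ R.depth b) : R.Anc a b := by
  rcases ha.total hb with h' | h'
  · exact h'
  · rw [h'.eq_of_depth_le h]; exact Anc.refl _

lemma Anc.eq_of_depth_eq {a b w : W} (ha : R.Anc a w) (hb : R.Anc b w)
    (h : R.depth a = R.depth b) : a = b :=
  (ha.of_depth_le hb h.le).eq_of_depth_le h.ge

lemma Anc.par {a b w : W} (ha : R.Anc a w) (h : R.Par a b) : R.Anc b w := h.anc.trans ha

/-- Two children of the same vertex are not both ancestors of the same vertex. -/
lemma Par.eq_of_anc {a b u w : W} (ha : R.Par a u) (hb : R.Par b u) (haw : R.Anc a w)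
    (hbw : R.Anc b w) : a = b :=
  haw.eq_of_depth_eq hbw (by rw [ha.depth, hb.depth])

lemma Sib.not_anc {a b w : W} (h : R.Sib a b) (ha : R.Anc a w) : ¬ R.Anc b w :=
  fun hb => h.2.2.1 (ha.eq_of_depth_eq hb h.depth)

lemma Anc.exists_child {a w : W} (h : R.Anc a w) (h' : a ≠ w) :
    ∃ b, R.Par b a ∧ R.Anc b w := by
  rcases Relation.ReflTransGen.cases_tail h with h | ⟨b, hb, hb'⟩
  · exact absurd h h'
  · exact ⟨b, hb', hb⟩

lemma root_anc (w : W) : R.Anc R.root w := by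
  induction h : R.depth w generalizing w with
  | zero =>
    by_cases hw : w = R.root
    · rw [hw]; exact Anc.refl _
    · have := R.depth_parent w hw; omega
  | succ n ih =>
    by_cases hw : w = R.root
    · rw [hw]; exact Anc.refl _
    · have := R.depth_parent w hw
      exact (ih (R.parent w) (by omega)).trans (par_parent hw).anc

lemma not_par_root {a : W} : ¬ R.Par R.root a := fun h => h.1 rfl

lemma eq_root_of_depth {a : W} (h : R.depth a = 0) : a = R.root := by
  by_contra hne
  have := R.depth_parent a hne
  omega

/-- Two vertices are comparable, or they diverge at a pair of siblings. -/
lemma anc_or_sib (w x : W) :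
    R.Anc w x ∨ R.Anc x w ∨ ∃ a b, R.Sib a b ∧ R.Anc a w ∧ R.Anc b x := by
  induction h : R.depth w generalizing w with
  | zero => rw [eq_root_of_depth h]; exact Or.inl (root_anc x)
  | succ n ih =>
    have hw : w ≠ R.root := by rintro rfl; rw [R.depth_root] at h; omega
    have hp := par_parent hw
    have := hp.depth
    rcases ih (R.parent w) (by omega) with h₁ | h₁ | ⟨a, b, hab, ha, hb⟩
    · by_cases hx : R.parent w = x
      · exact Or.inr (Or.inl (hx ▸ hp.anc))
      · obtain ⟨b, hb, hbx⟩ := h₁.exists_child hx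
        by_cases hbw : b = w
        · exact Or.inl (hbw ▸ hbx)
        · exact Or.inr (Or.inr ⟨w, b, hp.sib hb (Ne.symm hbw), Anc.refl _, hbx⟩)
    · exact Or.inr (Or.inl (h₁.trans hp.anc))
    · exact Or.inr (Or.inr ⟨a, b, hab, ha.trans hp.anc, hb⟩)

open scoped Classical in
variable (R) in
/-- The ancestors of `w` whose depth has the parity `j`. -/
noncomputable def path [Fintype W] (j : ℕ) (w : W) : Finset W :=
  Finset.univ.filter fun a => R.Anc a w ∧ R.depth a % 2 = j

@[simp]
lemma mem_path [Fintype W] {j : ℕ} {w a : W} :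
    a ∈ R.path j w ↔ R.Anc a w ∧ R.depth a % 2 = j := by
  simp [path]

end PlaneTree

/-! ### Systems of objects with the morphisms of the projectives of a Brauer tree algebra -/

/-- Objects `P a` of a linear category, indexed by the vertices of a rooted tree, such that the
morphisms between them are as between the indecomposable projective modules of a Brauer tree
algebra (the vertex `a` stands for the edge above it, and one further edge ends in the root). The
socle endomorphism of `P a` is `c a a`. -/
structure BrauerSystem (K : Type u) [Field K] {W : Type} (R : PlaneTree W) (C : Type w)
    [Category.{v} C] [Preadditive C] [Linear K C] where
  P : W → C
  c : ∀ a b, P a ⟶ P b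
  span_self : ∀ {a} (f : P a ⟶ P a), ∃ α β : K, f = α • 𝟙 (P a) + β • c a a
  span_ne : ∀ {a b}, a ≠ b → ∀ f : P a ⟶ P b, ∃ β : K, f = β • c a b
  c_eq_zero : ∀ {a b}, a ≠ b → ¬ R.Par a b → ¬ R.Par b a → ¬ R.Sib a b → c a b = 0
  c_self_ne_zero : ∀ a, c a a ≠ 0
  c_self_comp : ∀ a, c a a ≫ c a a = 0
  c_par : ∀ {a b}, R.Par a b → c a b ≫ c b a = c a a
  c_par' : ∀ {a b}, R.Par a b → c b a ≫ c a b = c b b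
  up_lt : ∀ {a b u}, R.Sib a b → R.Par a u → R.pos a < R.pos b → c a b ≫ c b u = c a u
  up_gt : ∀ {a b u}, R.Sib a b → R.Par a u → R.pos b < R.pos a → c a b ≫ c b u = 0
  down_lt : ∀ {a b u}, R.Sib a b → R.Par a u → R.pos a < R.pos b → c u a ≫ c a b = c u b
  down_gt : ∀ {a b u}, R.Sib a b → R.Par a u → R.pos b < R.pos a → c u a ≫ c a b = 0
  over_gt : ∀ {a b u}, R.Sib a b → R.Par a u → R.pos b < R.pos a → c a u ≫ c u b = c a b
  over_lt : ∀ {a b u}, R.Sib a b → R.Par a u → R.pos a < R.pos b → c a u ≫ c u b = 0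

namespace BrauerSystem

variable {K : Type u} [Field K] {W : Type} {R : PlaneTree W} {C : Type w}
    [Category.{v} C] [Preadditive C] [Linear K C] (B : BrauerSystem K R C)

lemma c_self_comp_c (a b : W) : B.c a a ≫ B.c a b = 0 := by
  by_cases h : a = b
  · subst h; exact B.c_self_comp a
  · obtain ⟨β, hβ⟩ := B.span_ne h (B.c a a ≫ B.c a b)
    have h₁ : B.c a a ≫ (B.c a a ≫ B.c a b) = 0 := by
      rw [← Category.assoc, B.c_self_comp, zero_comp]
    rw [hβ, Linear.comp_smul, hβ, smul_smul] at h₁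
    rcases smul_eq_zero.1 h₁ with h₂ | h₂
    · rw [hβ, mul_self_eq_zero.1 h₂, zero_smul]
    · rw [hβ, h₂, smul_zero]

lemma c_comp_c_self (a b : W) : B.c a b ≫ B.c b b = 0 := by
  by_cases h : a = b
  · subst h; exact B.c_self_comp a
  · obtain ⟨β, hβ⟩ := B.span_ne h (B.c a b ≫ B.c b b)
    have h₁ : (B.c a b ≫ B.c b b) ≫ B.c b b = 0 := by
      rw [Category.assoc, B.c_self_comp, comp_zero]
    rw [hβ, Linear.smul_comp, hβ, smul_smul] at h₁
    rcases smul_eq_zero.1 h₁ with h₂ | h₂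
    · rw [hβ, mul_self_eq_zero.1 h₂, zero_smul]
    · rw [hβ, h₂, smul_zero]

lemma hom_eq_zero {a b : W} (h : a ≠ b) (h₁ : ¬ R.Par a b) (h₂ : ¬ R.Par b a)
    (h₃ : ¬ R.Sib a b) (f : B.P a ⟶ B.P b) : f = 0 := by
  obtain ⟨β, rfl⟩ := B.span_ne h f
  rw [B.c_eq_zero h h₁ h₂ h₃, smul_zero]

/-- Between vertices of different depths of the same parity there are no morphisms. -/
lemma hom_eq_zero_of_depth_ne {a b : W} (h : R.depth a ≠ R.depth b)
    (h' : R.depth a % 2 = R.depth b % 2) (f : B.P a ⟶ B.P b) : f = 0 :=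
  B.hom_eq_zero (fun e => h (by rw [e])) (fun e => by have := e.depth; omega)
    (fun e => by have := e.depth; omega) (fun e => h e.depth) f

lemma hom_eq_zero_of_parity {a b : W} (h' : R.depth a % 2 ≠ R.depth b % 2)
    (h₁ : ¬ R.Par a b) (h₂ : ¬ R.Par b a) (f : B.P a ⟶ B.P b) : f = 0 :=
  B.hom_eq_zero (fun e => h' (by rw [e])) h₁ h₂ (fun e => h' (by rw [e.depth])) f

lemma c_ne_zero {a b : W} (h : R.Par a b) : B.c a b ≠ 0 := fun h' =>
  B.c_self_ne_zero a (by rw [← B.c_par h, h', zero_comp])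

lemma c_ne_zero' {a b : W} (h : R.Par a b) : B.c b a ≠ 0 := fun h' =>
  B.c_self_ne_zero a (by rw [← B.c_par h, h', comp_zero])

lemma coeff_unique {a : W} {α β α' β' : K}
    (h : α • 𝟙 (B.P a) + β • B.c a a = α' • 𝟙 (B.P a) + β' • B.c a a) : α = α' ∧ β = β' := by
  have h₁ := congrArg (fun f => f ≫ B.c a a) h
  simp only [Preadditive.add_comp, Linear.smul_comp, Category.id_comp, B.c_self_comp, smul_zero,
    add_zero] at h₁
  have h₂ := smul_left_injective K (B.c_self_ne_zero a) h₁
  subst h₂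
  exact ⟨rfl, smul_left_injective K (B.c_self_ne_zero a) (add_left_cancel h)⟩

/-- The coefficient of the identity in an endomorphism of `P a`. -/
noncomputable def coeff {a : W} (f : B.P a ⟶ B.P a) : K := (B.span_self f).choose

lemma coeff_spec {a : W} (f : B.P a ⟶ B.P a) :
    ∃ β : K, f = B.coeff f • 𝟙 (B.P a) + β • B.c a a := (B.span_self f).choose_spec

lemma coeff_eq {a : W} (α β : K) : B.coeff (α • 𝟙 (B.P a) + β • B.c a a) = α := by
  obtain ⟨β', h⟩ := B.coeff_spec (α • 𝟙 (B.P a) + β • B.c a a)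
  exact (B.coeff_unique h).1.symm

lemma coeff_id (a : W) : B.coeff (𝟙 (B.P a)) = 1 := by
  simpa using B.coeff_eq (a := a) 1 0

lemma coeff_smul_c (a : W) (β : K) : B.coeff (β • B.c a a) = 0 := by
  simpa using B.coeff_eq (a := a) 0 β

lemma coeff_add {a : W} (f g : B.P a ⟶ B.P a) : B.coeff (f + g) = B.coeff f + B.coeff g := by
  obtain ⟨β, hf⟩ := B.coeff_spec f
  obtain ⟨γ, hg⟩ := B.coeff_spec g
  rw [← B.coeff_eq (a := a) (B.coeff f + B.coeff g) (β + γ)]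
  congr 1
  conv_lhs => rw [hf, hg]
  module

lemma coeff_smul {a : W} (k : K) (f : B.P a ⟶ B.P a) : B.coeff (k • f) = k * B.coeff f := by
  obtain ⟨β, hf⟩ := B.coeff_spec f
  rw [← B.coeff_eq (a := a) (k * B.coeff f) (k * β)]
  congr 1
  conv_lhs => rw [hf]
  module

lemma coeff_comp {a : W} (f g : B.P a ⟶ B.P a) : B.coeff (f ≫ g) = B.coeff f * B.coeff g := by
  obtain ⟨β, hf⟩ := B.coeff_spec f
  obtain ⟨γ, hg⟩ := B.coeff_spec g
  rw [← B.coeff_eq (a := a) (B.coeff f * B.coeff g) (B.coeff f * γ + β * B.coeff g)]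
  congr 1
  conv_lhs => rw [hf, hg]
  simp only [Preadditive.add_comp, Preadditive.comp_add, Linear.smul_comp, Linear.comp_smul,
    Category.id_comp, Category.comp_id, B.c_self_comp]
  module

lemma comp_c {a : W} (f : B.P a ⟶ B.P a) (b : W) : f ≫ B.c a b = B.coeff f • B.c a b := by
  obtain ⟨β, hf⟩ := B.coeff_spec f
  conv_lhs => rw [hf]
  simp [B.c_self_comp_c]

lemma c_comp {b : W} (f : B.P b ⟶ B.P b) (a : W) : B.c a b ≫ f = B.coeff f • B.c a b := by
  obtain ⟨β, hf⟩ := B.coeff_spec f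
  conv_lhs => rw [hf]
  simp [B.c_comp_c_self]

open scoped Classical in
/-- The identity if `a = b`, and zero otherwise. -/
noncomputable def idm (a b : W) : B.P a ⟶ B.P b := if h : a = b then eqToHom (by rw [h]) else 0

@[simp]
lemma idm_self (a : W) : B.idm a a = 𝟙 _ := by simp [idm]

lemma idm_ne {a b : W} (h : a ≠ b) : B.idm a b = 0 := by simp [idm, h]

section Matrices

variable [Fintype W] [HasFiniteBiproducts C]

/-- The direct sum of the `P a` for the ancestors `a` of `w` in depths of parity `j`. -/
noncomputable abbrev X (j : ℕ) (w : W) : C := ⨁ fun a : {a // a ∈ R.path j w} => B.P a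

/-- The morphism between the objects `X j w` given by a matrix of morphisms. -/
noncomputable def mat (j k : ℕ) (w x : W) (M : ∀ a b, B.P a ⟶ B.P b) : B.X j w ⟶ B.X k x :=
  biproduct.matrix fun a b => M a b

open scoped Classical in
/-- The entries of a morphism between the objects `X j w`. -/
noncomputable def ent {j k : ℕ} {w x : W} (f : B.X j w ⟶ B.X k x) (a b : W) : B.P a ⟶ B.P b :=
  if h : a ∈ R.path j w ∧ b ∈ R.path k x then biproduct.components f ⟨a, h.1⟩ ⟨b, h.2⟩ else 0

lemma ent_of_mem {j k : ℕ} {w x : W} (f : B.X j w ⟶ B.X k x) {a b : W} (ha : a ∈ R.path j w)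
    (hb : b ∈ R.path k x) : B.ent f a b = biproduct.components f ⟨a, ha⟩ ⟨b, hb⟩ := by
  simp only [ent]
  rw [dif_pos ⟨ha, hb⟩]

lemma mat_ext_iff {j k : ℕ} {w x : W} {M N : ∀ a b, B.P a ⟶ B.P b} :
    B.mat j k w x M = B.mat j k w x N ↔
      ∀ a ∈ R.path j w, ∀ b ∈ R.path k x, M a b = N a b := by
  constructor
  · intro h a ha b hb
    have := congrArg (fun f => biproduct.components f ⟨a, ha⟩ ⟨b, hb⟩) h
    simpa [mat, biproduct.matrix_components] using this
  · intro h
    unfold mat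
    congr 1
    funext a b
    exact h a a.2 b b.2

lemma mat_ent {j k : ℕ} {w x : W} (f : B.X j w ⟶ B.X k x) : B.mat j k w x (B.ent f) = f := by
  conv_rhs => rw [← biproduct.components_matrix f]
  unfold mat
  congr 1
  funext a b
  exact B.ent_of_mem f a.2 b.2

lemma ent_mat {j k : ℕ} {w x : W} (M : ∀ a b, B.P a ⟶ B.P b) {a b : W}
    (ha : a ∈ R.path j w) (hb : b ∈ R.path k x) : B.ent (B.mat j k w x M) a b = M a b :=
  B.mat_ext_iff.1 (B.mat_ent (B.mat j k w x M)) a ha b hb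

lemma mat_comp {j k l : ℕ} {w x y : W} (M N : ∀ a b, B.P a ⟶ B.P b) :
    B.mat j k w x M ≫ B.mat k l x y N =
      B.mat j l w y fun a b => ∑ q ∈ R.path k x, M a q ≫ N q b := by
  unfold mat
  ext b a
  simp only [biproduct.ι_matrix_assoc, biproduct.matrix_π, biproduct.lift_desc,
    biproduct.ι_desc, Category.assoc]
  exact Finset.sum_coe_sort (R.path k x) fun q => M a q ≫ N q b

lemma mat_add {j k : ℕ} {w x : W} (M N : ∀ a b, B.P a ⟶ B.P b) :
    B.mat j k w x (fun a b => M a b + N a b) = B.mat j k w x M + B.mat j k w x N := by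
  unfold mat; ext a b; simp

lemma mat_smul {j k : ℕ} {w x : W} (r : K) (M : ∀ a b, B.P a ⟶ B.P b) :
    B.mat j k w x (fun a b => r • M a b) = r • B.mat j k w x M := by
  unfold mat; ext a b; simp

lemma mat_zero {j k : ℕ} {w x : W} : B.mat j k w x (fun _ _ => 0) = 0 := by
  unfold mat; ext a b; simp

lemma mat_idm {j : ℕ} {w : W} : B.mat j j w w B.idm = 𝟙 _ := by
  unfold mat
  ext a b
  by_cases h : a = b
  · subst h; simp
  · simp [biproduct.ι_π_ne _ (Ne.symm h), B.idm_ne (fun e => h (Subtype.ext e.symm))]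

/-- The differential of the two-term complex of `w`. -/
noncomputable def diff (w : W) : B.X 0 w ⟶ B.X 1 w := B.mat 0 1 w w B.c

end Matrices

end BrauerSystem

namespace BrauerSystem

variable {K : Type u} [Field K] {W : Type} {R : PlaneTree W} {C : Type w}
    [Category.{v} C] [Preadditive C] [Linear K C] (B : BrauerSystem K R C)

open scoped Classical in
variable (K) in
/-- The matrix with a single nonzero entry. -/
noncomputable def unitMatrix (a b : W) : W → W → K := fun a' b' => if a' = a ∧ b' = b then 1 else 0

lemma unitMatrix_self (a b : W) : unitMatrix K a b a b = 1 := by simp [unitMatrix]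

lemma unitMatrix_left {a b a' b' : W} (h : a' ≠ a) : unitMatrix K a b a' b' = 0 := by
  simp [unitMatrix, h]

lemma unitMatrix_right {a b a' b' : W} (h : b' ≠ b) : unitMatrix K a b a' b' = 0 := by
  simp [unitMatrix, h]

lemma mem_of_unitMatrix_mem [Fintype W] (N : Submodule K (W → W → K)) (ν : W → W → K)
    (h : ∀ a b, ν a b ≠ 0 → unitMatrix K a b ∈ N) : ν ∈ N := by
  classical
  have hν : ν = ∑ a, ∑ b, ν a b • unitMatrix K a b := by
    funext a b
    simp [Finset.sum_apply, unitMatrix, ite_and]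
  rw [hν]
  refine N.sum_mem fun a _ => N.sum_mem fun b _ => ?_
  by_cases h' : ν a b = 0
  · rw [h', zero_smul]; exact N.zero_mem
  · exact N.smul_mem _ (h a b h')

variable [Fintype W] [HasFiniteBiproducts C]

/-- The morphism given by a matrix of multiples of the morphisms `c a b`. -/
noncomputable def cmat (j k : ℕ) (w x : W) : (W → W → K) →ₗ[K] (B.X j w ⟶ B.X k x) where
  toFun ν := B.mat j k w x fun a b => ν a b • B.c a b
  map_add' ν μ := by
    rw [← B.mat_add]
    simp only [Pi.add_apply, add_smul]
  map_smul' r ν := by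
    rw [RingHom.id_apply, ← B.mat_smul]
    simp only [Pi.smul_apply, smul_eq_mul, mul_smul]

lemma cmat_apply (j k : ℕ) (w x : W) (ν : W → W → K) :
    B.cmat j k w x ν = B.mat j k w x fun a b => ν a b • B.c a b := rfl

lemma exists_cmat_of_ne {j k : ℕ} (hjk : j ≠ k) {w x : W} (g : B.X j w ⟶ B.X k x) :
    ∃ ν, g = B.cmat j k w x ν := by
  have h : ∀ a b, ∃ β : K, a ∈ R.path j w → b ∈ R.path k x → B.ent g a b = β • B.c a b := by
    intro a b
    by_cases hab : a = b
    · refine ⟨0, fun ha hb => ?_⟩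
      subst hab
      simp only [PlaneTree.mem_path] at ha hb
      exact absurd (ha.2.symm.trans hb.2) hjk
    · obtain ⟨β, hβ⟩ := B.span_ne hab (B.ent g a b)
      exact ⟨β, fun _ _ => hβ⟩
  choose ν hν using h
  refine ⟨ν, ?_⟩
  conv_lhs => rw [← B.mat_ent g]
  exact B.mat_ext_iff.2 fun a ha b hb => hν a b ha hb

open scoped Classical in
/-- The truncation of the identity matrix to the ancestors of `u`. -/
noncomputable def truncId (u a b : W) : B.P a ⟶ B.P b := if R.Anc a u then B.idm a b else 0

lemma mat_truncId_comp_diff {u w x : W} (hx : R.Anc u x) :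
    B.mat 0 0 w x (B.truncId u) ≫ B.diff x =
      B.mat 0 1 w x fun a b => B.truncId u a a ≫ B.c a b := by
  rw [diff, mat_comp, mat_ext_iff]
  intro a ha b _
  rw [PlaneTree.mem_path] at ha
  by_cases h : R.Anc a u
  · refine Finset.sum_eq_single a (fun q _ hq => ?_) fun h' => ?_
    · simp [truncId, B.idm_ne (Ne.symm hq)]
    · exact absurd (PlaneTree.mem_path.2 ⟨h.trans hx, ha.2⟩) h'
  · simp [truncId, h]

lemma diff_comp_mat_truncId {u w x : W} (hw : R.Anc u w) :
    B.diff w ≫ B.mat 1 1 w x (B.truncId u) =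
      B.mat 0 1 w x fun a b => B.c a b ≫ B.truncId u b b := by
  rw [diff, mat_comp, mat_ext_iff]
  intro a _ b hb
  rw [PlaneTree.mem_path] at hb
  by_cases h : R.Anc b u
  · refine Finset.sum_eq_single b (fun q _ hq => ?_) fun h' => ?_
    · simp [truncId, B.idm_ne hq]
    · exact absurd (PlaneTree.mem_path.2 ⟨h.trans hw, hb.2⟩) h'
  · rw [Finset.sum_eq_zero]
    · simp [truncId, h]
    · intro q _
      by_cases hq : q = b
      · subst hq; simp [truncId, h]
      · simp [truncId, B.idm_ne hq]

/-- Every morphism from the degree zero part of one of the two-term complexes to the degree one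
part of another one is null-homotopic. -/
theorem exists_homotopy_one (w x : W) (g : B.X 0 w ⟶ B.X 1 x) :
    ∃ h₀ h₁, g = h₀ ≫ B.diff x + B.diff w ≫ h₁ := by
  let N : Submodule K (W → W → K) :=
    { carrier := {ν | ∃ h₀ h₁, B.cmat 0 1 w x ν = h₀ ≫ B.diff x + B.diff w ≫ h₁}
      add_mem' := by
        rintro ν μ ⟨h₀, h₁, h⟩ ⟨h₀', h₁', h'⟩
        refine ⟨h₀ + h₀', h₁ + h₁', ?_⟩
        rw [map_add, h, h', Preadditive.add_comp, Preadditive.comp_add]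
        abel
      zero_mem' := ⟨0, 0, by simp⟩
      smul_mem' := by
        rintro r ν ⟨h₀, h₁, h⟩
        exact ⟨r • h₀, r • h₁, by rw [map_smul, h, Linear.smul_comp, Linear.comp_smul, smul_add]⟩ }
  obtain ⟨ν, rfl⟩ := B.exists_cmat_of_ne zero_ne_one g
  refine mem_of_unitMatrix_mem N ν fun a b _ => ?_
  have key : ∀ u, R.Anc u w → R.Anc u x → ∀ r : K,
      (∀ a' ∈ R.path 0 w, ∀ b' ∈ R.path 1 x, (R.Par a' b' ∨ R.Par b' a') →
        unitMatrix K a b a' b' • B.c a' b' =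
          r • (B.truncId u a' a' ≫ B.c a' b' - B.c a' b' ≫ B.truncId u b' b')) →
      unitMatrix K a b ∈ N := by
    intro u huw hux r h
    refine ⟨r • B.mat 0 0 w x (B.truncId u), - (r • B.mat 1 1 w x (B.truncId u)), ?_⟩
    rw [Linear.smul_comp, B.mat_truncId_comp_diff hux, Preadditive.comp_neg, Linear.comp_smul,
      B.diff_comp_mat_truncId huw, ← neg_smul, ← B.mat_smul, ← B.mat_smul, ← B.mat_add,
      cmat_apply, mat_ext_iff]
    intro a' ha' b' hb'
    by_cases hp : R.Par a' b' ∨ R.Par b' a'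
    · rw [h a' ha' b' hb' hp]; module
    · rw [not_or] at hp
      have : B.c a' b' = 0 := by
        rw [PlaneTree.mem_path] at ha' hb'
        exact B.hom_eq_zero_of_parity (by omega) hp.1 hp.2 _
      simp [this]
  have triv : (∀ a' ∈ R.path 0 w, ∀ b' ∈ R.path 1 x, (R.Par a' b' ∨ R.Par b' a') →
      ¬ (a' = a ∧ b' = b)) → unitMatrix K a b ∈ N := by
    intro h
    refine key R.root (PlaneTree.root_anc w) (PlaneTree.root_anc x) 0 ?_
    intro a' ha' b' hb' hp
    rw [unitMatrix, if_neg (h a' ha' b' hb' hp)]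
    simp
  by_cases hmem : a ∈ R.path 0 w ∧ b ∈ R.path 1 x ∧ (R.Par a b ∨ R.Par b a)
  swap
  · exact triv fun a' ha' b' hb' hp h => hmem (by rw [← h.1, ← h.2]; exact ⟨ha', hb', hp⟩)
  obtain ⟨ha, hb, hp⟩ := hmem
  rw [PlaneTree.mem_path] at ha hb
  rcases hp with hp | hp
  · refine key b (ha.1.par hp) hb.1 (-1) ?_
    intro a' ha' b' hb' hp'
    rw [PlaneTree.mem_path] at ha' hb'
    rcases hp' with hp' | hp'
    · by_cases h₁ : R.Anc a' b
      · have : ¬ (a' = a) := by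
          rintro rfl
          have h₂ := h₁.depth_le
          have := hp.depth
          omega
        simp [truncId, h₁, h₁.par hp', unitMatrix_left this]
      · by_cases h₂ : R.Anc b' b
        · have h₃ : b' = b := by
            refine h₂.eq_of_depth_le ?_
            by_contra h₄
            exact h₁ (ha'.1.of_depth_le (ha.1.par hp) (by have := hp'.depth; omega))
          subst h₃
          have h₅ : a' = a := hp'.eq_of_anc hp ha'.1 ha.1
          subst h₅
          simp [truncId, h₁, h₂, unitMatrix_self]
        · have : ¬ (b' = b) := by
            rintro rfl
            exact h₂ (PlaneTree.Anc.refl _)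
          simp [truncId, h₁, h₂, unitMatrix_right this]
    · have h₀ : ¬ (a' = a ∧ b' = b) := by
        rintro ⟨rfl, rfl⟩
        have := hp.depth
        have := hp'.depth
        omega
      rw [unitMatrix, if_neg h₀]
      by_cases h₁ : R.Anc b' b
      · simp [truncId, h₁, h₁.par hp']
      · by_cases h₂ : R.Anc a' b
        · exfalso
          refine h₁ (hb'.1.of_depth_le hb.1 ?_)
          have := h₂.depth_le
          have := hp'.depth
          omega
        · simp [truncId, h₁, h₂]
  · refine key a ha.1 (hb.1.par hp) 1 ?_
    intro a' ha' b' hb' hp'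
    rw [PlaneTree.mem_path] at ha' hb'
    rcases hp' with hp' | hp'
    · have h₀ : ¬ (a' = a ∧ b' = b) := by
        rintro ⟨rfl, rfl⟩
        have := hp.depth
        have := hp'.depth
        omega
      rw [unitMatrix, if_neg h₀]
      by_cases h₁ : R.Anc a' a
      · simp [truncId, h₁, h₁.par hp']
      · by_cases h₂ : R.Anc b' a
        · exfalso
          refine h₁ (ha'.1.of_depth_le ha.1 ?_)
          have := h₂.depth_le
          have := hp'.depth
          omega
        · simp [truncId, h₁, h₂]
    · by_cases h₁ : R.Anc b' a
      · have : ¬ (b' = b) := by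
          rintro rfl
          have h₂ := h₁.depth_le
          have := hp.depth
          omega
        simp [truncId, h₁, h₁.par hp', unitMatrix_right this]
      · by_cases h₂ : R.Anc a' a
        · have h₃ : a' = a := by
            refine h₂.eq_of_depth_le ?_
            by_contra h₄
            exact h₁ (hb'.1.of_depth_le (hb.1.par hp) (by have := hp'.depth; omega))
          subst h₃
          have h₅ : b' = b := hp'.eq_of_anc hp hb'.1 hb.1
          subst h₅
          simp [truncId, h₁, h₂, unitMatrix_self]
        · have : ¬ (a' = a) := by
            rintro rfl
            exact h₂ (PlaneTree.Anc.refl _)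
          simp [truncId, h₁, h₂, unitMatrix_left this]

lemma diff_comp_eq_zero_iff {w x : W} (h : B.X 1 w ⟶ B.X 0 x) : B.diff w ≫ h = 0 ↔
    ∀ a ∈ R.path 0 w, ∀ b ∈ R.path 0 x, ∑ q ∈ R.path 1 w, B.c a q ≫ B.ent h q b = 0 := by
  conv_lhs => rw [← B.mat_ent h, diff, mat_comp, ← B.mat_zero, mat_ext_iff]

lemma comp_diff_eq_zero_iff {w x : W} (h : B.X 1 w ⟶ B.X 0 x) : h ≫ B.diff x = 0 ↔
    ∀ a ∈ R.path 1 w, ∀ b ∈ R.path 1 x, ∑ q ∈ R.path 0 x, B.ent h a q ≫ B.c q b = 0 := by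
  conv_lhs => rw [← B.mat_ent h, diff, mat_comp, ← B.mat_zero, mat_ext_iff]

/-- In the sum over a path of compositions through the neighbours of `u`, only the parent of `u`
and the child of `u` on the path contribute. -/
lemma path_sum_eq {A : Type*} [AddCommMonoid A] {j : ℕ} {w u a : W} (f : W → A)
    (hf : ∀ q ∈ R.path j w, ¬ R.Par u q → ¬ R.Par q u → f q = 0)
    (hu : ∀ q ∈ R.path j w, R.Par u q → f q = 0)
    (ha : a ∈ R.path j w) (hau : R.Par a u) : ∑ q ∈ R.path j w, f q = f a := by
  refine Finset.sum_eq_single a (fun q hq hqa => ?_) fun h => absurd ha h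
  by_cases h₁ : R.Par u q
  · exact hu q hq h₁
  · refine hf q hq h₁ fun h₂ => hqa ?_
    rw [PlaneTree.mem_path] at hq ha
    exact h₂.eq_of_anc hau hq.1 ha.1

/-- The morphisms of degree `-1` between the two-term complexes vanish. -/
theorem eq_zero_of_comp_diff_eq_zero {w x : W} (h : B.X 1 w ⟶ B.X 0 x) (h₁ : B.diff w ≫ h = 0)
    (h₂ : h ≫ B.diff x = 0) : h = 0 := by
  rw [diff_comp_eq_zero_iff] at h₁
  rw [comp_diff_eq_zero_iff] at h₂
  obtain ⟨ν, hν⟩ := B.exists_cmat_of_ne one_ne_zero h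
  have hent : ∀ a ∈ R.path 1 w, ∀ b ∈ R.path 0 x, B.ent h a b = ν a b • B.c a b := by
    intro a ha b hb
    conv_lhs => rw [hν, cmat_apply]
    exact B.ent_mat _ ha hb
  have key : ∀ n, ∀ u, R.depth u = n → R.Anc u w → R.Anc u x →
      (R.depth u % 2 = 0 → ∀ a ∈ R.path 1 w, R.Par a u → ν a u = 0) ∧
      (R.depth u % 2 = 1 → ∀ b ∈ R.path 0 x, R.Par b u → ν u b = 0) := by
    intro n
    induction n with
    | zero =>
      intro u hu huw hux
      refine ⟨fun _ a ha hau => ?_, fun h => by omega⟩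
      have hu0 := PlaneTree.eq_root_of_depth hu
      have h₃ := h₁ u (by simp [huw, hu]) u (by simp [hux, hu])
      rw [path_sum_eq (u := u) (a := a) _ _ _ ha hau,
        hent a ha u (by simp [hux, hu]), Linear.comp_smul, B.c_par' hau] at h₃
      · exact (smul_eq_zero.1 h₃).resolve_right (B.c_self_ne_zero u)
      · intro q hq h₃ h₄
        rw [PlaneTree.mem_path] at hq
        rw [B.hom_eq_zero_of_parity (by omega) h₃ h₄ (B.c u q), zero_comp]
      · intro q hq h₃
        exact absurd hu0 h₃.1
    | succ n ih =>
      intro u hu huw hux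
      have hroot : u ≠ R.root := by rintro rfl; rw [R.depth_root] at hu; omega
      have hpu := PlaneTree.par_parent hroot
      have hpd := hpu.depth
      obtain ⟨ih₁, ih₂⟩ := ih (R.parent u) (by omega) (huw.par hpu) (hux.par hpu)
      constructor
      · intro hev a ha hau
        have hmx : u ∈ R.path 0 x := by simp [hux, hev]
        have h₃ := h₁ u (by simp [huw, hev]) u hmx
        rw [path_sum_eq (u := u) (a := a) _ _ _ ha hau, hent a ha u hmx,
          Linear.comp_smul, B.c_par' hau] at h₃
        · exact (smul_eq_zero.1 h₃).resolve_right (B.c_self_ne_zero u)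
        · intro q hq h₃ h₄
          rw [PlaneTree.mem_path] at hq
          rw [B.hom_eq_zero_of_parity (by omega) h₃ h₄ (B.c u q), zero_comp]
        · intro q hq h₃
          rw [hent q hq u hmx, h₃.unique hpu, ih₂ (by omega) u hmx hpu]
          simp
      · intro hod b hb hbu
        have hmw : u ∈ R.path 1 w := by simp [huw, hod]
        have h₃ := h₂ u hmw u (by simp [hux, hod])
        rw [path_sum_eq (u := u) (a := b) _ _ _ hb hbu, hent u hmw b hb,
          Linear.smul_comp, B.c_par' hbu] at h₃
        · exact (smul_eq_zero.1 h₃).resolve_right (B.c_self_ne_zero u)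
        · intro q hq h₃ h₄
          rw [PlaneTree.mem_path] at hq
          rw [B.hom_eq_zero_of_parity (by omega) h₄ h₃ (B.c q u), comp_zero]
        · intro q hq h₃
          rw [hent u hmw q hq, h₃.unique hpu, ih₁ (by omega) u hmw hpu]
          simp
  rw [hν, cmat_apply, ← B.mat_zero, mat_ext_iff]
  intro a ha b hb
  have ha' := PlaneTree.mem_path.1 ha
  have hb' := PlaneTree.mem_path.1 hb
  by_cases hab : R.Par a b
  · rw [(key _ b rfl (ha'.1.par hab) hb'.1).1 hb'.2 a ha hab, zero_smul]
  · by_cases hba : R.Par b a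
    · rw [(key _ a rfl ha'.1 (hb'.1.par hba)).2 ha'.2 b hb hba, zero_smul]
    · rw [B.hom_eq_zero_of_parity (by omega) hab hba (B.c a b), smul_zero]

end BrauerSystem

namespace BrauerSystem

variable {K : Type u} [Field K] {W : Type} {R : PlaneTree W} {C : Type w}
    [Category.{v} C] [Preadditive C] [Linear K C] (B : BrauerSystem K R C)
    [Fintype W] [HasFiniteBiproducts C]

/-- The matrices of the null-homotopic morphisms between the two-term complexes. -/
def nullMatrices (w x : W) : Submodule K (W → W → K) where
  carrier := {ν | ∃ h : B.X 1 w ⟶ B.X 0 x,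
    B.cmat 0 0 w x ν = B.diff w ≫ h ∧ B.cmat 1 1 w x ν = h ≫ B.diff x}
  add_mem' := by
    rintro ν μ ⟨h, h₀, h₁⟩ ⟨h', h₀', h₁'⟩
    exact ⟨h + h', by rw [map_add, h₀, h₀', Preadditive.comp_add],
      by rw [map_add, h₁, h₁', Preadditive.add_comp]⟩
  zero_mem' := ⟨0, by simp, by simp⟩
  smul_mem' := by
    rintro r ν ⟨h, h₀, h₁⟩
    exact ⟨r • h, by rw [map_smul, h₀, Linear.comp_smul], by rw [map_smul, h₁, Linear.smul_comp]⟩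

lemma mem_nullMatrices_of_forall {w x : W} {ν : W → W → K}
    (h : ∀ j, ∀ a ∈ R.path j w, ∀ b ∈ R.path j x, ν a b • B.c a b = 0) :
    ν ∈ B.nullMatrices w x := by
  refine ⟨0, ?_, ?_⟩
  · rw [comp_zero, cmat_apply, ← B.mat_zero, mat_ext_iff]
    exact h 0
  · rw [zero_comp, cmat_apply, ← B.mat_zero, mat_ext_iff]
    exact h 1

open scoped Classical in
lemma mem_nullMatrices_of_single {w x : W} {ν : W → W → K} {a b : W} (ha : a ∈ R.path 1 w)
    (hb : b ∈ R.path 0 x)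
    (h₀ : ∀ a' ∈ R.path 0 w, ∀ b' ∈ R.path 0 x,
      ν a' b' • B.c a' b' = if b' = b then B.c a' a ≫ B.c a b' else 0)
    (h₁ : ∀ a' ∈ R.path 1 w, ∀ b' ∈ R.path 1 x,
      ν a' b' • B.c a' b' = if a' = a then B.c a' b ≫ B.c b b' else 0) :
    ν ∈ B.nullMatrices w x := by
  refine ⟨B.cmat 1 0 w x (unitMatrix K a b), ?_, ?_⟩
  · rw [cmat_apply, cmat_apply, diff, mat_comp, mat_ext_iff]
    intro a' ha' b' hb'
    rw [h₀ a' ha' b' hb', Finset.sum_eq_single a]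
    · split_ifs with h
      · subst h; simp [unitMatrix_self]
      · simp [unitMatrix_right h]
    · intro q _ hq
      simp [unitMatrix_left hq]
    · exact fun h => absurd ha h
  · rw [cmat_apply, cmat_apply, diff, mat_comp, mat_ext_iff]
    intro a' ha' b' hb'
    rw [h₁ a' ha' b' hb', Finset.sum_eq_single b]
    · split_ifs with h
      · subst h; simp [unitMatrix_self]
      · simp [unitMatrix_left h]
    · intro q _ hq
      simp [unitMatrix_right hq]
    · exact fun h => absurd hb h

lemma c_comp_c_eq_zero {a b d : W} (h : R.depth a % 2 = R.depth d % 2)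
    (h' : R.depth a ≠ R.depth d) : B.c a b ≫ B.c b d = 0 :=
  B.hom_eq_zero_of_depth_ne h' h _

lemma unitMatrix_add_mem_nullMatrices {w x u v : W} (hw : R.Anc u w) (hx : R.Anc u x)
    (huv : R.Par u v) : unitMatrix K u u + unitMatrix K v v ∈ B.nullMatrices w x := by
  classical
  have hd := huv.depth
  have huv' : u ≠ v := by rintro rfl; omega
  have heq : ∀ {j}, ∀ a' ∈ R.path j w, ∀ z, R.Anc z w → R.depth a' = R.depth z → a' = z :=
    fun a' ha' z hz h => (PlaneTree.mem_path.1 ha').1.eq_of_depth_eq hz h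
  have heq' : ∀ {j}, ∀ a' ∈ R.path j x, ∀ z, R.Anc z x → R.depth a' = R.depth z → a' = z :=
    fun a' ha' z hz h => (PlaneTree.mem_path.1 ha').1.eq_of_depth_eq hz h
  rcases Nat.mod_two_eq_zero_or_one (R.depth u) with hu | hu
  · refine B.mem_nullMatrices_of_single (a := v) (b := u)
      (PlaneTree.mem_path.2 ⟨hw.par huv, by omega⟩) (PlaneTree.mem_path.2 ⟨hx, hu⟩) ?_ ?_
    · intro a' ha' b' hb'
      have ha := (PlaneTree.mem_path.1 ha').2
      have hb := (PlaneTree.mem_path.1 hb').2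
      have h₁ : b' ≠ v := by rintro rfl; omega
      split_ifs with h
      · subst h
        by_cases h₂ : a' = b'
        · subst h₂; simp [unitMatrix_self, unitMatrix_right h₁, B.c_par huv]
        · rw [B.c_comp_c_eq_zero (by omega) (fun e => h₂ (heq a' ha' b' hw e))]
          simp [unitMatrix_left h₂, unitMatrix_right h₁]
      · simp [unitMatrix_right h, unitMatrix_right h₁]
    · intro a' ha' b' hb'
      have ha := (PlaneTree.mem_path.1 ha').2
      have hb := (PlaneTree.mem_path.1 hb').2
      have h₁ : a' ≠ u := by rintro rfl; omega
      split_ifs with h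
      · subst h
        by_cases h₂ : b' = a'
        · subst h₂; simp [unitMatrix_self, unitMatrix_left h₁, B.c_par' huv]
        · rw [B.c_comp_c_eq_zero (by omega) (fun e => h₂ (heq' b' hb' a' (hx.par huv) e.symm))]
          simp [unitMatrix_left h₁, unitMatrix_right h₂]
      · simp [unitMatrix_left h, unitMatrix_left h₁]
  · refine B.mem_nullMatrices_of_single (a := u) (b := v)
      (PlaneTree.mem_path.2 ⟨hw, hu⟩) (PlaneTree.mem_path.2 ⟨hx.par huv, by omega⟩) ?_ ?_
    · intro a' ha' b' hb'
      have ha := (PlaneTree.mem_path.1 ha').2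
      have hb := (PlaneTree.mem_path.1 hb').2
      have h₁ : b' ≠ u := by rintro rfl; omega
      split_ifs with h
      · subst h
        by_cases h₂ : a' = b'
        · subst h₂; simp [unitMatrix_self, unitMatrix_right h₁, B.c_par' huv]
        · rw [B.c_comp_c_eq_zero (by omega) (fun e => h₂ (heq a' ha' b' (hw.par huv) e))]
          simp [unitMatrix_left h₂, unitMatrix_right h₁]
      · simp [unitMatrix_right h, unitMatrix_right h₁]
    · intro a' ha' b' hb'
      have ha := (PlaneTree.mem_path.1 ha').2
      have hb := (PlaneTree.mem_path.1 hb').2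
      have h₁ : a' ≠ v := by rintro rfl; omega
      split_ifs with h
      · subst h
        by_cases h₂ : b' = a'
        · subst h₂; simp [unitMatrix_self, unitMatrix_left h₁, B.c_par huv]
        · rw [B.c_comp_c_eq_zero (by omega) (fun e => h₂ (heq' b' hb' a' hx e.symm))]
          simp [unitMatrix_left h₁, unitMatrix_right h₂]
      · simp [unitMatrix_left h, unitMatrix_left h₁]

/-- A matrix supported at `(u, u)` and at pairs of siblings below `u` is null-homotopic by way of
a child `b` of `u` below which `x` lies but `w` does not. -/
lemma mem_nullMatrices_of_odd {w x u b : W} {ν : W → W → K} (hw : R.Anc u w)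
    (hu : R.depth u % 2 = 1) (hbu : R.Par b u) (hb : R.Anc b x) (hνu : ν u u = 1)
    (hν₁ : ∀ a' b', a' ∈ R.path 1 w → b' ∈ R.path 1 x → (a' ≠ u ∨ b' ≠ u) → ν a' b' = 0)
    (hν₂ : ∀ a' b', a' ∈ R.path 0 w → b' ∈ R.path 0 x → b' ≠ b → ν a' b' = 0)
    (hν₃ : ∀ a', ¬ R.Par a' u → ν a' b = 0)
    (hν₄ : ∀ a', R.Par a' u → R.Anc a' w → R.Sib a' b ∧
      ((R.pos a' < R.pos b ∧ ν a' b = 0) ∨ (R.pos b < R.pos a' ∧ ν a' b = 1))) :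
    ν ∈ B.nullMatrices w x := by
  classical
  have hd := hbu.depth
  refine B.mem_nullMatrices_of_single (a := u) (b := b)
    (PlaneTree.mem_path.2 ⟨hw, hu⟩) (PlaneTree.mem_path.2 ⟨hb, by omega⟩) ?_ ?_
  · intro a' ha' b' hb'
    split_ifs with h
    · subst h
      rw [PlaneTree.mem_path] at ha' hb'
      by_cases h₁ : R.Par a' u
      · obtain ⟨hs, ⟨hp, h₂⟩ | ⟨hp, h₂⟩⟩ := hν₄ a' h₁ ha'.1
        · rw [h₂, B.over_lt hs h₁ hp, zero_smul]
        · rw [h₂, B.over_gt hs h₁ hp, one_smul]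
      · rw [hν₃ a' h₁, zero_smul]
        by_cases h₂ : R.Par u a'
        · rw [B.c_comp_c_eq_zero (by omega) (by have := h₂.depth; omega)]
        · rw [B.hom_eq_zero_of_parity (by omega) h₁ h₂ (B.c a' u), zero_comp]
    · rw [hν₂ a' b' ha' hb' h, zero_smul]
  · intro a' ha' b' hb'
    split_ifs with h
    · subst h
      by_cases h₁ : b' = a'
      · subst h₁; rw [hνu, B.c_par' hbu, one_smul]
      · rw [hν₁ a' b' ha' hb' (Or.inr h₁), zero_smul]
        rw [PlaneTree.mem_path] at ha' hb'
        rw [B.c_comp_c_eq_zero (by omega)]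
        intro e
        exact h₁ (hb'.1.eq_of_depth_eq (hb.par hbu) e.symm)
    · rw [hν₁ a' b' ha' hb' (Or.inl h), zero_smul]

/-- A matrix supported at `(u, u)` and at pairs of siblings below `u` is null-homotopic by way of
a child `a` of `u` below which `w` lies but `x` does not. -/
lemma mem_nullMatrices_of_even {w x u a : W} {ν : W → W → K} (hx : R.Anc u x)
    (hu : R.depth u % 2 = 0) (hau : R.Par a u) (ha : R.Anc a w) (hνu : ν u u = 1)
    (hν₁ : ∀ a' b', a' ∈ R.path 0 w → b' ∈ R.path 0 x → (a' ≠ u ∨ b' ≠ u) → ν a' b' = 0)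
    (hν₂ : ∀ a' b', a' ∈ R.path 1 w → b' ∈ R.path 1 x → a' ≠ a → ν a' b' = 0)
    (hν₃ : ∀ b', ¬ R.Par b' u → ν a b' = 0)
    (hν₄ : ∀ b', R.Par b' u → R.Anc b' x → R.Sib a b' ∧
      ((R.pos a < R.pos b' ∧ ν a b' = 0) ∨ (R.pos b' < R.pos a ∧ ν a b' = 1))) :
    ν ∈ B.nullMatrices w x := by
  classical
  have hd := hau.depth
  refine B.mem_nullMatrices_of_single (a := a) (b := u)
    (PlaneTree.mem_path.2 ⟨ha, by omega⟩) (PlaneTree.mem_path.2 ⟨hx, hu⟩) ?_ ?_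
  · intro a' ha' b' hb'
    split_ifs with h
    · subst h
      by_cases h₁ : a' = b'
      · subst h₁; rw [hνu, B.c_par' hau, one_smul]
      · rw [hν₁ a' b' ha' hb' (Or.inl h₁), zero_smul]
        rw [PlaneTree.mem_path] at ha' hb'
        rw [B.c_comp_c_eq_zero (by omega)]
        intro e
        exact h₁ (ha'.1.eq_of_depth_eq (ha.par hau) e)
    · rw [hν₁ a' b' ha' hb' (Or.inr h), zero_smul]
  · intro a' ha' b' hb'
    split_ifs with h
    · subst h
      rw [PlaneTree.mem_path] at ha' hb'
      by_cases h₁ : R.Par b' u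
      · obtain ⟨hs, ⟨hp, h₂⟩ | ⟨hp, h₂⟩⟩ := hν₄ b' h₁ hb'.1
        · rw [h₂, B.over_lt hs hau hp, zero_smul]
        · rw [h₂, B.over_gt hs hau hp, one_smul]
      · rw [hν₃ b' h₁, zero_smul]
        by_cases h₂ : R.Par u b'
        · rw [B.c_comp_c_eq_zero (by omega) (by have := h₂.depth; omega)]
        · rw [B.hom_eq_zero_of_parity (by omega) h₂ h₁ (B.c u b'), comp_zero]
    · rw [hν₂ a' b' ha' hb' h, zero_smul]

lemma unitMatrix_mem_of_odd {w x u b : W} (hw : R.Anc u w) (hu : R.depth u % 2 = 1)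
    (hbu : R.Par b u) (hb : R.Anc b x)
    (h : ∀ a', R.Par a' u → R.Anc a' w → R.Sib a' b ∧ R.pos a' < R.pos b) :
    unitMatrix K u u ∈ B.nullMatrices w x := by
  have hbu' : b ≠ u := by rintro rfl; have := hbu.depth; omega
  refine B.mem_nullMatrices_of_odd hw hu hbu hb (unitMatrix_self u u) ?_ ?_ ?_ ?_
  · rintro a' b' - - (h | h)
    · exact unitMatrix_left h
    · exact unitMatrix_right h
  · intro a' b' ha' hb' _
    refine unitMatrix_left ?_
    rintro rfl
    rw [PlaneTree.mem_path] at ha'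
    omega
  · exact fun a' _ => unitMatrix_right hbu'
  · exact fun a' h₁ h₂ => ⟨(h a' h₁ h₂).1, Or.inl ⟨(h a' h₁ h₂).2, unitMatrix_right hbu'⟩⟩

lemma unitMatrix_mem_of_even {w x u a : W} (hx : R.Anc u x) (hu : R.depth u % 2 = 0)
    (hau : R.Par a u) (ha : R.Anc a w)
    (h : ∀ b', R.Par b' u → R.Anc b' x → R.Sib a b' ∧ R.pos a < R.pos b') :
    unitMatrix K u u ∈ B.nullMatrices w x := by
  have hau' : a ≠ u := by rintro rfl; have := hau.depth; omega
  refine B.mem_nullMatrices_of_even hx hu hau ha (unitMatrix_self u u) ?_ ?_ ?_ ?_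
  · rintro a' b' - - (h | h)
    · exact unitMatrix_left h
    · exact unitMatrix_right h
  · intro a' b' ha' hb' _
    refine unitMatrix_left ?_
    rintro rfl
    rw [PlaneTree.mem_path] at ha'
    omega
  · exact fun a' _ => unitMatrix_left hau'
  · exact fun a' h₁ h₂ => ⟨(h a' h₁ h₂).1, Or.inl ⟨(h a' h₁ h₂).2, unitMatrix_left hau'⟩⟩

/-- If `w` and `x` diverge at siblings `a` and `b` with `b` before `a`, then the morphism `c a b`
is homotopic to minus the socle endomorphism of the parent. -/
lemma unitMatrix_add_mem_of_sib {w x u a b : W} (hs : R.Sib a b) (hau : R.Par a u)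
    (ha : R.Anc a w) (hb : R.Anc b x) (hpos : R.pos b < R.pos a) :
    unitMatrix K u u + unitMatrix K a b ∈ B.nullMatrices w x := by
  have hbu := hs.par hau
  have hd := hau.depth
  have hd' := hbu.depth
  have hau' : a ≠ u := by rintro rfl; omega
  have hbu' : b ≠ u := by rintro rfl; omega
  rcases Nat.mod_two_eq_zero_or_one (R.depth u) with hu | hu
  · refine B.mem_nullMatrices_of_even (hb.par hbu) hu hau ha ?_ ?_ ?_ ?_ ?_
    · simp [unitMatrix_self, unitMatrix_left hau'.symm]
    · intro a' b' ha' hb' h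
      have : a' ≠ a := by rintro rfl; rw [PlaneTree.mem_path] at ha'; omega
      rcases h with h | h
      · simp [unitMatrix_left h, unitMatrix_left this]
      · simp [unitMatrix_right h, unitMatrix_left this]
    · intro a' b' ha' hb' h
      have : a' ≠ u := by rintro rfl; rw [PlaneTree.mem_path] at ha'; omega
      simp [unitMatrix_left h, unitMatrix_left this]
    · intro b' h
      have : b' ≠ b := by rintro rfl; exact h hbu
      simp [unitMatrix_right this, unitMatrix_left hau']
    · intro b' hb'u hb'
      obtain rfl := hb'u.eq_of_anc hbu hb' hb
      exact ⟨hs, Or.inr ⟨hpos, by simp [unitMatrix_self, unitMatrix_left hau']⟩⟩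
  · refine B.mem_nullMatrices_of_odd (ha.par hau) hu hbu hb ?_ ?_ ?_ ?_ ?_
    · simp [unitMatrix_self, unitMatrix_left hau'.symm]
    · intro a' b' ha' hb' h
      have : a' ≠ a := by rintro rfl; rw [PlaneTree.mem_path] at ha'; omega
      rcases h with h | h
      · simp [unitMatrix_left h, unitMatrix_left this]
      · simp [unitMatrix_right h, unitMatrix_left this]
    · intro a' b' ha' hb' h
      have : a' ≠ u := by rintro rfl; rw [PlaneTree.mem_path] at ha'; omega
      simp [unitMatrix_right h, unitMatrix_left this]
    · intro a' h
      have : a' ≠ a := by rintro rfl; exact h hau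
      simp [unitMatrix_left this, unitMatrix_right hbu']
    · intro a' ha'u ha'
      obtain rfl := ha'u.eq_of_anc hau ha' ha
      exact ⟨hs, Or.inr ⟨hpos, by simp [unitMatrix_self, unitMatrix_right hbu']⟩⟩

/-- The socle endomorphisms of the common ancestors are multiples of each other up to homotopy. -/
lemma exists_unitMatrix_sub_mem {w x u : W} (hw : R.Anc u w) (hx : R.Anc u x) :
    ∃ ε : K, ε ≠ 0 ∧
      unitMatrix K u u - ε • unitMatrix K R.root R.root ∈ B.nullMatrices w x := by
  induction h : R.depth u generalizing u with
  | zero =>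
    rw [PlaneTree.eq_root_of_depth h]
    exact ⟨1, one_ne_zero, by simp⟩
  | succ n ih =>
    have hroot : u ≠ R.root := by rintro rfl; rw [R.depth_root] at h; omega
    have hpu := PlaneTree.par_parent hroot
    have hpd := hpu.depth
    obtain ⟨ε, hε, h₁⟩ := ih (hw.par hpu) (hx.par hpu) (by omega)
    refine ⟨-ε, neg_ne_zero.2 hε, ?_⟩
    convert! (B.nullMatrices w x).sub_mem (B.unitMatrix_add_mem_nullMatrices hw hx hpu) h₁ using 1
    module

lemma unitMatrix_root_mem {w x u : W} (hw : R.Anc u w) (hx : R.Anc u x)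
    (h : unitMatrix K u u ∈ B.nullMatrices w x) :
    unitMatrix K R.root R.root ∈ B.nullMatrices w x := by
  obtain ⟨ε, hε, h₁⟩ := B.exists_unitMatrix_sub_mem hw hx
  have h₂ := (B.nullMatrices w x).sub_mem h h₁
  rw [sub_sub_cancel] at h₂
  exact ((B.nullMatrices w x).smul_mem_iff hε).1 h₂

end BrauerSystem

namespace BrauerSystem

variable {K : Type u} [Field K] {W : Type} {R : PlaneTree W} {C : Type w}
    [Category.{v} C] [Preadditive C] [Linear K C] (B : BrauerSystem K R C)
    [Fintype W] [HasFiniteBiproducts C]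

lemma ent_eq_zero_of_depth_ne {j : ℕ} {w x : W} (f : B.X j w ⟶ B.X j x) {a b : W}
    (ha : a ∈ R.path j w) (hb : b ∈ R.path j x) (h : R.depth a ≠ R.depth b) :
    B.ent f a b = 0 := by
  rw [PlaneTree.mem_path] at ha hb
  exact B.hom_eq_zero_of_depth_ne h (by omega) _

section ChainMap

variable {w x : W} {f₀ : B.X 0 w ⟶ B.X 0 x} {f₁ : B.X 1 w ⟶ B.X 1 x}

lemma comm_entries (hf : f₀ ≫ B.diff x = B.diff w ≫ f₁) {a b : W} (ha : a ∈ R.path 0 w)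
    (hb : b ∈ R.path 1 x) :
    ∑ q ∈ R.path 0 x, B.ent f₀ a q ≫ B.c q b = ∑ q ∈ R.path 1 w, B.c a q ≫ B.ent f₁ q b := by
  rw [← B.mat_ent f₀, ← B.mat_ent f₁, diff, diff, mat_comp, mat_comp, mat_ext_iff] at hf
  exact hf a ha b hb

variable (f₀) in
/-- At most one entry of a row of a morphism of degree zero is nonzero. -/
lemma row_sum {a a' : W} (ha : a ∈ R.path 0 w) (ha' : a' ∈ R.path 0 x)
    (h : R.depth a = R.depth a') (b : W) :
    ∑ q ∈ R.path 0 x, B.ent f₀ a q ≫ B.c q b = B.ent f₀ a a' ≫ B.c a' b := by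
  refine Finset.sum_eq_single a' (fun q hq hqa => ?_) fun h' => absurd ha' h'
  rw [B.ent_eq_zero_of_depth_ne f₀ ha hq, zero_comp]
  intro e
  rw [PlaneTree.mem_path] at hq ha'
  exact hqa (hq.1.eq_of_depth_eq ha'.1 (e.symm.trans h))

variable (f₁) in
/-- At most one entry of a column of a morphism of degree one is nonzero. -/
lemma col_sum {b b' : W} (hb : b ∈ R.path 1 x) (hb' : b' ∈ R.path 1 w)
    (h : R.depth b = R.depth b') (a : W) :
    ∑ q ∈ R.path 1 w, B.c a q ≫ B.ent f₁ q b = B.c a b' ≫ B.ent f₁ b' b := by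
  refine Finset.sum_eq_single b' (fun q hq hqb => ?_) fun h' => absurd hb' h'
  rw [B.ent_eq_zero_of_depth_ne f₁ hq hb, comp_zero]
  intro e
  rw [PlaneTree.mem_path] at hq hb'
  exact hqb (hq.1.eq_of_depth_eq hb'.1 (e.trans h))

variable (f₀) in
lemma row_sum_zero {a : W} (ha : a ∈ R.path 0 w) (h : R.depth x < R.depth a) (b : W) :
    ∑ q ∈ R.path 0 x, B.ent f₀ a q ≫ B.c q b = 0 := by
  refine Finset.sum_eq_zero fun q hq => ?_
  rw [B.ent_eq_zero_of_depth_ne f₀ ha hq, zero_comp]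
  have := (PlaneTree.mem_path.1 hq).1.depth_le
  omega

variable (f₁) in
lemma col_sum_zero {b : W} (hb : b ∈ R.path 1 x) (h : R.depth w < R.depth b) (a : W) :
    ∑ q ∈ R.path 1 w, B.c a q ≫ B.ent f₁ q b = 0 := by
  refine Finset.sum_eq_zero fun q hq => ?_
  rw [B.ent_eq_zero_of_depth_ne f₁ hq hb, comp_zero]
  have := (PlaneTree.mem_path.1 hq).1.depth_le
  omega

/-- The coefficient of the identity of the root component. -/
noncomputable def rootCoeff (f₀ : B.X 0 w ⟶ B.X 0 x) : K := B.coeff (B.ent f₀ R.root R.root)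

/-- The coefficients of the identities are the same at all common ancestors. -/
lemma coeff_ent_eq (hf : f₀ ≫ B.diff x = B.diff w ≫ f₁) {u : W} (hw : R.Anc u w)
    (hx : R.Anc u x) :
    (R.depth u % 2 = 0 → B.coeff (B.ent f₀ u u) = B.rootCoeff f₀) ∧
    (R.depth u % 2 = 1 → B.coeff (B.ent f₁ u u) = B.rootCoeff f₀) := by
  induction h : R.depth u generalizing u with
  | zero =>
    rw [PlaneTree.eq_root_of_depth h]
    exact ⟨fun _ => rfl, fun h => by omega⟩
  | succ n ih =>
    have hroot : u ≠ R.root := by rintro rfl; rw [R.depth_root] at h; omega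
    have hpu := PlaneTree.par_parent hroot
    have hpd := hpu.depth
    obtain ⟨ih₁, ih₂⟩ := ih (hw.par hpu) (hx.par hpu) (by omega)
    constructor
    · intro hev
      rw [← ih₂ (by omega)]
      have hu₀ : u ∈ R.path 0 w := by simp [hw, h, hev]
      have hu₁ : u ∈ R.path 0 x := by simp [hx, h, hev]
      have hp₀ : R.parent u ∈ R.path 1 w := PlaneTree.mem_path.2 ⟨hw.par hpu, by omega⟩
      have hp₁ : R.parent u ∈ R.path 1 x := PlaneTree.mem_path.2 ⟨hx.par hpu, by omega⟩
      have h₁ := B.comm_entries hf hu₀ hp₁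
      rw [B.row_sum f₀ hu₀ hu₁ rfl, B.col_sum f₁ hp₁ hp₀ rfl, B.comp_c, B.c_comp] at h₁
      exact smul_left_injective K (B.c_ne_zero hpu) h₁
    · intro hod
      rw [← ih₁ (by omega)]
      have hu₀ : u ∈ R.path 1 w := by simp [hw, h, hod]
      have hu₁ : u ∈ R.path 1 x := by simp [hx, h, hod]
      have hp₀ : R.parent u ∈ R.path 0 w := PlaneTree.mem_path.2 ⟨hw.par hpu, by omega⟩
      have hp₁ : R.parent u ∈ R.path 0 x := PlaneTree.mem_path.2 ⟨hx.par hpu, by omega⟩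
      have h₁ := B.comm_entries hf hp₀ hu₁
      rw [B.row_sum f₀ hp₀ hp₁ rfl, B.col_sum f₁ hu₁ hu₀ rfl, B.comp_c, B.c_comp] at h₁
      exact (smul_left_injective K (B.c_ne_zero' hpu) h₁).symm

lemma rootCoeff_eq_zero_of_anc_even (hf : f₀ ≫ B.diff x = B.diff w ≫ f₁) (h : R.Anc w x)
    (hne : w ≠ x) (hw : R.depth w % 2 = 0) : B.rootCoeff f₀ = 0 := by
  obtain ⟨b, hbw, hbx⟩ := h.exists_child hne
  have hd := hbw.depth
  have h₀ : w ∈ R.path 0 w := by simp [PlaneTree.Anc.refl, hw]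
  have h₁ : w ∈ R.path 0 x := by simp [h, hw]
  have h₂ : b ∈ R.path 1 x := PlaneTree.mem_path.2 ⟨hbx, by omega⟩
  have h₃ := B.comm_entries hf h₀ h₂
  rw [B.row_sum f₀ h₀ h₁ rfl, B.col_sum_zero f₁ h₂ (by omega), B.comp_c,
    (B.coeff_ent_eq hf (PlaneTree.Anc.refl w) h).1 hw] at h₃
  exact (smul_eq_zero.1 h₃).resolve_right (B.c_ne_zero' hbw)

lemma rootCoeff_eq_zero_of_anc_odd (hf : f₀ ≫ B.diff x = B.diff w ≫ f₁) (h : R.Anc x w)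
    (hne : x ≠ w) (hx : R.depth x % 2 = 1) : B.rootCoeff f₀ = 0 := by
  obtain ⟨a, hax, haw⟩ := h.exists_child hne
  have hd := hax.depth
  have h₀ : x ∈ R.path 1 w := by simp [h, hx]
  have h₁ : x ∈ R.path 1 x := by simp [PlaneTree.Anc.refl, hx]
  have h₂ : a ∈ R.path 0 w := PlaneTree.mem_path.2 ⟨haw, by omega⟩
  have h₃ := B.comm_entries hf h₂ h₁
  rw [B.row_sum_zero f₀ h₂ (by omega), B.col_sum f₁ h₁ h₀ rfl, B.c_comp,
    (B.coeff_ent_eq hf h (PlaneTree.Anc.refl x)).2 hx] at h₃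
  exact (smul_eq_zero.1 h₃.symm).resolve_right (B.c_ne_zero hax)

/-- At a pair of siblings where `w` and `x` diverge, commutation with the differential relates the
coefficient of the identity to the entry between the siblings. -/
lemma comm_sib (hf : f₀ ≫ B.diff x = B.diff w ≫ f₁) {a b u : W} (hs : R.Sib a b)
    (hau : R.Par a u) (ha : R.Anc a w) (hb : R.Anc b x) :
    (R.depth a % 2 = 0 → B.ent f₀ a b ≫ B.c b u = B.rootCoeff f₀ • B.c a u) ∧
    (R.depth a % 2 = 1 → B.c u a ≫ B.ent f₁ a b = B.rootCoeff f₀ • B.c u b) := by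
  have hd := hau.depth
  have hbu := hs.par hau
  have hd' := hbu.depth
  constructor
  · intro h
    have h₁ : a ∈ R.path 0 w := by simp [ha, h]
    have h₂ : b ∈ R.path 0 x := PlaneTree.mem_path.2 ⟨hb, by omega⟩
    have h₃ : u ∈ R.path 1 w := PlaneTree.mem_path.2 ⟨ha.par hau, by omega⟩
    have h₄ : u ∈ R.path 1 x := PlaneTree.mem_path.2 ⟨hb.par hbu, by omega⟩
    have h₅ := B.comm_entries hf h₁ h₄
    rwa [B.row_sum f₀ h₁ h₂ hs.depth, B.col_sum f₁ h₄ h₃ rfl, B.c_comp,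
      (B.coeff_ent_eq hf (ha.par hau) (hb.par hbu)).2 (by omega)] at h₅
  · intro h
    have h₁ : a ∈ R.path 1 w := by simp [ha, h]
    have h₂ : b ∈ R.path 1 x := PlaneTree.mem_path.2 ⟨hb, by omega⟩
    have h₃ : u ∈ R.path 0 w := PlaneTree.mem_path.2 ⟨ha.par hau, by omega⟩
    have h₄ : u ∈ R.path 0 x := PlaneTree.mem_path.2 ⟨hb.par hbu, by omega⟩
    have h₅ := B.comm_entries hf h₃ h₂
    rw [B.row_sum f₀ h₃ h₄ rfl, B.col_sum f₁ h₂ h₁ hs.depth.symm, B.comp_c,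
      (B.coeff_ent_eq hf (ha.par hau) (hb.par hbu)).1 (by omega)] at h₅
    exact h₅.symm

lemma rootCoeff_eq_zero_of_sib (hf : f₀ ≫ B.diff x = B.diff w ≫ f₁) {a b : W} (hs : R.Sib a b)
    (ha : R.Anc a w) (hb : R.Anc b x) (hpos : R.pos b < R.pos a) : B.rootCoeff f₀ = 0 := by
  have hau := PlaneTree.par_parent hs.1
  obtain ⟨h₁, h₂⟩ := B.comm_sib hf hs hau ha hb
  rcases Nat.mod_two_eq_zero_or_one (R.depth a) with h | h
  · obtain ⟨β, hβ⟩ := B.span_ne hs.2.2.1 (B.ent f₀ a b)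
    have h₃ := h₁ h
    rw [hβ, Linear.smul_comp, B.up_gt hs hau hpos, smul_zero] at h₃
    exact (smul_eq_zero.1 h₃.symm).resolve_right (B.c_ne_zero hau)
  · obtain ⟨β, hβ⟩ := B.span_ne hs.2.2.1 (B.ent f₁ a b)
    have h₃ := h₂ h
    rw [hβ, Linear.comp_smul, B.down_gt hs hau hpos, smul_zero] at h₃
    exact (smul_eq_zero.1 h₃.symm).resolve_right (B.c_ne_zero' (hs.par hau))

/-- If there is a morphism whose root coefficient is nonzero between the complexes of different
vertices, then the socle endomorphism of the root is null-homotopic. -/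
theorem unitMatrix_root_mem_of_rootCoeff_ne_zero (hf : f₀ ≫ B.diff x = B.diff w ≫ f₁)
    (h : B.rootCoeff f₀ ≠ 0) (hne : w ≠ x) :
    unitMatrix K R.root R.root ∈ B.nullMatrices w x := by
  rcases R.anc_or_sib w x with h₁ | h₁ | ⟨a, b, hs, ha, hb⟩
  · rcases Nat.mod_two_eq_zero_or_one (R.depth w) with h₂ | h₂
    · exact absurd (B.rootCoeff_eq_zero_of_anc_even hf h₁ hne h₂) h
    · obtain ⟨b, hbw, hbx⟩ := h₁.exists_child hne
      refine B.unitMatrix_root_mem (PlaneTree.Anc.refl w) h₁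
        (B.unitMatrix_mem_of_odd (PlaneTree.Anc.refl w) h₂ hbw hbx fun a' h₃ h₄ => ?_)
      have := h₃.depth
      have := h₄.depth_le
      omega
  · rcases Nat.mod_two_eq_zero_or_one (R.depth x) with h₂ | h₂
    · obtain ⟨a, hax, haw⟩ := h₁.exists_child hne.symm
      refine B.unitMatrix_root_mem h₁ (PlaneTree.Anc.refl x)
        (B.unitMatrix_mem_of_even (PlaneTree.Anc.refl x) h₂ hax haw fun a' h₃ h₄ => ?_)
      have := h₃.depth
      have := h₄.depth_le
      omega
    · exact absurd (B.rootCoeff_eq_zero_of_anc_odd hf h₁ hne.symm h₂) h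
  · have hau := PlaneTree.par_parent hs.1
    have hbu := hs.par hau
    have hpos : R.pos a < R.pos b := by
      rcases lt_trichotomy (R.pos a) (R.pos b) with h₃ | h₃ | h₃
      · exact h₃
      · exact absurd h₃ hs.pos_ne
      · exact absurd (B.rootCoeff_eq_zero_of_sib hf hs ha hb h₃) h
    refine B.unitMatrix_root_mem (ha.par hau) (hb.par hbu) ?_
    rcases Nat.mod_two_eq_zero_or_one (R.depth (R.parent a)) with h₂ | h₂
    · refine B.unitMatrix_mem_of_even (hb.par hbu) h₂ hau ha fun b' h₃ h₄ => ?_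
      obtain rfl := h₃.eq_of_anc hbu h₄ hb
      exact ⟨hs, hpos⟩
    · refine B.unitMatrix_mem_of_odd (ha.par hau) h₂ hbu hb fun a' h₃ h₄ => ?_
      obtain rfl := h₃.eq_of_anc hau h₄ ha
      exact ⟨hs, hpos⟩

/-- A morphism with root coefficient zero is homotopic to a multiple of the socle endomorphism of
the root. -/
theorem exists_nullMatrices_of_rootCoeff_eq_zero (hf : f₀ ≫ B.diff x = B.diff w ≫ f₁)
    (h : B.rootCoeff f₀ = 0) :
    ∃ (β : K) (ν : W → W → K), ν ∈ B.nullMatrices w x ∧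
      f₀ = B.cmat 0 0 w x (ν + β • unitMatrix K R.root R.root) ∧
      f₁ = B.cmat 1 1 w x (ν + β • unitMatrix K R.root R.root) := by
  classical
  have hent : ∀ a b, ∃ β : K, (a ∈ R.path 0 w → b ∈ R.path 0 x → B.ent f₀ a b = β • B.c a b) ∧
      (a ∈ R.path 1 w → b ∈ R.path 1 x → B.ent f₁ a b = β • B.c a b) := by
    intro a b
    rcases Nat.mod_two_eq_zero_or_one (R.depth a) with ha | ha
    · by_cases hab : a = b
      · subst hab
        obtain ⟨β, hβ⟩ := B.coeff_spec (B.ent f₀ a a)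
        refine ⟨β, fun h₁ h₂ => ?_, fun h₁ => ?_⟩
        · rw [PlaneTree.mem_path] at h₁ h₂
          rw [(B.coeff_ent_eq hf h₁.1 h₂.1).1 ha, h, zero_smul, zero_add] at hβ
          exact hβ
        · rw [PlaneTree.mem_path] at h₁
          omega
      · obtain ⟨β, hβ⟩ := B.span_ne hab (B.ent f₀ a b)
        refine ⟨β, fun h₁ h₂ => hβ, fun h₁ => ?_⟩
        rw [PlaneTree.mem_path] at h₁
        omega
    · by_cases hab : a = b
      · subst hab
        obtain ⟨β, hβ⟩ := B.coeff_spec (B.ent f₁ a a)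
        refine ⟨β, fun h₁ => ?_, fun h₁ h₂ => ?_⟩
        · rw [PlaneTree.mem_path] at h₁
          omega
        · rw [PlaneTree.mem_path] at h₁ h₂
          rw [(B.coeff_ent_eq hf h₁.1 h₂.1).2 ha, h, zero_smul, zero_add] at hβ
          exact hβ
      · obtain ⟨β, hβ⟩ := B.span_ne hab (B.ent f₁ a b)
        refine ⟨β, fun h₁ => ?_, fun h₁ h₂ => hβ⟩
        rw [PlaneTree.mem_path] at h₁
        omega
  choose μ hμ using hent
  have h₀ : f₀ = B.cmat 0 0 w x μ := by
    conv_lhs => rw [← B.mat_ent f₀]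
    exact B.mat_ext_iff.2 fun a ha b hb => (hμ a b).1 ha hb
  have h₁ : f₁ = B.cmat 1 1 w x μ := by
    conv_lhs => rw [← B.mat_ent f₁]
    exact B.mat_ext_iff.2 fun a ha b hb => (hμ a b).2 ha hb
  have key : μ ∈ B.nullMatrices w x ⊔ Submodule.span K {unitMatrix K R.root R.root} := by
    refine mem_of_unitMatrix_mem _ _ fun a b hab => ?_
    by_cases hrel : R.Anc a w ∧ R.Anc b x ∧ R.depth a = R.depth b ∧ μ a b • B.c a b ≠ 0
    · obtain ⟨haw, hbx, hd, hc⟩ := hrel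
      have hcc : B.c a b ≠ 0 := fun e => hc (by rw [e, smul_zero])
      have root_mem : ∀ u, R.Anc u w → R.Anc u x → unitMatrix K u u ∈
          B.nullMatrices w x ⊔ Submodule.span K {unitMatrix K R.root R.root} := by
        intro u hu hu'
        obtain ⟨ε, -, hε⟩ := B.exists_unitMatrix_sub_mem hu hu'
        have h₂ := Submodule.add_mem_sup hε (Submodule.smul_mem _ ε
          (Submodule.mem_span_singleton_self (R := K) (unitMatrix K R.root R.root)))
        rwa [sub_add_cancel] at h₂
      by_cases hs : R.Sib a b
      · have hau := PlaneTree.par_parent hs.1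
        rcases lt_trichotomy (R.pos a) (R.pos b) with h₃ | h₃ | h₃
        · exfalso
          obtain ⟨h₄, h₅⟩ := B.comm_sib hf hs hau haw hbx
          rcases Nat.mod_two_eq_zero_or_one (R.depth a) with h₆ | h₆
          · have h₇ := h₄ h₆
            rw [(hμ a b).1 (by simp [haw, h₆]) (PlaneTree.mem_path.2 ⟨hbx, by omega⟩),
              Linear.smul_comp, B.up_lt hs hau h₃, h, zero_smul] at h₇
            exact hab ((smul_eq_zero.1 h₇).resolve_right (B.c_ne_zero hau))
          · have h₇ := h₅ h₆
            rw [(hμ a b).2 (by simp [haw, h₆]) (PlaneTree.mem_path.2 ⟨hbx, by omega⟩),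
              Linear.comp_smul, B.down_lt hs hau h₃, h, zero_smul] at h₇
            exact hab ((smul_eq_zero.1 h₇).resolve_right (B.c_ne_zero' (hs.par hau)))
        · exact absurd h₃ hs.pos_ne
        · have h₄ := B.unitMatrix_add_mem_of_sib hs hau haw hbx h₃
          have h₅ := root_mem _ (haw.par hau) (hbx.par (hs.par hau))
          have h₆ := Submodule.sub_mem _ (Submodule.mem_sup_left h₄) h₅
          rwa [add_sub_cancel_left] at h₆
      · by_cases hab' : a = b
        · subst hab'
          exact root_mem a haw hbx
        · exact absurd (B.c_eq_zero hab' (fun e => by have := e.depth; omega)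
            (fun e => by have := e.depth; omega) hs) hcc
    · refine Submodule.mem_sup_left (B.mem_nullMatrices_of_forall fun j a' ha' b' hb' => ?_)
      by_cases h₂ : a' = a ∧ b' = b
      · obtain ⟨rfl, rfl⟩ := h₂
        rw [PlaneTree.mem_path] at ha' hb'
        have h₃ : B.c a' b' = 0 := by
          by_contra hc
          by_cases hd : R.depth a' = R.depth b'
          · exact hrel ⟨ha'.1, hb'.1, hd, smul_ne_zero hab hc⟩
          · exact hc (B.hom_eq_zero_of_depth_ne hd (by omega) _)
        rw [h₃, smul_zero]
      · rw [unitMatrix, if_neg h₂, zero_smul]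
  obtain ⟨ν, hν, ρ, hρ, rfl⟩ := Submodule.mem_sup.1 key
  obtain ⟨β, rfl⟩ := Submodule.mem_span_singleton.1 hρ
  exact ⟨β, ν, hν, h₀, h₁⟩

end ChainMap

/-- The socle endomorphism of the root is not null-homotopic on the complex of a vertex. -/
theorem unitMatrix_root_notMem (w : W) : unitMatrix K R.root R.root ∉ B.nullMatrices w w := by
  classical
  rintro ⟨h, h₀, h₁⟩
  obtain ⟨ν, rfl⟩ := B.exists_cmat_of_ne one_ne_zero h
  rw [cmat_apply, cmat_apply, diff, mat_comp, mat_ext_iff] at h₀ h₁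
  have hroot : R.root ∈ R.path 0 w := by simp [PlaneTree.root_anc, R.depth_root]
  have e₀ : ∀ u ∈ R.path 0 w, u ≠ R.root →
      ∑ q ∈ R.path 1 w, B.c u q ≫ (ν q u • B.c q u) = 0 := fun u hu hu' => by
    rw [← h₀ u hu u hu, unitMatrix_left hu', zero_smul]
  have e₁ : ∀ u ∈ R.path 1 w, ∑ q ∈ R.path 0 w, (ν u q • B.c u q) ≫ B.c q u = 0 := fun u hu => by
    rw [← h₁ u hu u hu, unitMatrix_left, zero_smul]
    rintro rfl
    rw [PlaneTree.mem_path, R.depth_root] at hu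
    omega
  have key : ∀ n, ∀ b u, R.depth u = n → R.Par b u → R.Anc b w →
      (R.depth u % 2 = 0 → ν b u ≠ 0) ∧ (R.depth u % 2 = 1 → ν u b ≠ 0) := by
    intro n
    induction n with
    | zero =>
      intro b u hu hbu hb
      refine ⟨fun _ hν => ?_, fun h => by omega⟩
      obtain rfl := PlaneTree.eq_root_of_depth hu
      have h₂ := h₀ _ hroot _ hroot
      rw [path_sum_eq (u := R.root) (a := b) _ _ _
        (PlaneTree.mem_path.2 ⟨hb, by have := hbu.depth; omega⟩) hbu, hν,
        unitMatrix_self, zero_smul, comp_zero, one_smul] at h₂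
      · exact B.c_self_ne_zero _ h₂
      · intro q hq h₃ h₄
        rw [PlaneTree.mem_path] at hq
        rw [B.hom_eq_zero_of_parity (by omega) h₃ h₄ (B.c R.root q), zero_comp]
      · exact fun q _ h₃ => absurd h₃ PlaneTree.not_par_root
    | succ n ih =>
      intro b u hu hbu hb
      have hu' : u ≠ R.root := by rintro rfl; rw [R.depth_root] at hu; omega
      have hpu := PlaneTree.par_parent hu'
      have hpd := hpu.depth
      have hbd := hbu.depth
      have huw := hb.par hbu
      have hne : b ≠ R.parent u := by rintro h; rw [h] at hbd; omega
      obtain ⟨ih₁, ih₂⟩ := ih u (R.parent u) (by omega) hpu huw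
      constructor
      · intro hev hν
        have h₂ := e₀ u (by simp [huw, hev]) hu'
        rw [Finset.sum_eq_single (R.parent u), Linear.comp_smul, B.c_par hpu] at h₂
        · exact ih₂ (by omega) ((smul_eq_zero.1 h₂).resolve_right (B.c_self_ne_zero _))
        · intro q hq hqu
          rw [PlaneTree.mem_path] at hq
          by_cases h₃ : R.Par q u
          · rw [h₃.eq_of_anc hbu hq.1 hb, hν, zero_smul, comp_zero]
          · rw [B.hom_eq_zero_of_parity (by omega) (fun h₄ => hqu (h₄.unique hpu)) h₃ (B.c u q),
              zero_comp]
        · exact fun h₃ => absurd (PlaneTree.mem_path.2 ⟨huw.par hpu, by omega⟩) h₃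
      · intro hod hν
        have h₂ := e₁ u (by simp [huw, hod])
        rw [Finset.sum_eq_single (R.parent u), Linear.smul_comp, B.c_par hpu] at h₂
        · exact ih₁ (by omega) ((smul_eq_zero.1 h₂).resolve_right (B.c_self_ne_zero _))
        · intro q hq hqu
          rw [PlaneTree.mem_path] at hq
          by_cases h₃ : R.Par q u
          · rw [h₃.eq_of_anc hbu hq.1 hb, hν, zero_smul, zero_comp]
          · rw [B.hom_eq_zero_of_parity (by omega) h₃ (fun h₄ => hqu (h₄.unique hpu)) (B.c q u),
              comp_zero]
        · exact fun h₃ => absurd (PlaneTree.mem_path.2 ⟨huw.par hpu, by omega⟩) h₃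
  have hchild : ∀ {j} q, q ∈ R.path j w → ¬ R.Par q w := fun q hq h => by
    have := h.depth
    have := (PlaneTree.mem_path.1 hq).1.depth_le
    omega
  by_cases hw : w = R.root
  · subst hw
    have h₂ := h₀ _ hroot _ hroot
    rw [Finset.sum_eq_zero, unitMatrix_self, one_smul] at h₂
    · exact B.c_self_ne_zero _ h₂
    · intro q hq
      have hq' := (PlaneTree.mem_path.1 hq)
      rw [B.hom_eq_zero_of_parity (by rw [R.depth_root]; omega) PlaneTree.not_par_root (hchild q hq) (B.c R.root q),
        zero_comp]
  · have hpw := PlaneTree.par_parent hw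
    have hpd := hpw.depth
    have hww := PlaneTree.Anc.refl (R := R) w
    obtain ⟨k₁, k₂⟩ := key _ w (R.parent w) rfl hpw hww
    rcases Nat.mod_two_eq_zero_or_one (R.depth w) with h₃ | h₃
    · have h₂ := e₀ w (by simp [hww, h₃]) hw
      rw [Finset.sum_eq_single (R.parent w), Linear.comp_smul, B.c_par hpw] at h₂
      · exact k₂ (by omega) ((smul_eq_zero.1 h₂).resolve_right (B.c_self_ne_zero _))
      · intro q hq hqu
        have hq' := (PlaneTree.mem_path.1 hq)
        rw [B.hom_eq_zero_of_parity (by omega) (fun h₄ => hqu (h₄.unique hpw)) (hchild q hq)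
          (B.c w q), zero_comp]
      · exact fun h₃ => absurd (PlaneTree.mem_path.2 ⟨hww.par hpw, by omega⟩) h₃
    · have h₂ := e₁ w (by simp [hww, h₃])
      rw [Finset.sum_eq_single (R.parent w), Linear.smul_comp, B.c_par hpw] at h₂
      · exact k₁ (by omega) ((smul_eq_zero.1 h₂).resolve_right (B.c_self_ne_zero _))
      · intro q hq hqu
        have hq' := (PlaneTree.mem_path.1 hq)
        rw [B.hom_eq_zero_of_parity (by omega) (hchild q hq) (fun h₄ => hqu (h₄.unique hpw))
          (B.c q w), comp_zero]
      · exact fun h₃ => absurd (PlaneTree.mem_path.2 ⟨hww.par hpw, by omega⟩) h₃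

end BrauerSystem

namespace BrauerSystem

variable {K : Type u} [Field K] {W : Type} {R : PlaneTree W} {C : Type w}
    [Category.{v} C] [Preadditive C] [Linear K C] (B : BrauerSystem K R C)

variable (R) in
/-- The condition on `w` and `x` for the existence of a morphism between their complexes which is
the identity on the common part. -/
def Precedes [Fintype W] (w x : W) : Prop :=
  (∀ a ∈ R.path 0 w, ∀ b ∈ R.path 1 x, ¬ R.Anc b w → R.Par b a →
    ∃ a' ∈ R.path 1 w, R.Par a' a ∧ R.pos a' < R.pos b) ∧
  (∀ a ∈ R.path 0 w, ∀ b ∈ R.path 1 x, ¬ R.Anc a x → R.Par a b →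
    ∃ b' ∈ R.path 0 x, R.Par b' b ∧ R.pos a < R.pos b')

lemma precedes_of_anc_odd [Fintype W] {w x : W} (h : R.Anc w x) (hw : R.depth w % 2 = 1) :
    Precedes R w x := by
  refine ⟨fun a ha b hb hbw hba => ?_, fun a ha b hb hax hab => ?_⟩
  · exfalso
    rw [PlaneTree.mem_path] at ha hb
    have h₁ := hba.depth
    have h₂ := ha.1.depth_le
    have h₃ : ¬ R.depth b ≤ R.depth w := fun h' => hbw (hb.1.of_depth_le h h')
    omega
  · exact absurd ((PlaneTree.mem_path.1 ha).1.trans h) hax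

lemma precedes_of_anc_even [Fintype W] {w x : W} (h : R.Anc w x) (hw : R.depth w % 2 = 0) :
    Precedes R x w := by
  refine ⟨fun a ha b hb hbw hba => ?_, fun a ha b hb hax hab => ?_⟩
  · exact absurd ((PlaneTree.mem_path.1 hb).1.trans h) hbw
  · exfalso
    rw [PlaneTree.mem_path] at ha hb
    have h₁ := hab.depth
    have h₂ := hb.1.depth_le
    have h₃ : ¬ R.depth a ≤ R.depth w := fun hle => hax (ha.1.of_depth_le h hle)
    omega

/-- If `x` lies below `b` and `w` below a sibling of `b`, then an ancestor of `x` which is not an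
ancestor of `w`, but whose parent is, equals `b`. -/
lemma eq_of_sib {w x a b b' u : W} (hs : R.Sib a b) (ha : R.Anc a w) (hb : R.Anc b x)
    (hb' : R.Anc b' x) (hbw : ¬ R.Anc b' w) (hbu : R.Par b' u) (hu : R.Anc u w) : b' = b := by
  have hau := PlaneTree.par_parent hs.1
  have hbp := hs.par hau
  have hd := hbu.depth
  have hd' := hbp.depth
  have h₁ : R.depth b ≤ R.depth b' := by
    by_contra h
    refine hbw ((hb'.of_depth_le (hb.par hbp) (by omega)).trans (ha.par hau))
  by_contra h₂
  have h₃ : R.depth b ≠ R.depth b' := fun e => h₂ (hb'.eq_of_depth_eq hb e.symm)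
  have h₄ : R.Anc b u := hb.of_depth_le (hb'.par hbu) (by omega)
  exact hs.not_anc ha (h₄.trans hu)

lemma precedes_of_sib [Fintype W] {w x a b : W} (hs : R.Sib a b) (ha : R.Anc a w) (hb : R.Anc b x)
    (hpos : R.pos a < R.pos b) : Precedes R w x := by
  have hau := PlaneTree.par_parent hs.1
  refine ⟨fun a' ha' b' hb' hbw hba => ?_, fun a' ha' b' hb' hax hab => ?_⟩
  · rw [PlaneTree.mem_path] at ha' hb'
    obtain rfl := eq_of_sib hs ha hb hb'.1 hbw hba ha'.1
    have h := hs.depth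
    exact ⟨a, PlaneTree.mem_path.2 ⟨ha, by omega⟩, hs.symm.par hba, hpos⟩
  · rw [PlaneTree.mem_path] at ha' hb'
    obtain rfl := eq_of_sib hs.symm hb ha ha'.1 hax hab hb'.1
    have h := hs.depth
    exact ⟨b, PlaneTree.mem_path.2 ⟨hb, by omega⟩, hs.par hab, hpos⟩

lemma precedes_total [Fintype W] (w x : W) : Precedes R w x ∨ Precedes R x w := by
  rcases R.anc_or_sib w x with h | h | ⟨a, b, hs, ha, hb⟩
  · rcases Nat.mod_two_eq_zero_or_one (R.depth w) with h' | h'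
    · exact Or.inr (precedes_of_anc_even h h')
    · exact Or.inl (precedes_of_anc_odd h h')
  · rcases Nat.mod_two_eq_zero_or_one (R.depth x) with h' | h'
    · exact Or.inl (precedes_of_anc_even h h')
    · exact Or.inr (precedes_of_anc_odd h h')
  · rcases lt_trichotomy (R.pos a) (R.pos b) with h' | h' | h'
    · exact Or.inl (precedes_of_sib hs ha hb h')
    · exact absurd h' hs.pos_ne
    · exact Or.inr (precedes_of_sib hs.symm hb ha h')

open scoped Classical in
/-- The matrix which is the identity on common ancestors and `c a b` on siblings `a` before `b`. -/
noncomputable def comparison (a b : W) : B.P a ⟶ B.P b :=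
  if R.Sib a b ∧ R.pos a < R.pos b then B.c a b else B.idm a b

lemma comparison_self (a : W) : B.comparison a a = 𝟙 _ := by
  rw [comparison, if_neg, idm_self]
  exact fun h => h.1.2.2.1 rfl

lemma comparison_sib {a b : W} (h : R.Sib a b) (h' : R.pos a < R.pos b) :
    B.comparison a b = B.c a b := if_pos ⟨h, h'⟩

lemma comparison_of_depth_ne {a b : W} (h : R.depth a ≠ R.depth b) : B.comparison a b = 0 := by
  rw [comparison, if_neg, idm_ne]
  · rintro rfl; exact h rfl
  · exact fun h' => h h'.1.depth

variable [Fintype W] [HasFiniteBiproducts C]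

lemma comparison_row_sum {x a a' : W} (ha' : a' ∈ R.path 0 x)
    (h : R.depth a = R.depth a') (b : W) :
    ∑ q ∈ R.path 0 x, B.comparison a q ≫ B.c q b = B.comparison a a' ≫ B.c a' b := by
  refine Finset.sum_eq_single a' (fun q hq hqa => ?_) fun h' => absurd ha' h'
  rw [B.comparison_of_depth_ne, zero_comp]
  intro e
  rw [PlaneTree.mem_path] at hq ha'
  exact hqa (hq.1.eq_of_depth_eq ha'.1 (e.symm.trans h))

lemma comparison_col_sum {w b b' : W} (hb' : b' ∈ R.path 1 w)
    (h : R.depth b = R.depth b') (a : W) :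
    ∑ q ∈ R.path 1 w, B.c a q ≫ B.comparison q b = B.c a b' ≫ B.comparison b' b := by
  refine Finset.sum_eq_single b' (fun q hq hqb => ?_) fun h' => absurd hb' h'
  rw [B.comparison_of_depth_ne, comp_zero]
  intro e
  rw [PlaneTree.mem_path] at hq hb'
  exact hqb (hq.1.eq_of_depth_eq hb'.1 (e.trans h))

/-- The comparison matrix is a morphism of complexes if `w` precedes `x`. -/
theorem comparison_comm {w x : W} (h : Precedes R w x) :
    B.mat 0 0 w x B.comparison ≫ B.diff x = B.diff w ≫ B.mat 1 1 w x B.comparison := by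
  obtain ⟨h₁, h₂⟩ := h
  rw [diff, diff, mat_comp, mat_comp, mat_ext_iff]
  intro a ha b hb
  have ha' := PlaneTree.mem_path.1 ha
  have hb' := PlaneTree.mem_path.1 hb
  by_cases hax : R.Anc a x
  · rw [B.comparison_row_sum (PlaneTree.mem_path.2 ⟨hax, ha'.2⟩) rfl, comparison_self,
      Category.id_comp]
    by_cases hbw : R.Anc b w
    · rw [B.comparison_col_sum (PlaneTree.mem_path.2 ⟨hbw, hb'.2⟩) rfl, comparison_self,
        Category.comp_id]
    · have hab : ¬ R.Par a b := fun e => hbw (ha'.1.par e)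
      by_cases hba : R.Par b a
      · obtain ⟨q, hq, hqa, hpos⟩ := h₁ a ha b hb hbw hba
        have hs : R.Sib q b := hqa.sib hba (by rintro rfl; exact hbw (PlaneTree.mem_path.1 hq).1)
        rw [B.comparison_col_sum hq hs.depth.symm, B.comparison_sib hs hpos,
          B.down_lt hs hqa hpos]
      · rw [B.hom_eq_zero_of_parity (by omega) hab hba (B.c a b), Finset.sum_eq_zero]
        intro q hq
        have hq' := PlaneTree.mem_path.1 hq
        by_cases hs : R.Sib q b ∧ R.pos q < R.pos b
        · rw [B.comparison_sib hs.1 hs.2]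
          by_cases hqa : R.Par q a
          · exact absurd (hs.1.par hqa) hba
          · exact B.hom_eq_zero_of_parity (by omega) hab hba _
        · rw [comparison, if_neg hs, idm_ne, comp_zero]
          rintro rfl
          exact hbw hq'.1
  · have hba : ¬ R.Par b a := fun e => hax (hb'.1.par e)
    by_cases hab : R.Par a b
    · obtain ⟨q, hq, hqb, hpos⟩ := h₂ a ha b hb hax hab
      have hs : R.Sib a q := hab.sib hqb (by rintro rfl; exact hax (PlaneTree.mem_path.1 hq).1)
      rw [B.comparison_row_sum hq hs.depth, B.comparison_sib hs hpos, B.up_lt hs hab hpos,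
        B.comparison_col_sum (PlaneTree.mem_path.2 ⟨ha'.1.par hab, hb'.2⟩) rfl,
        comparison_self, Category.comp_id]
    · rw [Finset.sum_eq_zero, Finset.sum_eq_zero]
      · intro q hq
        exact B.hom_eq_zero_of_parity (by omega) hab hba _
      · intro q hq
        exact B.hom_eq_zero_of_parity (by omega) hab hba _

lemma root_mem_path (w : W) : R.root ∈ R.path 0 w := by
  simp [PlaneTree.root_anc, R.depth_root]

lemma rootCoeff_comparison (w x : W) : B.rootCoeff (B.mat 0 0 w x B.comparison) = 1 := by
  rw [rootCoeff, B.ent_mat _ (root_mem_path w) (root_mem_path x), comparison_self, coeff_id]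

lemma rootCoeff_id (w : W) : B.rootCoeff (𝟙 (B.X 0 w)) = 1 := by
  rw [rootCoeff, ← mat_idm, B.ent_mat _ (root_mem_path w) (root_mem_path w), idm_self, coeff_id]

/-- The only even entry in the row of the root is at the root. -/
lemma ent_root_left {w x : W} (f : B.X 0 w ⟶ B.X 0 x) {b : W} (hb : b ∈ R.path 0 x)
    (h : b ≠ R.root) : B.ent f R.root b = 0 := by
  refine B.ent_eq_zero_of_depth_ne f (root_mem_path w) hb fun e => h ?_
  rw [R.depth_root] at e
  exact PlaneTree.eq_root_of_depth e.symm

lemma ent_root_right {w x : W} (f : B.X 0 w ⟶ B.X 0 x) {a : W} (ha : a ∈ R.path 0 w)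
    (h : a ≠ R.root) : B.ent f a R.root = 0 := by
  refine B.ent_eq_zero_of_depth_ne f ha (root_mem_path x) fun e => h ?_
  rw [R.depth_root] at e
  exact PlaneTree.eq_root_of_depth e

lemma rootCoeff_comp {w x y : W} (f : B.X 0 w ⟶ B.X 0 x) (g : B.X 0 x ⟶ B.X 0 y) :
    B.rootCoeff (f ≫ g) = B.rootCoeff f * B.rootCoeff g := by
  have h : B.ent (f ≫ g) R.root R.root = B.ent f R.root R.root ≫ B.ent g R.root R.root := by
    conv_lhs => rw [← B.mat_ent f, ← B.mat_ent g, mat_comp]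
    rw [B.ent_mat _ (root_mem_path w) (root_mem_path y)]
    refine Finset.sum_eq_single R.root (fun q hq hq' => ?_) fun h => absurd (root_mem_path x) h
    rw [B.ent_root_left f hq hq', zero_comp]
  rw [rootCoeff, h, coeff_comp, rootCoeff, rootCoeff]

lemma ent_add {j k : ℕ} {w x : W} (f g : B.X j w ⟶ B.X k x) (a b : W) :
    B.ent (f + g) a b = B.ent f a b + B.ent g a b := by
  simp only [ent]
  split_ifs <;> simp [biproduct.components]

lemma ent_smul {j k : ℕ} {w x : W} (r : K) (f : B.X j w ⟶ B.X k x) (a b : W) :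
    B.ent (r • f) a b = r • B.ent f a b := by
  simp only [ent]
  split_ifs <;> simp [biproduct.components]

lemma rootCoeff_add {w x : W} (f g : B.X 0 w ⟶ B.X 0 x) :
    B.rootCoeff (f + g) = B.rootCoeff f + B.rootCoeff g := by
  rw [rootCoeff, ent_add, coeff_add, rootCoeff, rootCoeff]

lemma rootCoeff_smul {w x : W} (r : K) (f : B.X 0 w ⟶ B.X 0 x) :
    B.rootCoeff (r • f) = r * B.rootCoeff f := by
  rw [rootCoeff, ent_smul, coeff_smul, rootCoeff]

/-- The socle endomorphism of the root, as a morphism between the degree zero parts. -/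
noncomputable def socle (w x : W) : B.X 0 w ⟶ B.X 0 x :=
  B.cmat 0 0 w x (unitMatrix K R.root R.root)

lemma cmat_one_root (w x : W) : B.cmat 1 1 w x (unitMatrix K R.root R.root) = 0 := by
  rw [cmat_apply, ← B.mat_zero, mat_ext_iff]
  intro a ha b _
  rw [unitMatrix_left, zero_smul]
  rintro rfl
  rw [PlaneTree.mem_path, R.depth_root] at ha
  omega

lemma socle_comp_diff (w x : W) : B.socle w x ≫ B.diff x = 0 := by
  rw [socle, diff, cmat_apply, mat_comp, ← B.mat_zero, mat_ext_iff]
  intro a _ b _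
  refine Finset.sum_eq_zero fun q _ => ?_
  by_cases ha : a = R.root
  · subst ha
    by_cases hq : q = R.root
    · subst hq; rw [Linear.smul_comp, B.c_self_comp_c, smul_zero]
    · rw [unitMatrix_right hq, zero_smul, zero_comp]
  · rw [unitMatrix_left ha, zero_smul, zero_comp]

lemma rootCoeff_socle (w x : W) : B.rootCoeff (B.socle w x) = 0 := by
  rw [rootCoeff, socle, cmat_apply, B.ent_mat _ (root_mem_path w) (root_mem_path x),
    unitMatrix_self, coeff_smul_c]

lemma comp_socle {w x : W} (f : B.X 0 w ⟶ B.X 0 x) (y : W) :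
    f ≫ B.socle x y = B.rootCoeff f • B.socle w y := by
  conv_lhs => rw [← B.mat_ent f]
  rw [socle, socle, cmat_apply, cmat_apply, mat_comp, ← mat_smul, mat_ext_iff]
  intro a ha b _
  rw [Finset.sum_eq_single R.root]
  · by_cases ha' : a = R.root
    · subst ha'
      by_cases hb : b = R.root
      · subst hb
        rw [Linear.comp_smul, B.comp_c, smul_comm, rootCoeff]
      · simp [unitMatrix_right hb]
    · rw [B.ent_root_right f ha ha', zero_comp, unitMatrix_left ha', zero_smul, smul_zero]
  · intro q _ hq
    rw [unitMatrix_left hq, zero_smul, comp_zero]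
  · exact fun h => absurd (root_mem_path x) h

lemma socle_comp {x y : W} (f : B.X 0 x ⟶ B.X 0 y) (w : W) :
    B.socle w x ≫ f = B.rootCoeff f • B.socle w y := by
  conv_lhs => rw [← B.mat_ent f]
  rw [socle, socle, cmat_apply, cmat_apply, mat_comp, ← mat_smul, mat_ext_iff]
  intro a _ b hb
  rw [Finset.sum_eq_single R.root]
  · by_cases hb' : b = R.root
    · subst hb'
      by_cases ha : a = R.root
      · subst ha
        rw [Linear.smul_comp, B.c_comp, smul_comm, rootCoeff]
      · simp [unitMatrix_left ha]
    · rw [B.ent_root_left f hb hb', comp_zero, unitMatrix_right hb', zero_smul, smul_zero]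
  · intro q _ hq
    rw [unitMatrix_right hq, zero_smul, zero_comp]
  · exact fun h => absurd (root_mem_path x) h

end BrauerSystem

/-! ### Complexes in the degrees zero and one -/

namespace TwoTermComplex

variable {C : Type w} [Category.{v} C] [Preadditive C] [HasZeroObject C]

lemma rel_zero_one : (ComplexShape.up ℤ).Rel 0 1 := by simp

/-- The complex with the differential `d` from degree zero to degree one. -/
noncomputable def of {X Y : C} (d : X ⟶ Y) : CochainComplex C ℤ :=
  HomologicalComplex.double d rel_zero_one

section

variable {X Y : C} (d : X ⟶ Y)

/-- The degree zero part. -/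
noncomputable def iso₀ : (of d).X 0 ≅ X := HomologicalComplex.doubleXIso₀ d rel_zero_one

/-- The degree one part. -/
noncomputable def iso₁ : (of d).X 1 ≅ Y := HomologicalComplex.doubleXIso₁ d rel_zero_one (by simp)

lemma isZero_X {i : ℤ} (h₀ : i ≠ 0) (h₁ : i ≠ 1) : IsZero ((of d).X i) :=
  HomologicalComplex.isZero_double_X d rel_zero_one i h₀ h₁

lemma of_d : (of d).d 0 1 = (iso₀ d).hom ≫ d ≫ (iso₁ d).inv :=
  HomologicalComplex.double_d d rel_zero_one (by simp)

end

variable {X' Y' X'' Y'' : C} {d' : X' ⟶ Y'} {d'' : X'' ⟶ Y''}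

variable {X Y : C} {d : X ⟶ Y}

/-- The degree zero component of a morphism. -/
noncomputable def hom₀ {e : X' ⟶ Y'} (φ : of d ⟶ of e) : X ⟶ X' :=
  (iso₀ d).inv ≫ φ.f 0 ≫ (iso₀ e).hom

/-- The degree one component of a morphism. -/
noncomputable def hom₁ (φ : of d ⟶ of d') : Y ⟶ Y' := (iso₁ d).inv ≫ φ.f 1 ≫ (iso₁ d').hom

lemma f_zero (φ : of d ⟶ of d') : φ.f 0 = (iso₀ d).hom ≫ hom₀ φ ≫ (iso₀ d').inv := by
  simp [hom₀]

lemma f_one (φ : of d ⟶ of d') : φ.f 1 = (iso₁ d).hom ≫ hom₁ φ ≫ (iso₁ d').inv := by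
  simp [hom₁]

lemma hom_ext {φ ψ : of d ⟶ of d'} (h₀ : hom₀ φ = hom₀ ψ) (h₁ : hom₁ φ = hom₁ ψ) : φ = ψ :=
  HomologicalComplex.from_double_hom_ext (by rw [f_zero, f_zero, h₀]) (by rw [f_one, f_one, h₁])

lemma hom_comm (φ : of d ⟶ of d') : hom₀ φ ≫ d' = d ≫ hom₁ φ := by
  have h := φ.comm 0 1
  rw [f_zero, f_one, of_d, of_d] at h
  rw [← cancel_epi (iso₀ d).hom, ← cancel_mono (iso₁ d').inv]
  simpa using h

/-- The morphism with given components. -/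
noncomputable def homMk (f₀ : X ⟶ X') (f₁ : Y ⟶ Y') (h : f₀ ≫ d' = d ≫ f₁) : of d ⟶ of d' :=
  HomologicalComplex.mkHomFromDouble rel_zero_one (by simp) (f₀ ≫ (iso₀ d').inv)
    (f₁ ≫ (iso₁ d').inv) (by rw [of_d]; simp [reassoc_of% h]) (fun k hk =>
      (isZero_X d' (by rintro rfl; simp at hk) (by rintro rfl; simp at hk)).eq_of_tgt _ _)

@[simp]
lemma hom₀_homMk (f₀ : X ⟶ X') (f₁ : Y ⟶ Y') (h : f₀ ≫ d' = d ≫ f₁) :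
    hom₀ (homMk f₀ f₁ h) = f₀ := by
  have e : (homMk f₀ f₁ h).f 0 = (iso₀ d).hom ≫ f₀ ≫ (iso₀ d').inv :=
    HomologicalComplex.mkHomFromDouble_f₀ _ _ _ _ _ _
  rw [hom₀, e]
  simp

@[simp]
lemma hom₁_homMk (f₀ : X ⟶ X') (f₁ : Y ⟶ Y') (h : f₀ ≫ d' = d ≫ f₁) :
    hom₁ (homMk f₀ f₁ h) = f₁ := by
  have e : (homMk f₀ f₁ h).f 1 = (iso₁ d).hom ≫ f₁ ≫ (iso₁ d').inv :=
    HomologicalComplex.mkHomFromDouble_f₁ _ _ _ _ _ _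
  rw [hom₁, e]
  simp

lemma hom₀_id : hom₀ (𝟙 (of d)) = 𝟙 X := by simp [hom₀]

lemma hom₀_comp (φ : of d ⟶ of d') (ψ : of d' ⟶ of d'') : hom₀ (φ ≫ ψ) = hom₀ φ ≫ hom₀ ψ := by
  simp [hom₀]

lemma hom₁_comp (φ : of d ⟶ of d') (ψ : of d' ⟶ of d'') : hom₁ (φ ≫ ψ) = hom₁ φ ≫ hom₁ ψ := by
  simp [hom₁]

lemma hom₀_sub (φ ψ : of d ⟶ of d') : hom₀ (φ - ψ) = hom₀ φ - hom₀ ψ := by simp [hom₀]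

lemma hom₁_sub (φ ψ : of d ⟶ of d') : hom₁ (φ - ψ) = hom₁ φ - hom₁ ψ := by simp [hom₁]

lemma hom₀_smul {K : Type u} [Ring K] [Linear K C] (r : K) (φ : of d ⟶ of d') :
    hom₀ (r • φ) = r • hom₀ φ := by simp [hom₀]

lemma hom₁_smul {K : Type u} [Ring K] [Linear K C] (r : K) (φ : of d ⟶ of d') :
    hom₁ (r • φ) = r • hom₁ φ := by simp [hom₁]

/-- The homotopy of a morphism from degree one to degree zero. -/
noncomputable def homotopy (φ : of d ⟶ of d') (h : Y ⟶ X') (h₀ : hom₀ φ = d ≫ h)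
    (h₁ : hom₁ φ = h ≫ d') : Homotopy φ 0 where
  hom i j := if e : i = 1 ∧ j = 0 then
    eqToHom (by rw [e.1]) ≫ (iso₁ d).hom ≫ h ≫ (iso₀ d').inv ≫ eqToHom (by rw [e.2]) else 0
  zero i j hij := by
    rw [dif_neg]
    rintro ⟨rfl, rfl⟩
    exact hij rel_zero_one
  comm i := by
    rw [dNext_eq _ (show (ComplexShape.up ℤ).Rel i (i + 1) by simp),
      prevD_eq _ (show (ComplexShape.up ℤ).Rel (i - 1) i by simp)]
    by_cases hi₀ : i = 0
    · subst hi₀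
      have e : (of d).d 0 (0 + 1) = (of d).d 0 1 := rfl
      rw [dif_pos ⟨by simp, rfl⟩, dif_neg (by simp), zero_comp, f_zero, h₀]
      change _ = (of d).d 0 1 ≫ _ + _ + _
      rw [of_d]
      simp
    · by_cases hi₁ : i = 1
      · subst hi₁
        rw [dif_neg (by simp), dif_pos ⟨rfl, by simp⟩, comp_zero, f_one, h₁]
        change _ = _ + _ ≫ (of d').d 0 1 + _
        rw [of_d]
        simp
      · exact (isZero_X d hi₀ hi₁).eq_of_src _ _

lemma quotient_map_eq_zero_iff (φ : of d ⟶ of d') :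
    (HomotopyCategory.quotient C (ComplexShape.up ℤ)).map φ = 0 ↔
      ∃ h : Y ⟶ X', hom₀ φ = d ≫ h ∧ hom₁ φ = h ≫ d' := by
  rw [HomotopyCategory.quotient_map_eq_zero_iff]
  constructor
  · rintro ⟨H⟩
    refine ⟨(iso₁ d).inv ≫ H.hom 1 0 ≫ (iso₀ d').hom, ?_, ?_⟩
    · have h := H.comm 0
      rw [dNext_eq _ rel_zero_one, prevD_eq _ (show (ComplexShape.up ℤ).Rel (-1) 0 by simp),
        (isZero_X d' (show (-1 : ℤ) ≠ 0 by simp) (by simp)).eq_of_src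
        ((of d').d (-1) 0) 0, of_d] at h
      simp only [HomologicalComplex.zero_f, comp_zero, add_zero] at h
      simp [hom₀, h]
    · have h := H.comm 1
      rw [dNext_eq _ (show (ComplexShape.up ℤ).Rel 1 2 by simp), prevD_eq _ rel_zero_one,
        (isZero_X d (show (2 : ℤ) ≠ 0 by simp) (by simp)).eq_of_tgt
        ((of d).d 1 2) 0, of_d] at h
      simp only [HomologicalComplex.zero_f, zero_comp, zero_add, add_zero] at h
      simp [hom₁, h]
  · rintro ⟨h, h₀, h₁⟩
    exact ⟨homotopy φ h h₀ h₁⟩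

open CochainComplex.HomComplex in
/-- The vanishing of the morphisms of nonzero degree in the homotopy category. -/
theorem shiftedHom_eq_zero
    (hpos : ∀ g : X ⟶ Y', ∃ h₀ h₁, g = h₀ ≫ d' + d ≫ h₁)
    (hneg : ∀ g : Y ⟶ X', d ≫ g = 0 → g ≫ d' = 0 → g = 0) {n : ℤ} (hn : n ≠ 0)
    (f : of d ⟶ (of d')⟦n⟧) :
    (HomotopyCategory.quotient C (ComplexShape.up ℤ)).map f = 0 := by
  have hX : ∀ {i : ℤ}, i ≠ 0 → i ≠ 1 → IsZero ((of d).X i) := fun h₀ h₁ => isZero_X d h₀ h₁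
  have hX' : ∀ {i : ℤ}, i ≠ 0 → i ≠ 1 → IsZero ((of d').X i) := fun h₀ h₁ => isZero_X d' h₀ h₁
  obtain ⟨z, rfl⟩ := (Cocycle.equivHomShift (K := of d) (L := of d') (n := n)).symm.surjective f
  rw [← CohomologyClass.toHom_mk, CohomologyClass.toHom_mk_eq_zero_iff]
  have hz : δ n (n + 1) z.1 = 0 := Cocycle.δ_eq_zero z (n + 1)
  by_cases hn₁ : n = 1
  · subst hn₁
    obtain ⟨h₀, h₁, h⟩ := hpos ((iso₀ d).inv ≫ z.1.v 0 1 (by simp) ≫ (iso₁ d').hom)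
    have hzv : z.1.v 0 1 (by simp) = (iso₀ d).hom ≫ (h₀ ≫ d' + d ≫ h₁) ≫ (iso₁ d').inv := by
      simp [← h]
    let φ : ∀ p : ℤ, (of d).X p ⟶ (of d').X p := fun p =>
      if e : p = 0 then eqToHom (by rw [e]) ≫ (iso₀ d).hom ≫ h₀ ≫ (iso₀ d').inv ≫
        eqToHom (by rw [e])
      else if e : p = 1 then eqToHom (by rw [e]) ≫ (iso₁ d).hom ≫ (-h₁) ≫ (iso₁ d').inv ≫
        eqToHom (by rw [e]) else 0
    have hφ₀ : φ 0 = (iso₀ d).hom ≫ h₀ ≫ (iso₀ d').inv := by simp [φ]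
    have hφ₁ : φ 1 = (iso₁ d).hom ≫ (-h₁) ≫ (iso₁ d').inv := by simp [φ]
    refine (mem_coboundaries_iff z 0 (by simp)).2 ⟨Cochain.ofHoms φ, ?_⟩
    ext p q hpq
    by_cases hp : p = 0
    · subst hp
      obtain rfl : q = 1 := by omega
      rw [δ_v 0 1 (by simp) _ 0 1 _ 0 1 (by simp) (by simp), Cochain.ofHoms_v, Cochain.ofHoms_v,
        hφ₀, hφ₁, of_d, of_d, hzv]
      simp
    · by_cases hp' : p = 1
      · subst hp'
        exact (hX' (by omega) (by omega)).eq_of_tgt _ _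
      · exact (hX hp hp').eq_of_src _ _
  · refine (mem_coboundaries_iff z (n - 1) (by simp)).2 ⟨0, ?_⟩
    rw [δ_zero]
    by_cases hn₂ : n = -1
    · subst hn₂
      have h₁ : (iso₁ d).inv ≫ z.1.v 1 0 (by simp) ≫ (iso₀ d').hom = 0 := by
        apply hneg
        · have h := congrArg (fun y => Cochain.v y 0 0 (by simp)) hz
          simp only [Cochain.zero_v] at h
          rw [δ_v (-1) (-1 + 1) (by simp) _ 0 0 _ (-1) 1 (by simp) (by simp),
            (hX' (show (-1 : ℤ) ≠ 0 by simp) (by simp)).eq_of_src ((of d').d (-1) 0) 0, of_d] at h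
          rw [← cancel_epi (iso₀ d).hom, ← cancel_mono (iso₀ d').inv]
          simpa using h
        · have h := congrArg (fun y => Cochain.v y 1 1 (by simp)) hz
          simp only [Cochain.zero_v] at h
          rw [δ_v (-1) (-1 + 1) (by simp) _ 1 1 _ 0 2 (by simp) (by simp),
            (hX (show (2 : ℤ) ≠ 0 by simp) (by simp)).eq_of_tgt ((of d).d 1 2) 0, of_d] at h
          rw [← cancel_epi (iso₁ d).hom, ← cancel_mono (iso₁ d').inv]
          simpa using h
      have h₂ : z.1.v 1 0 (by simp) = 0 := by
        rw [← cancel_epi (iso₁ d).inv, ← cancel_mono (iso₀ d').hom]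
        simpa using h₁
      ext p q hpq
      by_cases hp : p = 1
      · subst hp
        obtain rfl : q = 0 := by omega
        exact h₂.symm
      · by_cases hp' : p = 0
        · subst hp'
          exact (hX' (by omega) (by omega)).eq_of_tgt _ _
        · exact (hX hp' hp).eq_of_src _ _
    · ext p q hpq
      by_cases hp : p ≠ 0 ∧ p ≠ 1
      · exact (hX hp.1 hp.2).eq_of_src _ _
      · exact (hX' (by omega) (by omega)).eq_of_tgt _ _

end TwoTermComplex

/-! ### Paths in Brauer tree algebras -/

namespace BrauerTree

variable {V : Type v} (Γ : BrauerTree V)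

lemma finite_dart : Finite Γ.graph.Dart := by
  have := Γ.finite
  exact Finite.of_injective (fun d : Γ.graph.Dart => d.toProd) SimpleGraph.Dart.toProd_injective

lemma finite_edge : Finite Γ.Edge := by
  have := Γ.finite_dart
  refine Finite.of_surjective Γ.edgeOf ?_
  rintro ⟨e, he⟩
  induction e with
  | _ x y => exact ⟨⟨(x, y), he⟩, rfl⟩

lemma edgeOf_surjective : Function.Surjective Γ.edgeOf := by
  rintro ⟨e, he⟩
  induction e with
  | _ x y => exact ⟨⟨(x, y), he⟩, rfl⟩

lemma edgeOf_eq_iff {d d' : Γ.graph.Dart} : Γ.edgeOf d = Γ.edgeOf d' ↔ d = d' ∨ d = d'.symm := by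
  rw [edgeOf, edgeOf, Subtype.mk.injEq, SimpleGraph.dart_edge_eq_iff]

lemma edgeOf_symm (d : Γ.graph.Dart) : Γ.edgeOf d.symm = Γ.edgeOf d :=
  Γ.edgeOf_eq_iff.2 (Or.inr rfl)

lemma eq_of_fst_eq {d e : Γ.graph.Dart} (h : Γ.edgeOf d = Γ.edgeOf e) (hfst : d.fst = e.fst) :
    d = e := by
  rcases Γ.edgeOf_eq_iff.1 h with h₁ | h₁
  · exact h₁
  · rw [h₁] at hfst
    exact absurd hfst.symm e.fst_ne_snd

/-- The number of edges at the base vertex of a dart. -/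
noncomputable def period (d : Γ.graph.Dart) : ℕ := Function.minimalPeriod Γ.next d

lemma period_pos (d : Γ.graph.Dart) : 0 < Γ.period d := by
  have := Γ.finite_dart
  exact Function.minimalPeriod_pos_of_mem_periodicPts
    (Function.Injective.mem_periodicPts Γ.next.injective d)

lemma iterate_period (d : Γ.graph.Dart) : Γ.next^[Γ.period d] d = d :=
  Function.iterate_minimalPeriod

lemma iterate_fst (d : Γ.graph.Dart) (k : ℕ) : (Γ.next^[k] d).fst = d.fst := by
  induction k with
  | zero => rfl
  | succ k ih => rw [Function.iterate_succ_apply', Γ.next_fst, ih]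

lemma exists_iterate {d d' : Γ.graph.Dart} (h : d.fst = d'.fst) :
    ∃ k < Γ.period d, Γ.next^[k] d = d' := by
  have := Γ.finite_dart
  obtain ⟨k, hk⟩ := (Γ.next_sameCycle d d' h).exists_nat_pow_eq
  refine ⟨k % Γ.period d, Nat.mod_lt _ (Γ.period_pos d), ?_⟩
  rw [period, Function.iterate_mod_minimalPeriod_eq, ← hk, Equiv.Perm.iterate_eq_pow]

lemma period_eq {d d' : Γ.graph.Dart} (h : d.fst = d'.fst) : Γ.period d = Γ.period d' := by
  obtain ⟨k, -, rfl⟩ := Γ.exists_iterate h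
  have := Γ.finite_dart
  exact (Function.minimalPeriod_apply_iterate
    (Function.Injective.mem_periodicPts Γ.next.injective d) k).symm

lemma iterate_inj {d : Γ.graph.Dart} {k l : ℕ} (hk : k < Γ.period d) (hl : l < Γ.period d)
    (h : Γ.next^[k] d = Γ.next^[l] d) : k = l :=
  Function.iterate_injOn_Iio_minimalPeriod hk hl h

/-- The product of the values of `f` at `k` successive darts. -/
noncomputable def pathProd {M : Type*} [Monoid M] (f : Γ.graph.Dart → M) (d : Γ.graph.Dart)
    (k : ℕ) : M :=
  ((List.range k).map fun l => f (Γ.next^[l] d)).prod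

section pathProd

variable {M : Type*} [Monoid M] (f : Γ.graph.Dart → M) (d : Γ.graph.Dart)

@[simp]
lemma pathProd_zero : Γ.pathProd f d 0 = 1 := by simp [pathProd]

@[simp]
lemma pathProd_one : Γ.pathProd f d 1 = f d := by simp [pathProd]

lemma pathProd_succ (k : ℕ) :
    Γ.pathProd f d (k + 1) = Γ.pathProd f d k * f (Γ.next^[k] d) := by
  simp [pathProd, List.range_succ]

lemma pathProd_succ' (k : ℕ) :
    Γ.pathProd f d (k + 1) = f d * Γ.pathProd f (Γ.next d) k := by
  simp [pathProd, List.range_succ_eq_map, Function.comp_def]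

lemma pathProd_add (j k : ℕ) :
    Γ.pathProd f d (j + k) = Γ.pathProd f d j * Γ.pathProd f (Γ.next^[j] d) k := by
  induction k with
  | zero => simp
  | succ k ih =>
    rw [← add_assoc, pathProd_succ, ih, pathProd_succ, mul_assoc, ← Function.iterate_add_apply,
      add_comm k j]

lemma map_pathProd {N : Type*} [Monoid N] (φ : M →* N) (k : ℕ) :
    φ (Γ.pathProd f d k) = Γ.pathProd (fun d => φ (f d)) d k := by
  simp [pathProd, map_list_prod, Function.comp_def]

end pathProd

end BrauerTree

namespace BrauerTreeAlgebra

variable (K : Type u) [Field K] {V : Type v} (Γ : BrauerTree V)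

/-- The idempotent of an edge. -/
noncomputable def idem (i : Γ.Edge) : BrauerTreeAlgebra K Γ := RingQuot.mkAlgHom K (Rel K Γ) (e K Γ i)

/-- The arrow of a dart. -/
noncomputable def arrow (d : Γ.graph.Dart) : BrauerTreeAlgebra K Γ :=
  RingQuot.mkAlgHom K (Rel K Γ) (a K Γ d)

/-- The path of length `k` that starts with the arrow of a dart. -/
noncomputable def path (d : Γ.graph.Dart) (k : ℕ) : BrauerTreeAlgebra K Γ :=
  Γ.pathProd (arrow K Γ) d k

variable {K Γ}

lemma mk_cyc (d : Γ.graph.Dart) :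
    RingQuot.mkAlgHom K (Rel K Γ) (cyc K Γ d) = path K Γ d (Γ.period d) :=
  Γ.map_pathProd (a K Γ) d (RingQuot.mkAlgHom K (Rel K Γ)).toMonoidHom (Γ.period d)

lemma idem_mul_self (i : Γ.Edge) : idem K Γ i * idem K Γ i = idem K Γ i := by
  rw [idem, ← map_mul]
  exact RingQuot.mkAlgHom_rel K (Rel.idem i)

lemma idem_mul_ne {i j : Γ.Edge} (h : i ≠ j) : idem K Γ i * idem K Γ j = 0 := by
  rw [idem, idem, ← map_mul, RingQuot.mkAlgHom_rel K (Rel.orth i j h), map_zero]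

lemma finsum_idem : ∑ᶠ i, idem K Γ i = 1 := by
  have := Γ.finite_edge
  have := Fintype.ofFinite Γ.Edge
  have h := RingQuot.mkAlgHom_rel K (Rel.sum (K := K) (Γ := Γ))
  rw [map_one, finsum_eq_sum_of_fintype, map_sum] at h
  rwa [finsum_eq_sum_of_fintype]

lemma sum_idem [Fintype Γ.Edge] : ∑ i, idem K Γ i = 1 := by
  rw [← finsum_idem, finsum_eq_sum_of_fintype]

lemma idem_mul_arrow (d : Γ.graph.Dart) :
    idem K Γ (Γ.edgeOf d) * arrow K Γ d = arrow K Γ d := by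
  rw [idem, arrow, ← map_mul]
  exact RingQuot.mkAlgHom_rel K (Rel.source d)

lemma arrow_mul_idem (d : Γ.graph.Dart) :
    arrow K Γ d * idem K Γ (Γ.edgeOf (Γ.next d)) = arrow K Γ d := by
  rw [idem, arrow, ← map_mul]
  exact RingQuot.mkAlgHom_rel K (Rel.target d)

lemma arrow_mul_arrow_symm (d : Γ.graph.Dart) :
    arrow K Γ d * arrow K Γ (Γ.next d).symm = 0 := by
  rw [arrow, arrow, ← map_mul, RingQuot.mkAlgHom_rel K (Rel.zero d), map_zero]

lemma path_period_symm (d : Γ.graph.Dart) :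
    path K Γ d.symm (Γ.period d.symm) = path K Γ d (Γ.period d) := by
  rw [← mk_cyc, ← mk_cyc]
  exact (RingQuot.mkAlgHom_rel K (Rel.cycle d)).symm

lemma path_succ (d : Γ.graph.Dart) (k : ℕ) :
    path K Γ d (k + 1) = path K Γ d k * arrow K Γ (Γ.next^[k] d) := Γ.pathProd_succ _ d k

lemma path_succ' (d : Γ.graph.Dart) (k : ℕ) :
    path K Γ d (k + 1) = arrow K Γ d * path K Γ (Γ.next d) k := Γ.pathProd_succ' _ d k

lemma path_add (d : Γ.graph.Dart) (j k : ℕ) :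
    path K Γ d (j + k) = path K Γ d j * path K Γ (Γ.next^[j] d) k := Γ.pathProd_add _ d j k

lemma path_one (d : Γ.graph.Dart) : path K Γ d 1 = arrow K Γ d := Γ.pathProd_one _ d

lemma idem_mul_path (d : Γ.graph.Dart) {k : ℕ} (hk : 0 < k) :
    idem K Γ (Γ.edgeOf d) * path K Γ d k = path K Γ d k := by
  obtain ⟨k, rfl⟩ := Nat.exists_eq_succ_of_ne_zero hk.ne'
  rw [path_succ', ← mul_assoc, idem_mul_arrow]

lemma path_mul_idem (d : Γ.graph.Dart) {k : ℕ} (hk : 0 < k) :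
    path K Γ d k * idem K Γ (Γ.edgeOf (Γ.next^[k] d)) = path K Γ d k := by
  obtain ⟨k, rfl⟩ := Nat.exists_eq_succ_of_ne_zero hk.ne'
  rw [path_succ, mul_assoc, Function.iterate_succ_apply', arrow_mul_idem]

lemma arrow_mul_path_ne {c d : Γ.graph.Dart} (h : Γ.next c ≠ d) {k : ℕ} (hk : 0 < k) :
    arrow K Γ c * path K Γ d k = 0 := by
  by_cases he : Γ.edgeOf (Γ.next c) = Γ.edgeOf d
  · rcases Γ.edgeOf_eq_iff.1 he.symm with h₁ | h₁
    · exact absurd h₁.symm h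
    · obtain ⟨k, rfl⟩ := Nat.exists_eq_succ_of_ne_zero hk.ne'
      rw [path_succ', ← mul_assoc, h₁, arrow_mul_arrow_symm, zero_mul]
  · rw [← arrow_mul_idem, ← idem_mul_path d hk, mul_assoc, ← mul_assoc (idem K Γ _),
      idem_mul_ne he, zero_mul, mul_zero]

lemma path_eq_zero (d : Γ.graph.Dart) {k : ℕ} (hk : Γ.period d < k) : path K Γ d k = 0 := by
  have h : path K Γ d (Γ.period d + 1) = 0 := by
    rw [path_succ', Γ.period_eq (Γ.next_fst d).symm, ← path_period_symm]
    refine arrow_mul_path_ne (fun e => ?_) (Γ.period_pos _)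
    exact (Γ.next d).symm_ne e.symm
  obtain ⟨l, rfl⟩ := Nat.exists_eq_add_of_lt hk
  rw [add_right_comm, path_add, h, zero_mul]

variable (K Γ) in
/-- The idempotents and the paths that go at most once around a vertex span the algebra. -/
theorem span_paths : Submodule.span K (Set.range (idem K Γ) ∪
    {x | ∃ d k, 0 < k ∧ k ≤ Γ.period d ∧ x = path K Γ d k}) = ⊤ := by
  classical
  set S := Submodule.span K (Set.range (idem K Γ) ∪
    {x | ∃ d k, 0 < k ∧ k ≤ Γ.period d ∧ x = path K Γ d k}) with hS
  have hidem : ∀ i, idem K Γ i ∈ S := fun i => Submodule.subset_span (Or.inl ⟨i, rfl⟩)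
  have hpath : ∀ d k, 0 < k → path K Γ d k ∈ S := by
    intro d k hk
    by_cases h : k ≤ Γ.period d
    · exact Submodule.subset_span (Or.inr ⟨d, k, hk, h, rfl⟩)
    · rw [path_eq_zero d (not_le.1 h)]
      exact S.zero_mem
  have hone : (1 : BrauerTreeAlgebra K Γ) ∈ S := by
    have := Γ.finite_edge
    have := Fintype.ofFinite Γ.Edge
    rw [← sum_idem]
    exact S.sum_mem fun i _ => hidem i
  have hgen : ∀ x y : BrauerTreeAlgebra K Γ,
      (∀ i, x * idem K Γ i ∈ S) → (∀ d k, 0 < k → x * path K Γ d k ∈ S) → y ∈ S → x * y ∈ S := by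
    intro x y h₁ h₂ hy
    induction hy using Submodule.span_induction with
    | mem y hy =>
      rcases hy with ⟨i, rfl⟩ | ⟨d, k, hk, -, rfl⟩
      · exact h₁ i
      · exact h₂ d k hk
    | zero => rw [mul_zero]; exact S.zero_mem
    | add y z _ _ hy hz => rw [mul_add]; exact S.add_mem hy hz
    | smul r y _ hy => rw [mul_smul_comm]; exact S.smul_mem r hy
  have key : ∀ x : Free K Γ, ∀ y ∈ S, RingQuot.mkAlgHom K (Rel K Γ) x * y ∈ S := by
    intro x
    induction x using FreeAlgebra.induction with
    | grade0 r =>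
      intro y hy
      rw [AlgHom.commutes, ← Algebra.smul_def]
      exact S.smul_mem r hy
    | grade1 z =>
      intro y hy
      rcases z with i | c
      · refine hgen (idem K Γ i) y (fun j => ?_) (fun d k hk => ?_) hy
        · by_cases h : i = j
          · subst h; rw [idem_mul_self]; exact hidem i
          · rw [idem_mul_ne h]; exact S.zero_mem
        · by_cases h : i = Γ.edgeOf d
          · subst h; rw [idem_mul_path d hk]; exact hpath d k hk
          · rw [← idem_mul_path d hk, ← mul_assoc, idem_mul_ne h, zero_mul]; exact S.zero_mem
      · refine hgen (arrow K Γ c) y (fun j => ?_) (fun d k hk => ?_) hy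
        · by_cases h : Γ.edgeOf (Γ.next c) = j
          · subst h; rw [arrow_mul_idem, ← path_one]; exact hpath c 1 one_pos
          · rw [← arrow_mul_idem, mul_assoc, idem_mul_ne h, mul_zero]; exact S.zero_mem
        · by_cases h : Γ.next c = d
          · subst h; rw [← path_succ']; exact hpath c _ k.succ_pos
          · rw [arrow_mul_path_ne h hk]; exact S.zero_mem
    | mul x₁ x₂ h₁ h₂ =>
      intro y hy
      rw [map_mul, mul_assoc]
      exact h₁ _ (h₂ y hy)
    | add x₁ x₂ h₁ h₂ =>
      intro y hy
      rw [map_add, add_mul]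
      exact S.add_mem (h₁ y hy) (h₂ y hy)
  rw [eq_top_iff]
  rintro x -
  obtain ⟨x, rfl⟩ := RingQuot.mkAlgHom_surjective K (Rel K Γ) x
  rw [← mul_one (RingQuot.mkAlgHom K (Rel K Γ) x)]
  exact key x 1 hone

/-- The part of the algebra between two idempotents is spanned by paths. -/
lemma idem_mul_mul_idem_mem {i j : Γ.Edge} (S : Submodule K (BrauerTreeAlgebra K Γ))
    (hidem : i = j → idem K Γ i ∈ S)
    (hpath : ∀ d k, 0 < k → k ≤ Γ.period d → Γ.edgeOf d = i → Γ.edgeOf (Γ.next^[k] d) = j →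
      path K Γ d k ∈ S) (x : BrauerTreeAlgebra K Γ) : idem K Γ i * x * idem K Γ j ∈ S := by
  have hx : x ∈ (⊤ : Submodule K (BrauerTreeAlgebra K Γ)) := trivial
  rw [← span_paths K Γ] at hx
  induction hx using Submodule.span_induction with
  | mem x hx =>
    rcases hx with ⟨l, rfl⟩ | ⟨d, k, hk, hk', rfl⟩
    · by_cases hl : i = l
      · subst hl
        rw [idem_mul_self]
        by_cases hj : i = j
        · rw [← hj, idem_mul_self]
          exact hidem hj
        · rw [idem_mul_ne hj]
          exact S.zero_mem
      · rw [idem_mul_ne hl, zero_mul]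
        exact S.zero_mem
    · by_cases hi : i = Γ.edgeOf d
      · rw [hi, idem_mul_path d hk]
        by_cases hj : Γ.edgeOf (Γ.next^[k] d) = j
        · rw [← hj, path_mul_idem d hk]
          exact hpath d k hk hk' hi.symm hj
        · rw [← path_mul_idem d hk, mul_assoc, idem_mul_ne hj, mul_zero]
          exact S.zero_mem
      · rw [← idem_mul_path d hk, ← mul_assoc, idem_mul_ne hi, zero_mul, zero_mul]
        exact S.zero_mem
  | zero => rw [mul_zero, zero_mul]; exact S.zero_mem
  | add x y _ _ hx hy => rw [mul_add, add_mul]; exact S.add_mem hx hy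
  | smul r x _ hx => rw [mul_smul_comm, smul_mul_assoc]; exact S.smul_mem r hx

section Representation

variable (j : Γ.Edge)

variable (Γ) in
/-- The basis of the projective module of the edge `j`: a generator `inl true`, the socle
`inl false`, and the darts at the ends of `j`. -/
abbrev State := Bool ⊕ Γ.graph.Dart

/-- The edge of a basis element. -/
def State.edge : State Γ → Γ.Edge
  | .inl _ => j
  | .inr d => Γ.edgeOf d

open scoped Classical in
/-- The basis element that is mapped to a nonzero element by the arrow of `d`. -/
noncomputable def stateSource (d : Γ.graph.Dart) : State Γ :=
  if Γ.edgeOf (Γ.next d) = j then .inl true else .inr (Γ.next d)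

open scoped Classical in
/-- The nonzero element in the image of the arrow of `d`. -/
noncomputable def stateTarget (d : Γ.graph.Dart) : State Γ :=
  if Γ.edgeOf d = j then .inl false else .inr d

lemma edge_stateSource (d : Γ.graph.Dart) :
    (stateSource j d).edge j = Γ.edgeOf (Γ.next d) := by
  rw [stateSource]
  split_ifs with h
  · exact h.symm
  · rfl

lemma edge_stateTarget (d : Γ.graph.Dart) : (stateTarget j d).edge j = Γ.edgeOf d := by
  rw [stateTarget]
  split_ifs with h
  · exact h.symm
  · rfl

open scoped Classical in
variable (K) in
/-- The action of the arrow of `d`. -/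
noncomputable def arrowMatrix (d : Γ.graph.Dart) : Matrix (State Γ) (State Γ) K :=
  if d.fst ∈ (j : Sym2 V) then Matrix.single (stateTarget j d) (stateSource j d) 1 else 0

open scoped Classical in
variable (K) in
/-- The action of the idempotent of `i`. -/
noncomputable def idemMatrix (i : Γ.Edge) : Matrix (State Γ) (State Γ) K :=
  Matrix.diagonal fun s => if s.edge j = i then 1 else 0

variable [Fintype Γ.graph.Dart]

open scoped Classical in
lemma idemMatrix_mul_arrowMatrix (d : Γ.graph.Dart) :
    idemMatrix K j (Γ.edgeOf d) * arrowMatrix K j d = arrowMatrix K j d := by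
  rw [arrowMatrix]
  split_ifs with h
  · ext s t
    rw [idemMatrix, Matrix.diagonal_mul, Matrix.single_apply]
    by_cases hs : stateTarget j d = s
    · rw [← hs, edge_stateTarget, if_pos rfl, one_mul]
    · rw [if_neg (c := stateTarget j d = s ∧ _) fun h => hs h.1, mul_zero]
  · rw [mul_zero]

open scoped Classical in
lemma arrowMatrix_mul_idemMatrix (d : Γ.graph.Dart) :
    arrowMatrix K j d * idemMatrix K j (Γ.edgeOf (Γ.next d)) = arrowMatrix K j d := by
  rw [arrowMatrix]
  split_ifs with h
  · ext s t
    rw [idemMatrix, Matrix.mul_diagonal, Matrix.single_apply]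
    by_cases hs : stateSource j d = t
    · rw [← hs, edge_stateSource, if_pos rfl, mul_one]
    · rw [if_neg (c := _ ∧ stateSource j d = t) fun h => hs h.2, zero_mul]
  · rw [zero_mul]

open scoped Classical in
lemma arrowMatrix_mul_of_ne {d d' : Γ.graph.Dart} (h : stateSource j d ≠ stateTarget j d') :
    arrowMatrix K j d * arrowMatrix K j d' = 0 := by
  rw [arrowMatrix, arrowMatrix]
  split_ifs
  · exact Matrix.single_mul_single_of_ne _ _ _ _ h _
  all_goals simp

open scoped Classical in
lemma arrowMatrix_mul_symm (d : Γ.graph.Dart) :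
    arrowMatrix K j d * arrowMatrix K j (Γ.next d).symm = 0 := by
  refine arrowMatrix_mul_of_ne j ?_
  rw [stateSource, stateTarget]
  split_ifs
  · simp
  · simp
  · simp
  · simpa using (Γ.next d).symm_ne.symm

open scoped Classical in
lemma arrowMatrix_mul_next {d : Γ.graph.Dart} (h : Γ.edgeOf (Γ.next d) = j) :
    arrowMatrix K j d * arrowMatrix K j (Γ.next d) = 0 := by
  refine arrowMatrix_mul_of_ne j ?_
  rw [stateSource, stateTarget, if_pos h, if_pos h]
  simp

open scoped Classical in
lemma pathProd_arrowMatrix_of_ne {d : Γ.graph.Dart} (h : Γ.edgeOf d ≠ j) :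
    Γ.pathProd (arrowMatrix K j) d (Γ.period d) = 0 := by
  by_cases hd : d.fst ∈ (j : Sym2 V)
  · obtain ⟨d', hd', hj⟩ : ∃ d' : Γ.graph.Dart, d.fst = d'.fst ∧ Γ.edgeOf d' = j := by
      obtain ⟨c, rfl⟩ := Γ.edgeOf_surjective j
      rcases Sym2.mem_iff.1 (show d.fst ∈ s(c.fst, c.snd) from hd) with h₁ | h₁
      · exact ⟨c, h₁, rfl⟩
      · exact ⟨c.symm, h₁, Γ.edgeOf_symm c⟩
    obtain ⟨k, hk, rfl⟩ := Γ.exists_iterate hd'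
    obtain _ | k := k
    · exact absurd hj h
    obtain ⟨l, hl⟩ := Nat.exists_eq_add_of_lt hk
    rw [hl, show k + 1 + l + 1 = k + (2 + l) by ring, Γ.pathProd_add, Γ.pathProd_add,
      show (2 : ℕ) = 1 + 1 from rfl, Γ.pathProd_succ, Γ.pathProd_one, Function.iterate_one,
      arrowMatrix_mul_next j (by rwa [← Function.iterate_succ_apply' Γ.next]), zero_mul, mul_zero]
  · obtain ⟨l, hl⟩ := Nat.exists_eq_succ_of_ne_zero (Γ.period_pos d).ne'
    rw [hl, Γ.pathProd_succ', arrowMatrix, if_neg hd, zero_mul]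

open scoped Classical in
lemma pathProd_arrowMatrix {d : Γ.graph.Dart} (h : Γ.edgeOf d = j) {k : ℕ}
    (hk : k < Γ.period d) : Γ.pathProd (arrowMatrix K j) d (k + 1) =
      Matrix.single (.inl false) (stateSource j (Γ.next^[k] d)) 1 := by
  have hd : ∀ l, (Γ.next^[l] d).fst ∈ (j : Sym2 V) := fun l => by
    rw [Γ.iterate_fst, ← h]
    exact Sym2.mem_mk_left d.fst d.snd
  induction k with
  | zero => rw [Γ.pathProd_one, arrowMatrix, if_pos (show d.fst ∈ _ from hd 0), stateTarget, if_pos h]; rfl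
  | succ k ih =>
    have hne : Γ.edgeOf (Γ.next^[k + 1] d) ≠ j := fun e => by
      have := Γ.eq_of_fst_eq (e.trans h.symm) (Γ.iterate_fst d _)
      exact absurd (Γ.iterate_inj hk (Γ.period_pos d) this) k.succ_ne_zero
    rw [Γ.pathProd_succ, ih (Nat.lt_of_succ_lt hk), arrowMatrix, if_pos (hd _), stateTarget,
      if_neg hne, stateSource, ← Function.iterate_succ_apply' Γ.next, if_neg hne,
      Matrix.single_mul_single_same, mul_one]

open scoped Classical in
lemma pathProd_arrowMatrix_period {d : Γ.graph.Dart} (h : Γ.edgeOf d = j) :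
    Γ.pathProd (arrowMatrix K j) d (Γ.period d) =
      Matrix.single (.inl false) (.inl true) 1 := by
  obtain ⟨k, hk⟩ := Nat.exists_eq_succ_of_ne_zero (Γ.period_pos d).ne'
  rw [hk, pathProd_arrowMatrix j h (by omega), stateSource, ← Function.iterate_succ_apply' Γ.next,
    ← hk, Γ.iterate_period, if_pos h]

open scoped Classical in
lemma pathProd_arrowMatrix_symm (d : Γ.graph.Dart) :
    Γ.pathProd (arrowMatrix K j) d (Γ.period d) =
      Γ.pathProd (arrowMatrix K j) d.symm (Γ.period d.symm) := by
  by_cases h : Γ.edgeOf d = j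
  · rw [pathProd_arrowMatrix_period j h, pathProd_arrowMatrix_period j ((Γ.edgeOf_symm d).trans h)]
  · rw [pathProd_arrowMatrix_of_ne j h,
      pathProd_arrowMatrix_of_ne j fun e => h ((Γ.edgeOf_symm d).symm.trans e)]

open scoped Classical in
variable (K) in
/-- The action of the Brauer tree algebra on the projective module of the edge `j`. -/
noncomputable def representation :
    BrauerTreeAlgebra K Γ →ₐ[K] Matrix (State Γ) (State Γ) K :=
  RingQuot.liftAlgHom K ⟨FreeAlgebra.lift K (Sum.elim (idemMatrix K j) (arrowMatrix K j)), by
    have he : ∀ i, FreeAlgebra.lift K (Sum.elim (idemMatrix K j) (arrowMatrix K j)) (e K Γ i) =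
        idemMatrix K j i := fun i => FreeAlgebra.lift_ι_apply _ _
    have ha : ∀ d, FreeAlgebra.lift K (Sum.elim (idemMatrix K j) (arrowMatrix K j)) (a K Γ d) =
        arrowMatrix K j d := fun d => FreeAlgebra.lift_ι_apply _ _
    have hc : ∀ d, FreeAlgebra.lift K (Sum.elim (idemMatrix K j) (arrowMatrix K j)) (cyc K Γ d) =
        Γ.pathProd (arrowMatrix K j) d (Γ.period d) := fun d => by
      have := Γ.map_pathProd (a K Γ) d (FreeAlgebra.lift K
        (Sum.elim (idemMatrix K j) (arrowMatrix K j))).toMonoidHom (Γ.period d)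
      exact this.trans (congrArg (fun f => Γ.pathProd f d _) (funext ha))
    rintro x y (i | ⟨i, i', h⟩ | _ | d | d | d | d)
    · rw [map_mul, he, idemMatrix, Matrix.diagonal_mul_diagonal]
      simp
    · rw [map_mul, he, he, idemMatrix, idemMatrix, Matrix.diagonal_mul_diagonal, map_zero,
        ← Matrix.diagonal_zero]
      congr 1
      ext s
      by_cases hs : s.edge j = i
      · rw [if_neg (fun h' => h (hs.symm.trans h')), mul_zero]
      · rw [if_neg hs, zero_mul]
    · have := Γ.finite_edge
      have := Fintype.ofFinite Γ.Edge
      rw [finsum_eq_sum_of_fintype, map_sum, map_one, ← Matrix.diagonal_one]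
      simp_rw [he]
      ext s t
      rw [Matrix.sum_apply]
      by_cases hst : s = t
      · subst hst
        simp [idemMatrix]
      · simp [idemMatrix, Matrix.diagonal_apply_ne _ hst]
    · rw [map_mul, he, ha, idemMatrix_mul_arrowMatrix]
    · rw [map_mul, he, ha, arrowMatrix_mul_idemMatrix]
    · rw [map_mul, ha, ha, arrowMatrix_mul_symm, map_zero]
    · rw [hc, hc, pathProd_arrowMatrix_symm]⟩

open scoped Classical in
lemma representation_arrow (d : Γ.graph.Dart) :
    representation K j (arrow K Γ d) = arrowMatrix K j d := by
  rw [representation, arrow, RingQuot.liftAlgHom_mkAlgHom_apply]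
  exact FreeAlgebra.lift_ι_apply _ _

end Representation

/-- The socle elements are not zero: they act nontrivially on the projective module of an edge. -/
theorem path_period_ne_zero (d : Γ.graph.Dart) : path K Γ d (Γ.period d) ≠ 0 := by
  classical
  have := Γ.finite_dart
  have := Fintype.ofFinite Γ.graph.Dart
  intro h
  have h₁ := congrArg (representation K (Γ.edgeOf d)) h
  have h₂ := Γ.map_pathProd (arrow K Γ) d (representation K (Γ.edgeOf d)).toMonoidHom (Γ.period d)
  have h₃ : representation K (Γ.edgeOf d) (path K Γ d (Γ.period d)) =
      Γ.pathProd (arrowMatrix K (Γ.edgeOf d)) d (Γ.period d) :=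
    h₂.trans (congrArg (fun f => Γ.pathProd f d _) (funext (representation_arrow _)))
  rw [map_zero, h₃, pathProd_arrowMatrix_period _ rfl] at h₁
  have := congrFun (congrFun h₁ (.inl false)) (.inl true)
  rw [Matrix.single_apply_same] at this
  exact one_ne_zero this

end BrauerTreeAlgebra

/-! ### The Brauer star algebra -/

namespace BrauerTree

variable {n : ℕ}

/-- The dart at the centre of the star. -/
def centreDart (i : Fin n) : (star n).graph.Dart := starDartEquiv n (.inl i)

/-- The dart at a leaf of the star. -/
def leafDart (i : Fin n) : (star n).graph.Dart := starDartEquiv n (.inr i)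

lemma star_dart_cases {p : (star n).graph.Dart → Prop} (h₁ : ∀ i, p (centreDart i))
    (h₂ : ∀ i, p (leafDart i)) (d : (star n).graph.Dart) : p d := by
  obtain ⟨i | i, rfl⟩ := (starDartEquiv n).surjective d
  exacts [h₁ i, h₂ i]

lemma centreDart_symm (i : Fin n) : (centreDart i).symm = leafDart i := rfl

lemma leafDart_symm (i : Fin n) : (leafDart i).symm = centreDart i := rfl

lemma next_centreDart (i : Fin n) : (star n).next (centreDart i) = centreDart (finRotate n i) := by
  exact congrArg (fun x => starDartEquiv n (Equiv.Perm.sumCongr (finRotate n) 1 x))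
    ((starDartEquiv n).symm_apply_apply (.inl i))

lemma next_leafDart (i : Fin n) : (star n).next (leafDart i) = leafDart i := by
  exact congrArg (fun x => starDartEquiv n (Equiv.Perm.sumCongr (finRotate n) 1 x))
    ((starDartEquiv n).symm_apply_apply (.inr i))

lemma finRotate_val (i : Fin n) : (finRotate n i : ℕ) = (i + 1) % n := by
  cases n with
  | zero => exact i.elim0
  | succ n => rw [finRotate_apply, Fin.val_add, Fin.val_one', Nat.add_mod_mod]

lemma iterate_centreDart (i : Fin n) (k : ℕ) : (star n).next^[k] (centreDart i) =
    centreDart ⟨(i + k) % n, Nat.mod_lt _ i.pos⟩ := by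
  induction k with
  | zero => simp [Nat.mod_eq_of_lt i.2]
  | succ k ih =>
    rw [Function.iterate_succ_apply', ih, next_centreDart]
    congr 1
    ext
    rw [finRotate_val]
    simp [add_assoc]

lemma iterate_leafDart (i : Fin n) (k : ℕ) : (star n).next^[k] (leafDart i) = leafDart i :=
  Function.iterate_fixed (next_leafDart i) k

lemma centreDart_injective : Function.Injective (centreDart (n := n)) := fun _ _ h =>
  Sum.inl_injective ((starDartEquiv n).injective h)

lemma period_centreDart (i : Fin n) : (star n).period (centreDart i) = n := by
  have h := (star n).iterate_period (centreDart i)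
  rw [iterate_centreDart] at h
  have h' : (i + (star n).period (centreDart i)) % n = i :=
    congrArg Fin.val (centreDart_injective h)
  refine Nat.dvd_antisymm (Function.IsPeriodicPt.minimalPeriod_dvd ?_) ?_
  · rw [Function.IsPeriodicPt, Function.IsFixedPt, iterate_centreDart]
    simp [Nat.mod_eq_of_lt i.2]
  · have h₂ : (i + (star n).period (centreDart i)) ≡ i + 0 [MOD n] := by
      rw [Nat.ModEq, h', add_zero, Nat.mod_eq_of_lt i.2]
    exact (Nat.modEq_zero_iff_dvd).1 (Nat.ModEq.add_left_cancel' _ h₂)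

lemma period_leafDart (i : Fin n) : (star n).period (leafDart i) = 1 :=
  Function.minimalPeriod_eq_one_iff_isFixedPt.2 (next_leafDart i)

/-- The edges of the star. -/
def starEdge (i : Fin n) : (star n).Edge := (star n).edgeOf (centreDart i)

lemma edgeOf_leafDart (i : Fin n) : (star n).edgeOf (leafDart i) = starEdge i :=
  (star n).edgeOf_symm (centreDart i)

lemma starEdge_injective : Function.Injective (starEdge (n := n)) := fun _ _ h =>
  centreDart_injective ((star n).eq_of_fst_eq h rfl)

lemma starEdge_bijective : Function.Bijective (starEdge (n := n)) :=
  ⟨starEdge_injective, fun e => by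
    obtain ⟨d, rfl⟩ := (star n).edgeOf_surjective e
    induction d using star_dart_cases with
    | h₁ i => exact ⟨i, rfl⟩
    | h₂ i => exact ⟨i, (edgeOf_leafDart i).symm⟩⟩

/-- The edges of the star are numbered. -/
noncomputable def starEdgeEquiv (n : ℕ) : Fin n ≃ (star n).Edge :=
  Equiv.ofBijective starEdge starEdge_bijective

lemma starEdgeEquiv_symm (i : Fin n) : (starEdgeEquiv n).symm (starEdge i) = i :=
  (starEdgeEquiv n).symm_apply_apply i

end BrauerTree

/-- Generators of an algebra that satisfy the relations between the paths of the Brauer star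
algebra: `H i j` is the path from `i` to `j` for `i ≤ j` that does not pass the edge `0` again, and
`S i j` is the path from `i` to `j` that passes the edge `0` once more. -/
structure StarSystem (K : Type u) [Field K] (n : ℕ) (D : Type w) [Ring D] [Algebra K D] where
  H : Fin n → Fin n → D
  S : Fin n → Fin n → D
  H_mul_H : ∀ {i j k}, i ≤ j → j ≤ k → H i j * H j k = H i k
  H_mul_S : ∀ {i j k}, i ≤ j → H i j * S j k = S i k
  S_mul_H : ∀ {i j k}, j ≤ k → S i j * H j k = S i k
  S_mul_S : ∀ {i j k}, S i j * S j k = 0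
  H_mul_ne : ∀ {i j}, i ≠ j → H i i * H j j = 0
  S_lt : ∀ {i j}, i < j → S i j = 0
  S_self : ∀ i, S i i ≠ 0
  sum_H : ∑ i, H i i = 1
  span : Submodule.span K ({x | ∃ i j, i ≤ j ∧ x = H i j} ∪ {x | ∃ i j, x = S i j}) = ⊤

namespace StarSystem

open BrauerTree hiding star
open BrauerTreeAlgebra

variable {K : Type u} [Field K] {n : ℕ} {D : Type w} [Ring D] [Algebra K D]
  (σ : StarSystem K n D)

/-- The path of length `k` that starts at `i`. -/
def path (i : Fin n) (k : ℕ) : D :=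
  if h : i + k < n then σ.H i ⟨i + k, h⟩ else σ.S i ⟨(i + k) % n, Nat.mod_lt _ i.pos⟩

lemma path_of_lt {i j : Fin n} {k : ℕ} (h : (i : ℕ) + k = j) : σ.path i k = σ.H i j := by
  have hj : (⟨i + k, h ▸ j.2⟩ : Fin n) = j := Fin.ext h
  rw [path, dif_pos (h ▸ j.2), hj]

lemma path_of_le {i j : Fin n} {k : ℕ} (h : (i : ℕ) + k = n + j) : σ.path i k = σ.S i j := by
  have hj : (⟨(i + k) % n, Nat.mod_lt _ i.pos⟩ : Fin n) = j := Fin.ext (by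
    simp [h, Nat.mod_eq_of_lt j.2])
  rw [path, dif_neg (by omega), hj]

lemma path_mul (i : Fin n) {k : ℕ} (hkn : k < n) :
    σ.path i k * σ.path ⟨(i + k) % n, Nat.mod_lt _ i.pos⟩ 1 = σ.path i (k + 1) := by
  have hi := i.2
  rcases lt_or_ge (i + k : ℕ) n with h | h
  · have e₁ : (⟨(i + k) % n, Nat.mod_lt _ i.pos⟩ : Fin n) = ⟨i + k, h⟩ :=
      Fin.ext (Nat.mod_eq_of_lt h)
    rw [e₁, σ.path_of_lt (j := ⟨i + k, h⟩) rfl]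
    rcases lt_or_ge (i + k + 1 : ℕ) n with h' | h'
    · rw [σ.path_of_lt (i := i) (j := ⟨i + k + 1, h'⟩) (by simp; omega),
        σ.path_of_lt (j := ⟨i + k + 1, h'⟩) (by simp),
        σ.H_mul_H (by simp [Fin.le_def]) (by simp [Fin.le_def])]
    · rw [σ.path_of_le (i := i) (j := ⟨0, i.pos⟩) (by simp; omega),
        σ.path_of_le (j := ⟨0, i.pos⟩) (by simp; omega), σ.H_mul_S (by simp [Fin.le_def])]
  · obtain ⟨l, hl⟩ := Nat.exists_eq_add_of_le h
    have e₁ : (⟨(i + k) % n, Nat.mod_lt _ i.pos⟩ : Fin n) = ⟨l, by omega⟩ :=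
      Fin.ext (by simp only [hl, Nat.add_mod_left]; exact Nat.mod_eq_of_lt (by omega))
    rw [e₁, σ.path_of_le (j := ⟨l, by omega⟩) hl,
      σ.path_of_le (i := i) (j := ⟨l + 1, by omega⟩) (by simp; omega),
      σ.path_of_lt (j := ⟨l + 1, by omega⟩) (by simp), σ.S_mul_H (by simp [Fin.le_def])]

lemma H_mul_path (i : Fin n) {k : ℕ} (hk : k ≤ n) : σ.H i i * σ.path i k = σ.path i k := by
  have hi := i.2
  rcases lt_or_ge (i + k : ℕ) n with h | h
  · rw [σ.path_of_lt (j := ⟨i + k, h⟩) rfl, σ.H_mul_H le_rfl (by simp [Fin.le_def])]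
  · obtain ⟨l, hl⟩ := Nat.exists_eq_add_of_le h
    rw [σ.path_of_le (j := ⟨l, by omega⟩) hl, σ.H_mul_S le_rfl]

lemma path_mul_H (i : Fin n) {k : ℕ} (hk : k ≤ n) :
    σ.path i k * σ.H ⟨(i + k) % n, Nat.mod_lt _ i.pos⟩ ⟨(i + k) % n, Nat.mod_lt _ i.pos⟩ =
      σ.path i k := by
  have hi := i.2
  rcases lt_or_ge (i + k : ℕ) n with h | h
  · have e₁ : (⟨(i + k) % n, Nat.mod_lt _ i.pos⟩ : Fin n) = ⟨i + k, h⟩ :=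
      Fin.ext (Nat.mod_eq_of_lt h)
    rw [e₁, σ.path_of_lt (j := ⟨i + k, h⟩) rfl, σ.H_mul_H (by simp [Fin.le_def]) le_rfl]
  · obtain ⟨l, hl⟩ := Nat.exists_eq_add_of_le h
    have e₁ : (⟨(i + k) % n, Nat.mod_lt _ i.pos⟩ : Fin n) = ⟨l, by omega⟩ :=
      Fin.ext (by simp only [hl, Nat.add_mod_left]; exact Nat.mod_eq_of_lt (by omega))
    rw [e₁, σ.path_of_le (j := ⟨l, by omega⟩) hl, σ.S_mul_H le_rfl]

lemma path_mul_S (i : Fin n) : σ.path i 1 *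
    σ.S ⟨(i + 1) % n, Nat.mod_lt _ i.pos⟩ ⟨(i + 1) % n, Nat.mod_lt _ i.pos⟩ = 0 := by
  have hi := i.2
  rcases lt_or_ge (i + 1 : ℕ) n with h | h
  · have e₁ : (⟨(i + 1) % n, Nat.mod_lt _ i.pos⟩ : Fin n) = ⟨i + 1, h⟩ :=
      Fin.ext (Nat.mod_eq_of_lt h)
    rw [e₁, σ.path_of_lt (j := ⟨i + 1, h⟩) rfl, σ.H_mul_S (by simp [Fin.le_def]),
      σ.S_lt (by simp [Fin.lt_def])]
  · have e₁ : (⟨(i + 1) % n, Nat.mod_lt _ i.pos⟩ : Fin n) = ⟨0, i.pos⟩ :=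
      Fin.ext (by simp [show (i : ℕ) + 1 = n by omega])
    rw [e₁, σ.path_of_le (j := ⟨0, i.pos⟩) (by simp; omega), σ.S_mul_S]

lemma S_mul_path (i : Fin n) : σ.S i i * σ.path i 1 = 0 := by
  have hi := i.2
  rcases lt_or_ge (i + 1 : ℕ) n with h | h
  · rw [σ.path_of_lt (j := ⟨i + 1, h⟩) rfl, σ.S_mul_H (by simp [Fin.le_def]),
      σ.S_lt (by simp [Fin.lt_def])]
  · rw [σ.path_of_le (j := ⟨0, i.pos⟩) (by simp; omega), σ.S_mul_S]

/-- The image of the arrow of a dart. -/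
noncomputable def dartImage (d : (BrauerTree.star n).graph.Dart) : D :=
  Sum.elim (fun i => σ.path i 1) (fun i => σ.S i i) ((starDartEquiv n).symm d)

lemma dartImage_centreDart (i : Fin n) : σ.dartImage (centreDart i) = σ.path i 1 := by
  exact congrArg (Sum.elim _ _) ((starDartEquiv n).symm_apply_apply (.inl i))

lemma dartImage_leafDart (i : Fin n) : σ.dartImage (leafDart i) = σ.S i i := by
  exact congrArg (Sum.elim _ _) ((starDartEquiv n).symm_apply_apply (.inr i))

/-- The image of the idempotent of an edge. -/
noncomputable def edgeImage (e : (BrauerTree.star n).Edge) : D :=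
  σ.H ((starEdgeEquiv n).symm e) ((starEdgeEquiv n).symm e)

lemma edgeImage_starEdge (i : Fin n) : σ.edgeImage (starEdge i) = σ.H i i := by
  rw [edgeImage, starEdgeEquiv_symm]

lemma pathProd_dartImage (i : Fin n) {k : ℕ} (hk : 0 < k) (hkn : k ≤ n) :
    (BrauerTree.star n).pathProd σ.dartImage (centreDart i) k = σ.path i k := by
  induction k, hk using Nat.le_induction with
  | base => rw [Nat.succ_eq_add_one, Nat.zero_add, pathProd_one, dartImage_centreDart]
  | succ k hk ih =>
    rw [pathProd_succ, ih (by omega), iterate_centreDart, dartImage_centreDart,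
      σ.path_mul i (by omega)]

lemma pathProd_dartImage_leafDart (i : Fin n) :
    (BrauerTree.star n).pathProd σ.dartImage (leafDart i) ((BrauerTree.star n).period (leafDart i)) = σ.S i i := by
  rw [period_leafDart, pathProd_one, dartImage_leafDart]

lemma pathProd_dartImage_centreDart (i : Fin n) :
    (BrauerTree.star n).pathProd σ.dartImage (centreDart i) ((BrauerTree.star n).period (centreDart i)) = σ.S i i := by
  rw [period_centreDart, σ.pathProd_dartImage i i.pos le_rfl,
    σ.path_of_le (j := i) (by omega)]

/-- The homomorphism from the Brauer star algebra. -/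
noncomputable def algHom : BrauerTreeAlgebra K (BrauerTree.star n) →ₐ[K] D :=
  RingQuot.liftAlgHom K ⟨FreeAlgebra.lift K (Sum.elim σ.edgeImage σ.dartImage), by
    have he : ∀ i, FreeAlgebra.lift K (Sum.elim σ.edgeImage σ.dartImage) (e K (BrauerTree.star n) i) =
        σ.edgeImage i := fun i => FreeAlgebra.lift_ι_apply _ _
    have ha : ∀ d, FreeAlgebra.lift K (Sum.elim σ.edgeImage σ.dartImage) (a K (BrauerTree.star n) d) =
        σ.dartImage d := fun d => FreeAlgebra.lift_ι_apply _ _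
    have hc : ∀ d, FreeAlgebra.lift K (Sum.elim σ.edgeImage σ.dartImage) (cyc K (BrauerTree.star n) d) =
        (BrauerTree.star n).pathProd σ.dartImage d ((BrauerTree.star n).period d) := fun d => by
      have := (BrauerTree.star n).map_pathProd (a K (BrauerTree.star n)) d (FreeAlgebra.lift K
        (Sum.elim σ.edgeImage σ.dartImage)).toMonoidHom ((BrauerTree.star n).period d)
      exact this.trans (congrArg (fun f => (BrauerTree.star n).pathProd f d _) (funext ha))
    rintro x y (i | ⟨i, i', h⟩ | _ | d | d | d | d)
    · rw [map_mul, he, edgeImage, σ.H_mul_H le_rfl le_rfl]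
    · rw [map_mul, he, he, edgeImage, edgeImage,
        σ.H_mul_ne ((starEdgeEquiv n).symm.injective.ne h), map_zero]
    · have := (BrauerTree.star n).finite_edge
      have := Fintype.ofFinite (BrauerTree.star n).Edge
      rw [finsum_eq_sum_of_fintype, map_sum, map_one, ← σ.sum_H]
      simp_rw [he]
      exact Fintype.sum_equiv (starEdgeEquiv n).symm _ _ fun _ => rfl
    · rw [map_mul, he, ha]
      induction d using star_dart_cases with
      | h₁ i =>
        rw [← starEdge, σ.edgeImage_starEdge, dartImage_centreDart, σ.H_mul_path i i.pos]
      | h₂ i =>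
        rw [edgeOf_leafDart, σ.edgeImage_starEdge, dartImage_leafDart, σ.H_mul_S le_rfl]
    · rw [map_mul, he, ha]
      induction d using star_dart_cases with
      | h₁ i =>
        have h := iterate_centreDart i 1
        rw [Function.iterate_one] at h
        rw [h, ← starEdge, σ.edgeImage_starEdge, dartImage_centreDart, σ.path_mul_H i i.pos]
      | h₂ i =>
        rw [next_leafDart, edgeOf_leafDart, σ.edgeImage_starEdge, dartImage_leafDart,
          σ.S_mul_H le_rfl]
    · rw [map_mul, ha, ha, map_zero]
      induction d using star_dart_cases with
      | h₁ i =>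
        have h := iterate_centreDart i 1
        rw [Function.iterate_one] at h
        rw [h, centreDart_symm, dartImage_centreDart, dartImage_leafDart, σ.path_mul_S]
      | h₂ i =>
        rw [next_leafDart, leafDart_symm, dartImage_centreDart, dartImage_leafDart, σ.S_mul_path]
    · rw [hc, hc]
      induction d using star_dart_cases with
      | h₁ i =>
        rw [centreDart_symm, pathProd_dartImage_centreDart, pathProd_dartImage_leafDart]
      | h₂ i =>
        rw [leafDart_symm, pathProd_dartImage_centreDart, pathProd_dartImage_leafDart]⟩

lemma algHom_idem (i : Fin n) : σ.algHom (idem K (BrauerTree.star n) (starEdge i)) = σ.H i i := by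
  rw [algHom, idem, RingQuot.liftAlgHom_mkAlgHom_apply, ← edgeImage_starEdge]
  exact FreeAlgebra.lift_ι_apply _ _

lemma algHom_arrow (d : (BrauerTree.star n).graph.Dart) : σ.algHom (arrow K (BrauerTree.star n) d) = σ.dartImage d := by
  rw [algHom, arrow, RingQuot.liftAlgHom_mkAlgHom_apply]
  exact FreeAlgebra.lift_ι_apply _ _

lemma algHom_path (i : Fin n) {k : ℕ} (hk : 0 < k) (hkn : k ≤ n) :
    σ.algHom (BrauerTreeAlgebra.path K (BrauerTree.star n) (centreDart i) k) = σ.path i k := by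
  rw [← σ.pathProd_dartImage i hk hkn]
  exact ((BrauerTree.star n).map_pathProd (arrow K (BrauerTree.star n)) (centreDart i) σ.algHom.toMonoidHom k).trans
    (congrArg (fun f => (BrauerTree.star n).pathProd f _ _) (funext σ.algHom_arrow))

lemma algHom_surjective : Function.Surjective σ.algHom := by
  rw [← AlgHom.coe_toLinearMap, ← LinearMap.range_eq_top, ← top_le_iff, ← σ.span,
    Submodule.span_le]
  rintro x (⟨i, j, hij, rfl⟩ | ⟨i, j, rfl⟩)
  · rcases hij.eq_or_lt with rfl | hij
    · exact ⟨_, σ.algHom_idem i⟩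
    · refine ⟨_, (σ.algHom_path i (k := j - i) (by omega) (by omega)).trans ?_⟩
      exact σ.path_of_lt (by omega)
  · rcases lt_or_ge i j with h | h
    · rw [σ.S_lt h]
      exact Submodule.zero_mem _
    · refine ⟨_, (σ.algHom_path i (k := n + j - i) (by omega) (by omega)).trans ?_⟩
      exact σ.path_of_le (by omega)

lemma path_self_eq (i : Fin n) : BrauerTreeAlgebra.path K (BrauerTree.star n) (leafDart i) 1 =
    BrauerTreeAlgebra.path K (BrauerTree.star n) (centreDart i) n := by
  have := path_period_symm (K := K) (centreDart i)
  rwa [centreDart_symm, period_leafDart, period_centreDart] at this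

lemma eq_zero_of_algHom_eq_zero {i j : Fin n} {x : BrauerTreeAlgebra K (BrauerTree.star n)}
    (h : σ.algHom x = 0) : idem K (BrauerTree.star n) (starEdge i) * x * idem K (BrauerTree.star n) (starEdge j) = 0 := by
  have hF : σ.algHom (idem K (BrauerTree.star n) (starEdge i) * x * idem K (BrauerTree.star n) (starEdge j)) = 0 := by
    rw [map_mul, map_mul, h, mul_zero, zero_mul]
  rcases lt_trichotomy i j with hij | rfl | hij
  · have hmem := idem_mul_mul_idem_mem (i := starEdge i) (j := starEdge j)
      (Submodule.span K {BrauerTreeAlgebra.path K (BrauerTree.star n) (centreDart i) (j - i)})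
      (fun e => absurd (starEdge_injective e) hij.ne) (fun d k hk hk' h₁ h₂ => by
        induction d using star_dart_cases with
        | h₁ l =>
          obtain rfl := starEdge_injective h₁
          rw [iterate_centreDart] at h₂
          have h₃ := congrArg Fin.val (starEdge_injective h₂)
          rw [period_centreDart] at hk'
          simp only at h₃
          have : k = j - l := by
            rcases lt_or_ge (l + k : ℕ) n with h₄ | h₄
            · rw [Nat.mod_eq_of_lt h₄] at h₃; omega
            · rw [Nat.mod_eq_sub_mod h₄, Nat.mod_eq_of_lt (by omega)] at h₃; omega
          rw [this]
          exact Submodule.mem_span_singleton_self _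
        | h₂ l =>
          rw [iterate_leafDart, h₁] at h₂
          exact absurd (starEdge_injective h₂) hij.ne) x
    obtain ⟨r, hr⟩ := Submodule.mem_span_singleton.1 hmem
    rw [← hr] at hF ⊢
    rw [map_smul, σ.algHom_path i (by omega) (by omega), σ.path_of_lt (j := j) (by omega)] at hF
    have := congrArg (· * σ.S j i) hF
    simp only [smul_mul_assoc, σ.H_mul_S hij.le, zero_mul] at this
    rw [(smul_eq_zero.1 this).resolve_right (σ.S_self i), zero_smul]
  · have hmem := idem_mul_mul_idem_mem (i := starEdge i) (j := starEdge i)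
      (Submodule.span K {idem K (BrauerTree.star n) (starEdge i),
        BrauerTreeAlgebra.path K (BrauerTree.star n) (centreDart i) n})
      (fun _ => Submodule.subset_span (by simp)) (fun d k hk hk' h₁ h₂ => by
        refine Submodule.subset_span (Or.inr ?_)
        induction d using star_dart_cases with
        | h₁ l =>
          obtain rfl := starEdge_injective h₁
          rw [iterate_centreDart] at h₂
          have h₃ := congrArg Fin.val (starEdge_injective h₂)
          rw [period_centreDart] at hk'
          simp only at h₃
          have : k = n := by
            rcases lt_or_ge (l + k : ℕ) n with h₄ | h₄
            · rw [Nat.mod_eq_of_lt h₄] at h₃; omega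
            · rw [Nat.mod_eq_sub_mod h₄, Nat.mod_eq_of_lt (by omega)] at h₃; omega
          rw [this]
          rfl
        | h₂ l =>
          rw [edgeOf_leafDart] at h₁
          obtain rfl := starEdge_injective h₁
          rw [period_leafDart] at hk'
          obtain rfl : k = 1 := by omega
          exact path_self_eq l) x
    obtain ⟨r, s, hr⟩ := Submodule.mem_span_pair.1 hmem
    rw [← hr] at hF ⊢
    rw [map_add, map_smul, map_smul, σ.algHom_path i i.pos le_rfl, σ.path_of_le (j := i) (by omega),
      algHom_idem] at hF
    have := congrArg (· * σ.S i i) hF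
    simp only [add_mul, smul_mul_assoc, σ.H_mul_S le_rfl, zero_mul, σ.S_mul_S, smul_zero,
      add_zero] at this
    have hr₀ := (smul_eq_zero.1 this).resolve_right (σ.S_self i)
    rw [hr₀, zero_smul, zero_add] at hF
    rw [hr₀, (smul_eq_zero.1 hF).resolve_right (σ.S_self i), zero_smul, zero_smul, add_zero]
  · have hmem := idem_mul_mul_idem_mem (i := starEdge i) (j := starEdge j)
      (Submodule.span K {BrauerTreeAlgebra.path K (BrauerTree.star n) (centreDart i) (n + j - i)})
      (fun e => absurd (starEdge_injective e) hij.ne') (fun d k hk hk' h₁ h₂ => by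
        induction d using star_dart_cases with
        | h₁ l =>
          obtain rfl := starEdge_injective h₁
          rw [iterate_centreDart] at h₂
          have h₃ := congrArg Fin.val (starEdge_injective h₂)
          rw [period_centreDart] at hk'
          simp only at h₃
          have : k = n + j - l := by
            rcases lt_or_ge (l + k : ℕ) n with h₄ | h₄
            · rw [Nat.mod_eq_of_lt h₄] at h₃; omega
            · rw [Nat.mod_eq_sub_mod h₄, Nat.mod_eq_of_lt (by omega)] at h₃; omega
          rw [this]
          exact Submodule.mem_span_singleton_self _
        | h₂ l =>
          rw [iterate_leafDart, h₁] at h₂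
          exact absurd (starEdge_injective h₂) hij.ne') x
    obtain ⟨r, hr⟩ := Submodule.mem_span_singleton.1 hmem
    rw [← hr] at hF ⊢
    rw [map_smul, σ.algHom_path i (by omega) (by omega), σ.path_of_le (j := j) (by omega)] at hF
    have := congrArg (· * σ.H j i) hF
    simp only [smul_mul_assoc, σ.S_mul_H hij.le, zero_mul] at this
    rw [(smul_eq_zero.1 this).resolve_right (σ.S_self i), zero_smul]

lemma sum_idem_starEdge : ∑ i : Fin n, idem K (BrauerTree.star n) (starEdge i) = 1 := by
  have := (BrauerTree.star n).finite_edge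
  have := Fintype.ofFinite (BrauerTree.star n).Edge
  rw [← sum_idem]
  exact Fintype.sum_equiv (starEdgeEquiv n) _ _ fun _ => rfl

lemma algHom_injective : Function.Injective σ.algHom := by
  rw [injective_iff_map_eq_zero]
  intro x hx
  rw [← one_mul x, ← mul_one (1 * x), ← sum_idem_starEdge, Finset.sum_mul, Finset.sum_mul]
  refine Finset.sum_eq_zero fun i _ => ?_
  rw [Finset.mul_sum]
  exact Finset.sum_eq_zero fun j _ => σ.eq_zero_of_algHom_eq_zero hx

/-- An algebra with a star system is the Brauer star algebra. -/
noncomputable def algEquiv : D ≃ₐ[K] BrauerTreeAlgebra K (BrauerTree.star n) :=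
  (AlgEquiv.ofBijective σ.algHom ⟨σ.algHom_injective, σ.algHom_surjective⟩).symm

end StarSystem

/-! ### Endomorphism rings of direct sums of chains of objects -/

section Chain

variable {K : Type u} [Field K] {C : Type w} [Category.{v} C] [Preadditive C] [Linear K C] {n : ℕ}

lemma comp_eq_of_index_eq {Y : Fin n → C} {Z : C} {ι : ∀ i, Y i ⟶ Z} {π : ∀ i, Z ⟶ Y i}
    (hι : ∀ i, ι i ≫ π i = 𝟙 _) (i j k : Fin n) (f : Y j ⟶ Y i) (g : Y k ⟶ Y j) :
    (π k ≫ g ≫ ι j) ≫ (π j ≫ f ≫ ι i) = π k ≫ (g ≫ f) ≫ ι i := by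
  simp only [Category.assoc, reassoc_of% hι j]

/-- A direct sum of objects `Y i` has a star system of endomorphisms if the morphisms between the
objects `Y i` are given by two chains of morphisms `g` and `s`. -/
def StarSystem.ofChain (Y : Fin n → C) (g s : ∀ i j, Y j ⟶ Y i) (g_self : ∀ i, g i i = 𝟙 _)
    (g_comp_g : ∀ {i j k}, i ≤ j → j ≤ k → g j k ≫ g i j = g i k)
    (s_comp_g : ∀ {i j k}, i ≤ j → s j k ≫ g i j = s i k)
    (g_comp_s : ∀ {i j k}, j ≤ k → g j k ≫ s i j = s i k)
    (s_comp_s : ∀ {i j k}, s j k ≫ s i j = 0) (s_lt : ∀ {i j}, i < j → s i j = 0)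
    (s_self : ∀ i, s i i ≠ 0)
    (span_le : ∀ {i j}, i ≤ j → ∀ f : Y j ⟶ Y i, ∃ α β : K, f = α • g i j + β • s i j)
    (span_gt : ∀ {i j}, j < i → ∀ f : Y j ⟶ Y i, ∃ β : K, f = β • s i j)
    {Z : C} (ι : ∀ i, Y i ⟶ Z) (π : ∀ i, Z ⟶ Y i) (ι_π : ∀ i, ι i ≫ π i = 𝟙 _)
    (ι_π_ne : ∀ {i j}, i ≠ j → ι i ≫ π j = 0) (total : ∑ i, π i ≫ ι i = 𝟙 Z) :
    StarSystem K n (End Z) where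
  H i j := π j ≫ g i j ≫ ι i
  S i j := π j ≫ s i j ≫ ι i
  H_mul_H h h' := by rw [End.mul_def, comp_eq_of_index_eq ι_π, g_comp_g h h']
  H_mul_S h := by rw [End.mul_def, comp_eq_of_index_eq ι_π, s_comp_g h]
  S_mul_H h := by rw [End.mul_def, comp_eq_of_index_eq ι_π, g_comp_s h]
  S_mul_S := by
    intros
    rw [End.mul_def, comp_eq_of_index_eq ι_π, s_comp_s, zero_comp, comp_zero]
  H_mul_ne h := by
    rw [End.mul_def]
    simp [reassoc_of% ι_π_ne h.symm]
  S_lt h := by rw [s_lt h, zero_comp, comp_zero]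
  S_self i h := s_self i (by
    have := congrArg (fun f => ι i ≫ f ≫ π i) h
    simpa [ι_π, reassoc_of% ι_π i] using this)
  sum_H := by simpa [g_self] using total
  span := by
    rw [eq_top_iff]
    rintro (f : Z ⟶ Z) -
    have hf : f = ∑ i, ∑ j, π j ≫ (ι j ≫ f ≫ π i) ≫ ι i := by
      calc f = (∑ j, π j ≫ ι j) ≫ f ≫ ∑ i, π i ≫ ι i := by rw [total]; simp
        _ = _ := by
          rw [Preadditive.comp_sum, Preadditive.comp_sum]
          refine Finset.sum_congr rfl fun i _ => ?_
          rw [Preadditive.sum_comp]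
          simp
    rw [hf]
    refine Submodule.sum_mem _ fun i _ => Submodule.sum_mem _ fun j _ => ?_
    rcases le_or_gt i j with h | h
    · obtain ⟨α, β, h'⟩ := span_le h (ι j ≫ f ≫ π i)
      rw [h']
      have : π j ≫ (α • g i j + β • s i j) ≫ ι i =
          α • (π j ≫ g i j ≫ ι i) + β • (π j ≫ s i j ≫ ι i) := by simp
      rw [this]
      exact Submodule.add_mem _
        (Submodule.smul_mem _ _ (Submodule.subset_span (Or.inl ⟨i, j, h, rfl⟩)))
        (Submodule.smul_mem _ _ (Submodule.subset_span (Or.inr ⟨i, j, rfl⟩)))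
    · obtain ⟨β, h'⟩ := span_gt h (ι j ≫ f ≫ π i)
      rw [h']
      have : π j ≫ (β • s i j) ≫ ι i = β • (π j ≫ s i j ≫ ι i) := by simp
      rw [this]
      exact Submodule.smul_mem _ _ (Submodule.subset_span (Or.inr ⟨i, j, rfl⟩))

end Chain

/-! ### The endomorphism ring of the tilting complex of a Brauer system -/

namespace BrauerSystem

open TwoTermComplex

variable {K : Type u} [Field K] {W : Type} {R : PlaneTree W} {C : Type w}
    [Category.{v} C] [Preadditive C] [Linear K C] (B : BrauerSystem K R C)
    [Fintype W] [HasFiniteBiproducts C] [HasZeroObject C]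

/-- The two-term complex of a vertex. -/
noncomputable abbrev cx (w : W) : CochainComplex C ℤ := of (B.diff w)

/-- The two-term complex of a vertex in the homotopy category. -/
noncomputable abbrev hcx (w : W) : HomotopyCategory C (ComplexShape.up ℤ) :=
  (HomotopyCategory.quotient C (ComplexShape.up ℤ)).obj (B.cx w)

/-- The class in the homotopy category of the socle endomorphism of the root. -/
noncomputable def hsocle (w x : W) : B.hcx w ⟶ B.hcx x :=
  (HomotopyCategory.quotient C (ComplexShape.up ℤ)).map
    (homMk (B.socle w x) 0 (by rw [socle_comp_diff, comp_zero]))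

variable {B}

lemma hsocle_eq_zero_iff {w x : W} :
    B.hsocle w x = 0 ↔ unitMatrix K R.root R.root ∈ B.nullMatrices w x := by
  rw [hsocle, quotient_map_eq_zero_iff, hom₀_homMk, hom₁_homMk]
  exact exists_congr fun h => by rw [cmat_one_root, socle]

lemma hsocle_comp {w x y : W} (φ : B.cx x ⟶ B.cx y) :
    B.hsocle w x ≫ (HomotopyCategory.quotient C (ComplexShape.up ℤ)).map φ =
      B.rootCoeff (hom₀ φ) • B.hsocle w y := by
  rw [hsocle, hsocle, ← Functor.map_comp, ← Functor.map_smul]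
  congr 1
  apply hom_ext
  · rw [hom₀_comp, hom₀_homMk, hom₀_smul, hom₀_homMk, socle_comp]
  · rw [hom₁_comp, hom₁_homMk, hom₁_smul, hom₁_homMk, zero_comp, smul_zero]

lemma comp_hsocle {w x y : W} (φ : B.cx w ⟶ B.cx x) :
    (HomotopyCategory.quotient C (ComplexShape.up ℤ)).map φ ≫ B.hsocle x y =
      B.rootCoeff (hom₀ φ) • B.hsocle w y := by
  rw [hsocle, hsocle, ← Functor.map_comp, ← Functor.map_smul]
  congr 1
  apply hom_ext
  · rw [hom₀_comp, hom₀_homMk, hom₀_smul, hom₀_homMk, comp_socle]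
  · rw [hom₁_comp, hom₁_homMk, hom₁_smul, hom₁_homMk, comp_zero, smul_zero]

lemma hsocle_comp_hsocle (w x y : W) : B.hsocle w x ≫ B.hsocle x y = 0 := by
  conv_lhs => rw [hsocle.eq_1 B x y]
  rw [hsocle_comp, hom₀_homMk, rootCoeff_socle, zero_smul]

lemma hsocle_self_ne_zero (w : W) : B.hsocle w w ≠ 0 := fun h =>
  B.unitMatrix_root_notMem w (hsocle_eq_zero_iff.1 h)

lemma hsocle_eq_zero {w x : W} (hne : w ≠ x) (φ : B.cx w ⟶ B.cx x)
    (h : B.rootCoeff (hom₀ φ) ≠ 0) : B.hsocle w x = 0 :=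
  hsocle_eq_zero_iff.2 (B.unitMatrix_root_mem_of_rootCoeff_ne_zero (hom_comm φ) h hne)

lemma exists_eq_smul_hsocle {w x : W} (φ : B.cx w ⟶ B.cx x) (h : B.rootCoeff (hom₀ φ) = 0) :
    ∃ β : K, (HomotopyCategory.quotient C (ComplexShape.up ℤ)).map φ = β • B.hsocle w x := by
  obtain ⟨β, ν, ⟨p, hp₀, hp₁⟩, h₀, h₁⟩ :=
    B.exists_nullMatrices_of_rootCoeff_eq_zero (hom_comm φ) h
  refine ⟨β, ?_⟩
  rw [← sub_eq_zero, hsocle, ← Functor.map_smul, ← Functor.map_sub, quotient_map_eq_zero_iff]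
  refine ⟨p, ?_, ?_⟩
  · rw [hom₀_sub, hom₀_smul, hom₀_homMk, h₀, map_add, map_smul, ← socle, add_sub_cancel_right, hp₀]
  · rw [hom₁_sub, hom₁_smul, hom₁_homMk, h₁, map_add, map_smul, cmat_one_root, smul_zero,
      sub_zero, add_zero, hp₁]

lemma exists_eq_smul_add_smul {w x : W} (φ ψ : B.cx w ⟶ B.cx x)
    (h : B.rootCoeff (hom₀ ψ) = 1) :
    ∃ α β : K, (HomotopyCategory.quotient C (ComplexShape.up ℤ)).map φ =
      α • (HomotopyCategory.quotient C (ComplexShape.up ℤ)).map ψ + β • B.hsocle w x := by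
  obtain ⟨β, hβ⟩ := exists_eq_smul_hsocle (φ + (-B.rootCoeff (hom₀ φ)) • ψ) (by
    have : hom₀ (φ + (-B.rootCoeff (hom₀ φ)) • ψ) =
        hom₀ φ + (-B.rootCoeff (hom₀ φ)) • hom₀ ψ := by simp [hom₀]
    rw [this, rootCoeff_add, rootCoeff_smul, h, mul_one, add_neg_cancel])
  refine ⟨B.rootCoeff (hom₀ φ), β, ?_⟩
  rw [← hβ, Functor.map_add, Functor.map_smul, neg_smul]
  abel

lemma quotient_map_eq {w x : W} (hne : w ≠ x) (φ ψ : B.cx w ⟶ B.cx x)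
    (hφ : B.rootCoeff (hom₀ φ) = 1) (hψ : B.rootCoeff (hom₀ ψ) = 1) :
    (HomotopyCategory.quotient C (ComplexShape.up ℤ)).map φ =
      (HomotopyCategory.quotient C (ComplexShape.up ℤ)).map ψ := by
  obtain ⟨β, hβ⟩ := exists_eq_smul_hsocle (φ + (-1 : K) • ψ) (by
    have : hom₀ (φ + (-1 : K) • ψ) = hom₀ φ + (-1 : K) • hom₀ ψ := by simp [hom₀]
    rw [this, rootCoeff_add, rootCoeff_smul, hφ, hψ, mul_one, add_neg_cancel])
  rw [hsocle_eq_zero hne φ (by rw [hφ]; exact one_ne_zero), smul_zero, Functor.map_add,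
    Functor.map_smul, neg_smul, one_smul] at hβ
  exact add_neg_eq_zero.1 hβ

variable (B) in
/-- The order of the vertices: `w ≤ x` if there is a morphism from the complex of `x` to that of
`w` that is the identity at the root. -/
def Below (w x : W) : Prop := ∃ φ : B.cx x ⟶ B.cx w, B.rootCoeff (hom₀ φ) = 1

lemma Below.refl (w : W) : B.Below w w := ⟨𝟙 _, by rw [hom₀_id, rootCoeff_id]⟩

lemma Below.trans {w x y : W} : B.Below w x → B.Below x y → B.Below w y := by
  rintro ⟨φ, hφ⟩ ⟨ψ, hψ⟩
  exact ⟨ψ ≫ φ, by rw [hom₀_comp, rootCoeff_comp, hφ, hψ, mul_one]⟩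

lemma Below.antisymm {w x : W} : B.Below w x → B.Below x w → w = x := by
  rintro ⟨φ, hφ⟩ ⟨ψ, hψ⟩
  by_contra hne
  have h := hsocle_comp (w := w) φ
  rw [hφ, one_smul, hsocle_eq_zero hne ψ (by rw [hψ]; exact one_ne_zero), zero_comp] at h
  exact hsocle_self_ne_zero w h.symm

lemma below_of_precedes {w x : W} (h : Precedes R w x) : B.Below x w :=
  ⟨homMk _ _ (B.comparison_comm h), by rw [hom₀_homMk, rootCoeff_comparison]⟩

lemma below_total (w x : W) : B.Below w x ∨ B.Below x w :=
  (precedes_total w x).symm.imp below_of_precedes below_of_precedes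

variable (B) in
open scoped Classical in
/-- The linear order of the vertices by the morphisms between their complexes. -/
noncomputable abbrev belowOrder : LinearOrder W where
  le := B.Below
  le_refl := Below.refl
  le_trans _ _ _ := Below.trans
  le_antisymm _ _ := Below.antisymm
  le_total := below_total
  toDecidableLE := Classical.decRel _

variable (B) in
open scoped Classical in
/-- A morphism that is the identity at the root. -/
noncomputable def link (w x : W) : B.cx x ⟶ B.cx w :=
  if h : x = w then eqToHom (by rw [h]) else if h : B.Below w x then h.choose else 0

lemma link_self (w : W) : B.link w w = 𝟙 _ := by simp [link]

lemma rootCoeff_link {w x : W} (h : B.Below w x) : B.rootCoeff (hom₀ (B.link w x)) = 1 := by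
  by_cases hne : x = w
  · subst hne
    rw [link_self, hom₀_id, rootCoeff_id]
  · rw [link, dif_neg hne, dif_pos h]
    exact h.choose_spec

lemma link_comp_link {w x y : W} (h : B.Below w x) (h' : B.Below x y) :
    (HomotopyCategory.quotient C (ComplexShape.up ℤ)).map (B.link x y) ≫
      (HomotopyCategory.quotient C (ComplexShape.up ℤ)).map (B.link w x) =
      (HomotopyCategory.quotient C (ComplexShape.up ℤ)).map (B.link w y) := by
  rw [← Functor.map_comp]
  by_cases hne : y = w
  · subst hne
    obtain rfl := Below.antisymm h h'
    rw [link_self, Category.comp_id]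
  · refine quotient_map_eq hne _ _ ?_ (rootCoeff_link (h.trans h'))
    rw [hom₀_comp, rootCoeff_comp, rootCoeff_link h, rootCoeff_link h', mul_one]

variable (B) in
/-- The endomorphism algebra of the direct sum of the two-term complexes has a star system. -/
theorem nonempty_starSystem [HasBiproduct B.cx] :
    Nonempty (StarSystem K (Fintype.card W)
      (End ((HomotopyCategory.quotient C (ComplexShape.up ℤ)).obj (⨁ B.cx)))) := by
  classical
  let q := HomotopyCategory.quotient C (ComplexShape.up ℤ)
  let _ : LinearOrder W := B.belowOrder
  let e : Fin (Fintype.card W) ≃o W := Fintype.orderIsoFinOfCardEq W rfl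
  have hle : ∀ {i j}, i ≤ j → B.Below (e i) (e j) := fun h => e.le_iff_le.2 h
  have hne : ∀ {i j}, i < j → e j ≠ e i := fun h h' => h.ne' (e.injective h')
  refine ⟨StarSystem.ofChain (fun i => B.hcx (e i)) (fun i j => q.map (B.link (e i) (e j)))
    (fun i j => B.hsocle (e j) (e i)) (fun i => ?_) (fun h h' => link_comp_link (hle h) (hle h'))
    (fun h => ?_) (fun h => ?_) (hsocle_comp_hsocle _ _ _) (fun h => ?_)
    (fun i => hsocle_self_ne_zero _) (fun h f => ?_) (fun {i j} h f => ?_)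
    (fun i => q.map (biproduct.ι B.cx (e i))) (fun i => q.map (biproduct.π B.cx (e i)))
    (fun i => ?_) (fun h => ?_) ?_⟩
  · rw [link_self, q.map_id]
  · rw [hsocle_comp, rootCoeff_link (hle h), one_smul]
  · rw [comp_hsocle, rootCoeff_link (hle h), one_smul]
  · exact hsocle_eq_zero (hne h) (B.link _ _) (by rw [rootCoeff_link (hle h.le)]; exact one_ne_zero)
  · obtain ⟨φ, rfl⟩ := q.map_surjective f
    exact exists_eq_smul_add_smul φ _ (rootCoeff_link (hle h))
  · obtain ⟨φ, rfl⟩ := q.map_surjective f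
    refine exists_eq_smul_hsocle φ ?_
    by_contra hφ
    refine h.not_ge (e.le_iff_le.1 ⟨(B.rootCoeff (hom₀ φ))⁻¹ • φ, ?_⟩)
    rw [hom₀_smul, rootCoeff_smul, inv_mul_cancel₀ hφ]
  · rw [← q.map_comp, biproduct.ι_π_self, q.map_id]
  · rw [← q.map_comp, biproduct.ι_π_ne _ (e.injective.ne h), q.map_zero]
  · simp_rw [← q.map_comp]
    have h := Fintype.sum_equiv e.toEquiv
      (fun i => biproduct.π B.cx (e i) ≫ biproduct.ι B.cx (e i))
      (fun w => biproduct.π B.cx w ≫ biproduct.ι B.cx w) fun _ => rfl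
    rw [← q.map_sum, h, biproduct.total, q.map_id]

end BrauerSystem

/-! ### Thick subcategories of the derived category -/

section Thick

variable {C : Type u} [Category.{v} C] [Abelian C] [HasDerivedCategory.{w} C]

namespace CategoryTheory.ObjectProperty

variable (E : ObjectProperty (DerivedCategory C)) [E.IsTriangulated] [E.IsStableUnderRetracts]

/-- The complexes in a thick subcategory satisfy the two-out-of-three property. -/
lemma prop_Q_X₃_of_shortExact {S : ShortComplex (CochainComplex C ℤ)} (hS : S.ShortExact)
    (h₁ : E (DerivedCategory.Q.obj S.X₁)) (h₂ : E (DerivedCategory.Q.obj S.X₂)) :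
    E (DerivedCategory.Q.obj S.X₃) :=
  E.ext_of_isTriangulatedClosed₃ _ (DerivedCategory.triangleOfSES_distinguished hS) h₁ h₂

lemma prop_Q_X₁_of_shortExact {S : ShortComplex (CochainComplex C ℤ)} (hS : S.ShortExact)
    (h₂ : E (DerivedCategory.Q.obj S.X₂)) (h₃ : E (DerivedCategory.Q.obj S.X₃)) :
    E (DerivedCategory.Q.obj S.X₁) :=
  E.ext_of_isTriangulatedClosed₁ _ (DerivedCategory.triangleOfSES_distinguished hS) h₂ h₃

lemma prop_Q_X₂_of_shortExact {S : ShortComplex (CochainComplex C ℤ)} (hS : S.ShortExact)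
    (h₁ : E (DerivedCategory.Q.obj S.X₁)) (h₃ : E (DerivedCategory.Q.obj S.X₃)) :
    E (DerivedCategory.Q.obj S.X₂) :=
  E.ext_of_isTriangulatedClosed₂ _ (DerivedCategory.triangleOfSES_distinguished hS) h₁ h₃

lemma prop_singleFunctor (M : C) (m n : ℤ) (h : E ((DerivedCategory.singleFunctor C m).obj M)) :
    E ((DerivedCategory.singleFunctor C n).obj M) :=
  E.prop_of_iso (((DerivedCategory.singleFunctors C).shiftIso (m - n) n m (by omega)).app M)
    (E.le_shift (m - n) _ h)

/-- A complex that is concentrated in one degree. -/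
lemma prop_singleFunctor_of_isZero {D : CochainComplex C ℤ} (m n : ℤ)
    (hD : ∀ i, i ≠ m → IsZero (D.X i)) (h : E (DerivedCategory.Q.obj D)) {M : C}
    (e : D.X m ≅ M) : E ((DerivedCategory.singleFunctor C n).obj M) := by
  have h₁ : D.IsStrictlyGE m := (CochainComplex.isStrictlyGE_iff D m).2 fun i hi => hD i hi.ne
  have h₂ : D.IsStrictlyLE m := (CochainComplex.isStrictlyLE_iff D m).2 fun i hi => hD i hi.ne'
  obtain ⟨N, ⟨f⟩⟩ := CochainComplex.exists_iso_single D m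
  have g : N ≅ M := (HomologicalComplex.singleObjXSelf (ComplexShape.up ℤ) m N).symm ≪≫
    ((HomologicalComplex.eval C _ m).mapIso f).symm ≪≫ e
  refine E.prop_singleFunctor M m n (E.prop_of_iso
    ((DerivedCategory.singleFunctor C m).mapIso g) ?_)
  exact E.prop_of_iso (DerivedCategory.Q.mapIso f) h

lemma prop_singleFunctor_biproduct [HasFiniteBiproducts C] {J : Type} [Finite J] (f : J → C) (n : ℤ)
    (h : ∀ j, E ((DerivedCategory.singleFunctor C n).obj (f j))) :
    E ((DerivedCategory.singleFunctor C n).obj (⨁ f)) := by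
  have : E.IsClosedUnderFiniteProducts := .mk'
  have e := (DerivedCategory.singleFunctor C n).mapBiproduct f ≪≫ biproduct.isoProduct _
  exact E.prop_of_iso e.symm (E.prop_product h)

/-- A bounded complex is generated by its components. -/
lemma prop_of_bounded {D : CochainComplex C ℤ}
    (h : ∀ i, E ((DerivedCategory.singleFunctor C i).obj (D.X i))) {b c : ℤ}
    (hbc : ∀ i, i < b ∨ c < i → IsZero (D.X i)) : E (DerivedCategory.Q.obj D) := by
  obtain ⟨k, hk⟩ : ∃ k : ℕ, c < b + k := ⟨(c - b + 1).toNat, by omega⟩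
  induction k generalizing D c with
  | zero =>
    have hD : IsZero D := by
      rw [IsZero.iff_id_eq_zero]
      ext i
      exact (hbc i (by omega)).eq_of_src _ _
    exact E.prop_of_isZero (DerivedCategory.Q.map_isZero hD)
  | succ k ih =>
    let f : (HomologicalComplex.single C (ComplexShape.up ℤ) c).obj (D.X c) ⟶ D :=
      HomologicalComplex.mkHomFromSingle (𝟙 (D.X c)) fun i hi =>
        (hbc i (by simp at hi; omega)).eq_of_tgt _ _
    have hf : IsIso (f.f c) := by
      rw [HomologicalComplex.mkHomFromSingle_f]
      infer_instance
    have hz : ∀ i, i ≠ c →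
        IsZero (((HomologicalComplex.single C (ComplexShape.up ℤ) c).obj (D.X c)).X i) :=
      fun i hi => HomologicalComplex.isZero_single_obj_X _ _ _ _ hi
    have hmono : Mono f := by
      have : ∀ i, Mono (f.f i) := fun i => by
        by_cases hi : i = c
        · subst hi; infer_instance
        · exact ⟨fun _ _ _ => (hz i hi).eq_of_tgt _ _⟩
      exact HomologicalComplex.mono_of_mono_f f this
    let S := ShortComplex.mk f (cokernel.π f) (cokernel.condition f)
    have hS : S.ShortExact := { exact := ShortComplex.exact_cokernel f }
    have hSi : ∀ i, (S.map (HomologicalComplex.eval C _ i)).ShortExact := fun i =>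
      hS.map_of_exact (HomologicalComplex.eval C _ i)
    have hc : IsZero ((cokernel f).X c) := (hSi c).isIso_f_iff.1 hf
    have hne : ∀ i, i ≠ c → Nonempty (D.X i ≅ (cokernel f).X i) := fun i hi => by
      have : IsIso ((cokernel.π f).f i) := (hSi i).isIso_g_iff.2 (hz i hi)
      exact ⟨asIso ((cokernel.π f).f i)⟩
    refine E.prop_Q_X₂_of_shortExact hS (h c) (ih (c := c - 1) (fun i => ?_) (fun i hi => ?_)
      (by push_cast at hk; omega))
    · by_cases hi : i = c
      · subst hi
        exact E.prop_of_isZero ((DerivedCategory.singleFunctor C i).map_isZero hc)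
      · exact E.prop_of_iso ((DerivedCategory.singleFunctor C i).mapIso (hne i hi).some) (h i)
    · by_cases hi' : i = c
      · exact hi' ▸ hc
      · exact (hbc i (by omega)).of_iso (hne i hi').some.symm

end CategoryTheory.ObjectProperty

namespace TwoTermComplex

variable {X Y X' Y' X'' Y'' : C} {d : X ⟶ Y} {d' : X' ⟶ Y'} {d'' : X'' ⟶ Y''}

lemma shortExact {f : of d ⟶ of d'} {g : of d' ⟶ of d''} (h₀ : hom₀ f ≫ hom₀ g = 0)
    (h₁ : hom₁ f ≫ hom₁ g = 0) (H₀ : (ShortComplex.mk _ _ h₀).ShortExact)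
    (H₁ : (ShortComplex.mk _ _ h₁).ShortExact) :
    (ShortComplex.mk f g (hom_ext (by rw [hom₀_comp, h₀]; simp [hom₀])
      (by rw [hom₁_comp, h₁]; simp [hom₁]))).ShortExact := by
  refine HomologicalComplex.shortExact_of_degreewise_shortExact _ fun i => ?_
  by_cases hi : i = 0
  · subst hi
    exact ShortComplex.shortExact_of_iso (ShortComplex.isoMk (iso₀ d).symm (iso₀ d').symm
      (iso₀ d'').symm (by simp [f_zero]; exact Iso.inv_hom_id_assoc _ _)
      (by simp [f_zero]; exact Iso.inv_hom_id_assoc _ _)) H₀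
  · by_cases hi' : i = 1
    · subst hi'
      exact ShortComplex.shortExact_of_iso (ShortComplex.isoMk (iso₁ d).symm (iso₁ d').symm
        (iso₁ d'').symm (by simp [f_one]; exact Iso.inv_hom_id_assoc _ _)
      (by simp [f_one]; exact Iso.inv_hom_id_assoc _ _)) H₁
    · exact
        { exact := ShortComplex.exact_of_isZero_X₂ _ (isZero_X d' hi hi')
          mono_f := ⟨fun _ _ _ => (isZero_X d hi hi').eq_of_tgt _ _⟩
          epi_g := ⟨fun _ _ _ => (isZero_X d'' hi hi').eq_of_src _ _⟩ }

end TwoTermComplex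

end Thick

universe t

/-! ### The tilting complex of a Brauer system -/

namespace BrauerSystem

open TwoTermComplex

section Generation

variable {K : Type u} [Field K] {W : Type} {R : PlaneTree W} {C : Type w}
    [Category.{v} C] [Preadditive C] [Linear K C] (B : BrauerSystem K R C)
    [Fintype W] [HasFiniteBiproducts C]

lemma mat_idm_comp {j k : ℕ} {p w y : W} (h : R.path j p ⊆ R.path j w)
    (M : ∀ a b, B.P a ⟶ B.P b) : B.mat j j p w B.idm ≫ B.mat j k w y M = B.mat j k p y M := by
  rw [mat_comp, mat_ext_iff]
  intro a ha b _
  rw [Finset.sum_eq_single a, idm_self, Category.id_comp]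
  · intro q _ hq
    rw [B.idm_ne hq.symm, zero_comp]
  · exact fun h' => absurd (h ha) h'

lemma comp_mat_idm {j k : ℕ} {p w y : W} (h : R.path k p ⊆ R.path k w)
    (M : ∀ a b, B.P a ⟶ B.P b) : B.mat j k y w M ≫ B.mat k k w p B.idm = B.mat j k y p M := by
  rw [mat_comp, mat_ext_iff]
  intro a _ b hb
  rw [Finset.sum_eq_single b, idm_self, Category.comp_id]
  · intro q _ hq
    rw [B.idm_ne hq, comp_zero]
  · exact fun h' => absurd (h hb) h'

lemma anc_of_par_of_ne {a w p : W} (h : R.Anc a w) (hp : R.Par w p) (hne : a ≠ w) :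
    R.Anc a p := by
  refine h.of_depth_le hp.anc ?_
  have := hp.depth
  by_contra h'
  exact hne (h.eq_of_depth_le (by omega))

lemma path_eq_of_par {w p : W} (h : R.Par w p) {j : ℕ} (hj : R.depth w % 2 ≠ j) :
    R.path j w = R.path j p := by
  ext a
  rw [PlaneTree.mem_path, PlaneTree.mem_path]
  refine ⟨fun ⟨h₁, h₂⟩ => ⟨?_, h₂⟩, fun ⟨h₁, h₂⟩ => ⟨h₁.trans h.anc, h₂⟩⟩
  exact (anc_of_par_of_ne h₁ h (by rintro rfl; exact hj h₂))

lemma path_subset_of_par {w p : W} (h : R.Par w p) (j : ℕ) : R.path j p ⊆ R.path j w := by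
  intro a
  rw [PlaneTree.mem_path, PlaneTree.mem_path]
  exact fun ⟨h₁, h₂⟩ => ⟨h₁.trans h.anc, h₂⟩

lemma mem_path_self {w : W} {j : ℕ} (hj : R.depth w % 2 = j) : w ∈ R.path j w :=
  PlaneTree.mem_path.2 ⟨PlaneTree.Anc.refl w, hj⟩

/-- The inclusion of the last summand. -/
noncomputable abbrev lastι {w : W} {j : ℕ} (hj : R.depth w % 2 = j) : B.P w ⟶ B.X j w :=
  biproduct.ι (fun a : {a // a ∈ R.path j w} => B.P a) ⟨w, mem_path_self hj⟩

/-- The projection to the last summand. -/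
noncomputable abbrev lastπ {w : W} {j : ℕ} (hj : R.depth w % 2 = j) : B.X j w ⟶ B.P w :=
  biproduct.π (fun a : {a // a ∈ R.path j w} => B.P a) ⟨w, mem_path_self hj⟩

lemma par_notMem_path {w p : W} (h : R.Par w p) (j : ℕ) : w ∉ R.path j p := fun h' => by
  have := (PlaneTree.mem_path.1 h').1.depth_le
  have := h.depth
  omega

lemma lastι_comp {w p : W} {j : ℕ} (hj : R.depth w % 2 = j) (h : R.Par w p) :
    B.lastι hj ≫ B.mat j j w p B.idm = 0 := by
  apply biproduct.hom_ext
  intro b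
  rw [Category.assoc, mat, biproduct.matrix_π, biproduct.ι_desc, zero_comp]
  exact B.idm_ne fun e => par_notMem_path h _ (e ▸ b.2)

lemma comp_lastπ {w p : W} {j : ℕ} (hj : R.depth w % 2 = j) (h : R.Par w p) :
    B.mat j j p w B.idm ≫ B.lastπ hj = 0 := by
  apply biproduct.hom_ext'
  intro b
  rw [mat, biproduct.matrix_π, biproduct.ι_desc, comp_zero]
  exact B.idm_ne fun e => par_notMem_path h _ (e ▸ b.2)

lemma total_last {w p : W} {j : ℕ} (hj : R.depth w % 2 = j) (h : R.Par w p) :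
    B.mat j j w p B.idm ≫ B.mat j j p w B.idm + B.lastπ hj ≫ B.lastι hj = 𝟙 _ := by
  have hp := path_subset_of_par h j
  rw [mat_comp]
  apply biproduct.hom_ext
  intro b
  apply biproduct.hom_ext'
  intro a
  rw [Preadditive.add_comp, Preadditive.comp_add, mat, biproduct.matrix_π, biproduct.ι_desc]
  by_cases hb : (b : W) = w
  · obtain rfl : b = ⟨w, mem_path_self hj⟩ := Subtype.ext hb
    rw [Category.assoc, biproduct.ι_π_self, Finset.sum_eq_zero, zero_add]
    · simp
    · intro q hq
      rw [B.idm_ne (a := q) (b := w), comp_zero]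
      rintro rfl
      exact par_notMem_path h _ hq
  · have hb' : (⟨w, mem_path_self hj⟩ : {a // a ∈ R.path j w}) ≠ b :=
      fun e => hb (e ▸ rfl)
    rw [Category.assoc, biproduct.ι_π_ne _ hb', comp_zero, comp_zero, add_zero,
      Finset.sum_eq_single b.1, idm_self, Category.comp_id, Category.id_comp]
    · by_cases hab : a = b
      · subst hab
        simp
      · rw [biproduct.ι_π_ne _ hab, B.idm_ne fun e => hab (Subtype.ext e)]
    · intro q _ hq
      rw [B.idm_ne hq, comp_zero]
    · intro hbp
      refine absurd (PlaneTree.mem_path.2 ⟨?_, (PlaneTree.mem_path.1 b.2).2⟩) hbp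
      exact anc_of_par_of_ne (PlaneTree.mem_path.1 b.2).1 h hb

lemma lastι_π {w : W} {j : ℕ} (hj : R.depth w % 2 = j) : B.lastι hj ≫ B.lastπ hj = 𝟙 _ :=
  biproduct.ι_π_self _ _

lemma mat_idm_par {w p : W} (h : R.Par w p) (j : ℕ) :
    B.mat j j p w B.idm ≫ B.mat j j w p B.idm = 𝟙 _ := by
  rw [B.mat_idm_comp (path_subset_of_par h j), mat_idm]

lemma mat_idm_par' {w p : W} (h : R.Par w p) {j : ℕ} (hj : R.depth w % 2 ≠ j) :
    B.mat j j w p B.idm ≫ B.mat j j p w B.idm = 𝟙 _ := by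
  rw [B.mat_idm_comp (path_eq_of_par h hj).subset, mat_idm]

end Generation

section Thick

open scoped ZeroObject

variable {K : Type u} [Field K] {W : Type} {R : PlaneTree W} {C : Type w}
    [Category.{v} C] [Abelian C] [Linear K C] (B : BrauerSystem K R C)
    [Fintype W] [HasFiniteBiproducts C] [HasDerivedCategory.{t} C]

variable (E : ObjectProperty (DerivedCategory C)) [E.IsTriangulated] [E.IsStableUnderRetracts]

lemma prop_singleFunctor_root (n : ℤ) (h : E (DerivedCategory.Q.obj (B.cx R.root))) :
    E ((DerivedCategory.singleFunctor C n).obj (B.P R.root)) := by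
  have hroot : ∀ {a j}, a ∈ R.path j R.root → a = R.root ∧ j = 0 := fun ha => by
    obtain ⟨h₁, h₂⟩ := PlaneTree.mem_path.1 ha
    have h₃ := h₁.depth_le
    have h₄ := R.depth_root
    exact ⟨h₁.eq_of_depth_le (by omega), by omega⟩
  have hj : R.depth R.root % 2 = 0 := by rw [R.depth_root]
  refine E.prop_singleFunctor_of_isZero 0 n (fun i hi => ?_) h
    (iso₀ _ ≪≫ { hom := B.lastπ hj, inv := B.lastι hj, hom_inv_id := ?_, inv_hom_id := ?_ })
  · by_cases hi' : i = 1
    · subst hi'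
      refine IsZero.of_iso ?_ (iso₁ _)
      rw [IsZero.iff_id_eq_zero]
      apply biproduct.hom_ext
      intro b
      exact absurd (hroot b.2).2 one_ne_zero
    · exact isZero_X _ hi hi'
  · apply biproduct.hom_ext
    intro b
    obtain rfl : b = ⟨R.root, mem_path_self hj⟩ := Subtype.ext (hroot b.2).1
    rw [Category.assoc, biproduct.ι_π_self, Category.comp_id, Category.id_comp]
  · exact B.lastι_π hj

/-- The complex of a vertex of even depth is an extension of a projective by the complex of the
parent vertex. -/
lemma prop_singleFunctor_even (n : ℤ) {w p : W} (hp : R.Par w p) (hw : R.depth w % 2 = 0)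
    (h : E (DerivedCategory.Q.obj (B.cx w))) (h' : E (DerivedCategory.Q.obj (B.cx p))) :
    E ((DerivedCategory.singleFunctor C n).obj (B.P w)) := by
  have hw' : R.depth w % 2 ≠ 1 := by omega
  let f : B.cx p ⟶ B.cx w := homMk (B.mat 0 0 p w B.idm) (B.mat 1 1 p w B.idm) (by
    rw [diff, diff, B.mat_idm_comp (path_subset_of_par hp 0),
      B.comp_mat_idm (path_eq_of_par hp hw').subset])
  let g : B.cx w ⟶ of (0 : B.P w ⟶ 0) := homMk (B.lastπ hw) 0 (by simp)
  have H₀ : (ShortComplex.mk (B.mat 0 0 p w B.idm) (B.lastπ hw) (B.comp_lastπ hw hp)).ShortExact :=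
    ShortComplex.Splitting.shortExact
      { r := B.mat 0 0 w p B.idm
        s := B.lastι hw
        f_r := B.mat_idm_par hp 0
        s_g := B.lastι_π hw
        id := B.total_last hw hp }
  have H₁ : (ShortComplex.mk (B.mat 1 1 p w B.idm) (0 : B.X 1 w ⟶ 0) comp_zero).ShortExact :=
    ShortComplex.Splitting.shortExact
      { r := B.mat 1 1 w p B.idm
        s := 0
        f_r := B.mat_idm_par hp 1
        s_g := (isZero_zero C).eq_of_src _ _
        id := by simpa using B.mat_idm_par' hp hw' }
  have hS := shortExact (f := f) (g := g) (by simp [f, g, B.comp_lastπ hw hp])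
    (by simp [f, g]) (by simpa [f, g] using H₀) (by simpa [f, g] using H₁)
  refine E.prop_singleFunctor_of_isZero 0 n (fun i hi => ?_) (E.prop_Q_X₃_of_shortExact hS h' h)
    (iso₀ _)
  by_cases hi' : i = 1
  · subst hi'
    exact IsZero.of_iso (isZero_zero C) (iso₁ _)
  · exact isZero_X _ hi hi'

/-- The complex of a vertex of odd depth is an extension of the complex of the parent vertex by a
projective. -/
lemma prop_singleFunctor_odd (n : ℤ) {w p : W} (hp : R.Par w p) (hw : R.depth w % 2 = 1)
    (h : E (DerivedCategory.Q.obj (B.cx w))) (h' : E (DerivedCategory.Q.obj (B.cx p))) :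
    E ((DerivedCategory.singleFunctor C n).obj (B.P w)) := by
  have hw' : R.depth w % 2 ≠ 0 := by omega
  let g : B.cx w ⟶ B.cx p := homMk (B.mat 0 0 w p B.idm) (B.mat 1 1 w p B.idm) (by
    rw [diff, diff, B.mat_idm_comp (path_eq_of_par hp hw').subset,
      B.comp_mat_idm (path_subset_of_par hp 1)])
  let f : of (0 : 0 ⟶ B.P w) ⟶ B.cx w := homMk 0 (B.lastι hw) (by simp)
  have H₀ : (ShortComplex.mk (0 : 0 ⟶ B.X 0 w) (B.mat 0 0 w p B.idm) zero_comp).ShortExact :=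
    ShortComplex.Splitting.shortExact
      { r := 0
        s := B.mat 0 0 p w B.idm
        f_r := (isZero_zero C).eq_of_src _ _
        s_g := B.mat_idm_par hp 0
        id := by simpa using B.mat_idm_par' hp hw' }
  have H₁ : (ShortComplex.mk (B.lastι hw) (B.mat 1 1 w p B.idm) (B.lastι_comp hw hp)).ShortExact :=
    ShortComplex.Splitting.shortExact
      { r := B.lastπ hw
        s := B.mat 1 1 p w B.idm
        f_r := B.lastι_π hw
        s_g := B.mat_idm_par hp 1
        id := by rw [add_comm]; exact B.total_last hw hp }
  have hS := shortExact (f := f) (g := g) (by simp [f, g])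
    (by simp [f, g, B.lastι_comp hw hp]) (by simpa [f, g] using H₀) (by simpa [f, g] using H₁)
  refine E.prop_singleFunctor_of_isZero 1 n (fun i hi => ?_) (E.prop_Q_X₁_of_shortExact hS h h')
    (iso₁ _)
  by_cases hi' : i = 0
  · subst hi'
    exact IsZero.of_iso (isZero_zero C) (iso₀ _)
  · exact isZero_X _ hi' hi

/-- The two-term complexes generate the objects `P w`. -/
theorem prop_singleFunctor_P (h : ∀ w, E (DerivedCategory.Q.obj (B.cx w))) (n : ℤ) (w : W) :
    E ((DerivedCategory.singleFunctor C n).obj (B.P w)) := by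
  by_cases hw : w = R.root
  · subst hw
    exact B.prop_singleFunctor_root E n (h _)
  · rcases Nat.mod_two_eq_zero_or_one (R.depth w) with hj | hj
    · exact B.prop_singleFunctor_even E n (PlaneTree.par_parent hw) hj (h _) (h _)
    · exact B.prop_singleFunctor_odd E n (PlaneTree.par_parent hw) hj (h _) (h _)

end Thick

end BrauerSystem

namespace BrauerSystem

open TwoTermComplex

section Vanishing

variable {K : Type u} [Field K] {W : Type} {R : PlaneTree W} {C : Type w}
    [Category.{v} C] [Abelian C] [Linear K C] (B : BrauerSystem K R C)
    [Fintype W] [HasFiniteBiproducts C] [HasBiproduct B.cx]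

/-- The direct sum of the two-term complexes. -/
noncomputable abbrev tilt : CochainComplex C ℤ := ⨁ B.cx

lemma isZero_tilt_X {i : ℤ} (h₀ : i ≠ 0) (h₁ : i ≠ 1) : IsZero (B.tilt.X i) := by
  rw [IsZero.iff_id_eq_zero]
  have h := congrArg (HomologicalComplex.eval C _ i).map (biproduct.total (f := B.cx))
  rw [Functor.map_sum, CategoryTheory.Functor.map_id] at h
  refine h.symm.trans ?_
  refine Finset.sum_eq_zero fun w _ => ?_
  have hz : (HomologicalComplex.eval C (ComplexShape.up ℤ) i).map (biproduct.π B.cx w) = 0 :=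
    (isZero_X (B.diff w) h₀ h₁).eq_of_tgt _ _
  rw [Functor.map_comp, hz, zero_comp]

lemma quotient_map_shift_eq_zero {i : ℤ} (hi : i ≠ 0) (φ : B.tilt ⟶ B.tilt⟦i⟧) :
    (HomotopyCategory.quotient C (ComplexShape.up ℤ)).map φ = 0 := by
  have h : φ = ∑ w, ∑ x, (biproduct.π B.cx w ≫
      (biproduct.ι B.cx w ≫ φ ≫ (biproduct.π B.cx x)⟦i⟧') ≫ (biproduct.ι B.cx x)⟦i⟧') := by
    have h₁ : φ = (∑ w, biproduct.π B.cx w ≫ biproduct.ι B.cx w) ≫ φ ≫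
        (∑ x, biproduct.π B.cx x ≫ biproduct.ι B.cx x)⟦i⟧' := by
      rw [biproduct.total, CategoryTheory.Functor.map_id]
      exact ((Category.id_comp _).trans (Category.comp_id _)).symm
    refine h₁.trans ?_
    rw [Preadditive.sum_comp]
    refine Finset.sum_congr rfl fun w _ => ?_
    rw [Functor.map_sum, Preadditive.comp_sum, Preadditive.comp_sum]
    refine Finset.sum_congr rfl fun x _ => ?_
    rw [Functor.map_comp]
    simp only [Category.assoc]
  rw [h, Functor.map_sum]
  refine Finset.sum_eq_zero fun w _ => ?_
  rw [Functor.map_sum]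
  refine Finset.sum_eq_zero fun x _ => ?_
  rw [Functor.map_comp, Functor.map_comp, shiftedHom_eq_zero (B.exists_homotopy_one w x)
    (fun g h₁ h₂ => B.eq_zero_of_comp_diff_eq_zero g h₁ h₂) hi, zero_comp, comp_zero]

theorem derived_hom_eq_zero [HasDerivedCategory.{t} C] (hP : ∀ i, Projective (B.tilt.X i)) {i : ℤ}
    (hi : i ≠ 0) (f : DerivedCategory.Q.obj B.tilt ⟶ (DerivedCategory.Q.obj B.tilt)⟦i⟧) :
    f = 0 := by
  have : B.tilt.IsStrictlyLE 1 := (CochainComplex.isStrictlyLE_iff _ 1).2 fun i hi =>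
    B.isZero_tilt_X (by omega) (by omega)
  have := CochainComplex.isKProjective_of_projective B.tilt 1
  obtain ⟨g, hg⟩ := (CochainComplex.IsKProjective.Qh_map_bijective B.tilt
    ((HomotopyCategory.quotient C (ComplexShape.up ℤ)).obj (B.tilt⟦i⟧))).surjective
    ((DerivedCategory.quotientCompQhIso C).hom.app B.tilt ≫ f ≫
      (DerivedCategory.Q.commShiftIso i).inv.app B.tilt ≫
      (DerivedCategory.quotientCompQhIso C).inv.app (B.tilt⟦i⟧))
  obtain ⟨φ, rfl⟩ := (HomotopyCategory.quotient C (ComplexShape.up ℤ)).map_surjective g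
  rw [B.quotient_map_shift_eq_zero hi, Functor.map_zero] at hg
  rw [← cancel_epi ((DerivedCategory.quotientCompQhIso C).hom.app B.tilt),
    ← cancel_mono ((DerivedCategory.Q.commShiftIso i).inv.app B.tilt),
    ← cancel_mono ((DerivedCategory.quotientCompQhIso C).inv.app (B.tilt⟦i⟧))]
  simpa using hg.symm

end Vanishing

section Modules

open TwoTermTilting

/-- Finitely generated projective modules. -/
def _root_.ModuleCat.FGProjective {A : Type w} [Ring A] (M : ModuleCat.{w} A) : Prop :=
  Module.Finite A M ∧ Module.Projective A M

lemma _root_.ModuleCat.FGProjective.of_iso {A : Type w} [Ring A] {M N : ModuleCat.{w} A}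
    (h : M.FGProjective) (e : M ≅ N) : N.FGProjective := by
  have := h.1
  have := h.2
  exact ⟨Module.Finite.equiv e.toLinearEquiv, Module.Projective.of_equiv e.toLinearEquiv⟩

lemma _root_.ModuleCat.FGProjective.of_isZero {A : Type w} [Ring A] {M : ModuleCat.{w} A}
    (h : IsZero M) : M.FGProjective := by
  have := ModuleCat.subsingleton_of_isZero h
  exact ⟨inferInstance, Module.Projective.of_free⟩

lemma _root_.ModuleCat.FGProjective.biproduct {A : Type w} [Ring A] {J : Type} [Fintype J]
    {M : J → ModuleCat.{w} A} (h : ∀ j, (M j).FGProjective) : (⨁ M).FGProjective := by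
  have h₁ : ∀ j, Module.Finite A (M j) := fun j => (h j).1
  have h₂ : ∀ j, Projective (M j) := fun j =>
    (IsProjective.iff_projective (R := A) (M j)).1 (h j).2
  refine ⟨Module.Finite.equiv (ModuleCat.biproductIsoPi M).toLinearEquiv.symm, ?_⟩
  have : Projective (⨁ M) :=
    ⟨fun f e _ => ⟨biproduct.desc fun j => Projective.factorThru (biproduct.ι M j ≫ f) e, by
      apply biproduct.hom_ext'; intro j; simp⟩⟩
  exact (IsProjective.iff_projective (R := A) _).2 this

variable {K : Type u} [Field K] {W : Type} {R : PlaneTree W} {A : Type w} [Ring A] [Algebra K A]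
    (B : BrauerSystem K R (ModuleCat.{w} A)) [Fintype W]  [HasBiproduct B.cx]

lemma fgProjective_tilt (h : ∀ w, (B.P w).FGProjective) (i : ℤ) : (B.tilt.X i).FGProjective := by
  have e := (HomologicalComplex.eval (ModuleCat.{w} A) (ComplexShape.up ℤ) i).mapBiproduct B.cx
  refine ModuleCat.FGProjective.of_iso (ModuleCat.FGProjective.biproduct fun w => ?_) e.symm
  by_cases hi : i = 0
  · subst hi
    exact (ModuleCat.FGProjective.biproduct fun a : {a // a ∈ R.path 0 w} => h a).of_iso
        (iso₀ (B.diff w)).symm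
  · by_cases hi' : i = 1
    · subst hi'
      exact (ModuleCat.FGProjective.biproduct fun a : {a // a ∈ R.path 1 w} => h a).of_iso
        (iso₁ (B.diff w)).symm
    · exact .of_isZero (isZero_X (B.diff w) hi hi')

lemma isTwoTerm_tilt : IsTwoTerm B.tilt := fun _ h₀ h₁ => B.isZero_tilt_X h₀ h₁

lemma isPerfectComplex_tilt (h : ∀ w, (B.P w).FGProjective) : IsPerfectComplex B.tilt :=
  ⟨B.fgProjective_tilt h, 0, 1, fun _ hi => B.isZero_tilt_X (by omega) (by omega)⟩

/-- A thick subcategory that contains the regular module contains all perfect complexes. -/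
lemma _root_.TwoTermTilting.perf_le [HasDerivedCategory.{t} (ModuleCat.{w} A)]
    (E : ObjectProperty (DerivedCategory (ModuleCat.{w} A))) [E.IsTriangulated]
    [E.IsStableUnderRetracts]
    (h : ∀ n, E ((DerivedCategory.singleFunctor _ n).obj (ModuleCat.of A A))) : perf A ≤ E := by
  rintro X ⟨D, ⟨hD, b, c, hbc⟩, ⟨e⟩⟩
  refine E.prop_of_iso e.symm (E.prop_of_bounded (fun i => ?_) hbc)
  have := (hD i).1
  have := (hD i).2
  obtain ⟨n, p, s, -, -, hps⟩ := Module.Finite.exists_comp_eq_id_of_projective A (D.X i)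
  have r : Retract (D.X i) (ModuleCat.of A (Fin n → A)) :=
    { i := ModuleCat.ofHom s
      r := ModuleCat.ofHom p
      retract := by rw [← ModuleCat.ofHom_comp, hps]; rfl }
  refine E.prop_of_retract (r.map (DerivedCategory.singleFunctor _ i)) ?_
  refine E.prop_of_iso ((DerivedCategory.singleFunctor _ i).mapIso
    (ModuleCat.biproductIsoPi fun _ : Fin n => ModuleCat.of A A)) ?_
  exact E.prop_singleFunctor_biproduct _ i fun _ => h i

/-- The direct sum of the two-term complexes is a tilting complex. -/
theorem isTilting_tilt [HasDerivedCategory.{t} (ModuleCat.{w} A)]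
    (h : ∀ w, (B.P w).FGProjective) (hA : Nonempty (Retract (ModuleCat.of A A) (⨁ B.P))) :
    IsTilting B.tilt := by
  refine ⟨B.isPerfectComplex_tilt h, fun i hi f => B.derived_hom_eq_zero (fun j => ?_) hi f, ?_⟩
  · exact (IsProjective.iff_projective (R := A) _).1 (B.fgProjective_tilt h j).2
  · have hT := (ObjectProperty.singleton (DerivedCategory.Q.obj B.tilt)).le_triangEnvelope _
      ((ObjectProperty.singleton_iff _ _).2 rfl)
    have : (ObjectProperty.singleton (DerivedCategory.Q.obj B.tilt)).Nonempty :=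
      ⟨_, (ObjectProperty.singleton_iff _ _).2 rfl⟩
    refine perf_le _ fun n => ObjectProperty.prop_of_retract _
      (hA.some.map (DerivedCategory.singleFunctor _ n)) ?_
    refine ObjectProperty.prop_singleFunctor_biproduct _ _ _ fun w =>
      B.prop_singleFunctor_P _ (fun w => ?_) n w
    refine ObjectProperty.prop_of_retract _ (Retract.map ?_ DerivedCategory.Q) hT
    exact { i := biproduct.ι B.cx w, r := biproduct.π B.cx w, retract := biproduct.ι_π_self _ _ }

end Modules

end BrauerSystem

/-! ### Projective modules of idempotents -/

namespace IdempotentModule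

variable {K : Type u} [Field K] {A : Type w} [Ring A] [Algebra K A]

variable (A) in
/-- The left ideal generated by an element. -/
def leftIdeal (e : A) : Submodule A A := Submodule.span A {e}

/-- The left module generated by an element. -/
def obj (e : A) : ModuleCat.{w} A := ModuleCat.of A (leftIdeal A e)

lemma mul_mem (y e : A) : y * e ∈ leftIdeal A e := Submodule.mem_span_singleton.2 ⟨y, rfl⟩

lemma self_mem (e : A) : e ∈ leftIdeal A e := Submodule.mem_span_singleton_self e

lemma mul_eq_self {e : A} (he : e * e = e) {y : A} (hy : y ∈ leftIdeal A e) : y * e = y := by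
  obtain ⟨a, rfl⟩ := Submodule.mem_span_singleton.1 hy
  rw [smul_eq_mul, mul_assoc, he]

/-- The multiplication from the right by an element. -/
def rmul (e f x : A) : obj e ⟶ obj f :=
  ModuleCat.ofHom
    { toFun := fun y => (⟨y.1 * x * f, mul_mem _ _⟩ : leftIdeal A f)
      map_add' := fun y z => Subtype.ext (by simp [add_mul])
      map_smul' := fun a y => Subtype.ext (by simp [mul_assoc]) }

lemma rmul_apply (e f x : A) (y : leftIdeal A e) :
    ((rmul e f x).hom y : leftIdeal A f).1 = y.1 * x * f := rfl

lemma hom_ext {e f : A} {φ ψ : obj e ⟶ obj f}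
    (h : ∀ y : leftIdeal A e, (φ.hom y : leftIdeal A f).1 = (ψ.hom y : leftIdeal A f).1) : φ = ψ :=
  ModuleCat.hom_ext (LinearMap.ext fun y => Subtype.ext (h y))

lemma rmul_add (e f x y : A) : rmul e f (x + y) = rmul e f x + rmul e f y :=
  hom_ext fun z => by
    change z.1 * (x + y) * f = z.1 * x * f + z.1 * y * f
    rw [mul_add, add_mul]

lemma rmul_smul (e f : A) (r : K) (x : A) : rmul e f (r • x) = r • rmul e f x :=
  hom_ext fun z => by
    change z.1 * (r • x) * f = algebraMap K A r • (z.1 * x * f)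
    rw [mul_smul_comm, smul_mul_assoc, algebraMap_smul]

lemma rmul_zero (e f : A) : rmul e f 0 = 0 :=
  hom_ext fun z => by
    change z.1 * 0 * f = 0
    rw [mul_zero, zero_mul]

lemma rmul_comp {e f g x y : A} (hx : x * f = x) : rmul e f x ≫ rmul f g y = rmul e g (x * y) :=
  hom_ext fun z => by
    change z.1 * x * f * y * g = z.1 * (x * y) * g
    rw [mul_assoc z.1 x f, hx, mul_assoc z.1 x y]

lemma rmul_self {e : A} (he : e * e = e) : rmul e e e = 𝟙 (obj e) :=
  hom_ext fun z => by
    change z.1 * e * e = z.1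
    rw [mul_eq_self he z.2, mul_eq_self he z.2]

lemma exists_rmul {e f : A} (he : e * e = e) (hf : f * f = f) (φ : obj e ⟶ obj f) :
    ∃ x : A, φ = rmul e f (e * x * f) := by
  let x : leftIdeal A f := φ.hom (⟨e, self_mem e⟩ : leftIdeal A e)
  have key : ∀ z : leftIdeal A e, (φ.hom z : leftIdeal A f).1 = z.1 * x.1 := fun z => by
    have hz : z = z.1 • (⟨e, self_mem e⟩ : leftIdeal A e) := Subtype.ext (by
      simp [mul_eq_self he z.2])
    have h := map_smul φ.hom z.1 (⟨e, self_mem e⟩ : leftIdeal A e)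
    rw [← hz] at h
    exact congrArg (fun y : leftIdeal A f => y.1) h
  refine ⟨x.1, hom_ext fun z => ?_⟩
  rw [key, rmul_apply, ← mul_assoc, ← mul_assoc, mul_eq_self he z.2, mul_assoc, mul_assoc, hf,
    mul_eq_self hf x.2]

lemma eq_zero_of_rmul_eq_zero {e f x : A} (hx : e * x * f = x) (h : rmul e f x = 0) : x = 0 := by
  have h₁ := congrArg (fun φ : obj e ⟶ obj f =>
    (φ.hom (⟨e, self_mem e⟩ : leftIdeal A e) : leftIdeal A f).1) h
  rw [← hx]
  exact h₁

/-- The inclusion in the regular module. -/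
def incl (e : A) : obj e ⟶ ModuleCat.of A A := ModuleCat.ofHom (leftIdeal A e).subtype

/-- The multiplication by the generator. -/
def proj (e : A) : ModuleCat.of A A ⟶ obj e :=
  ModuleCat.ofHom ((LinearMap.toSpanSingleton A A e).codRestrict (leftIdeal A e)
    fun y => mul_mem y e)

lemma fgProjective {e : A} (he : e * e = e) : (obj e).FGProjective := by
  refine ⟨Module.Finite.of_fg (Submodule.fg_span_singleton e), ?_⟩
  refine Module.Projective.of_split (incl e).hom (proj e).hom (LinearMap.ext fun y => ?_)
  exact Subtype.ext (mul_eq_self he (y : leftIdeal A e).2)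

/-- The regular module is the direct sum of the modules of a complete system of idempotents. -/
lemma nonempty_retract {J : Type} [Fintype J] (e : J → A) (h : ∑ j, e j = 1) :
    Nonempty (Retract (ModuleCat.of A A) (⨁ fun j => obj (e j))) := by
  refine ⟨{ i := biproduct.lift fun j => proj (e j), r := biproduct.desc fun j => incl (e j),
            retract := ?_ }⟩
  rw [biproduct.lift_desc]
  ext
  rw [ModuleCat.hom_sum, LinearMap.sum_apply]
  refine Eq.trans (Finset.sum_congr rfl fun j _ => (?_ : _ = e j)) h
  exact one_mul (e j)

end IdempotentModule

/-! ### Brauer trees as rooted trees -/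

/-- A rooting of a Brauer tree at a leaf `v`: the set `W` stands for the vertices other than `v`,
`up a` is the dart from the vertex `a` towards `v`, and `root` is the only neighbour of `v`. -/
structure BrauerTree.Rooting {V : Type v} (Γ : BrauerTree V) (W : Type) where
  up : W → Γ.graph.Dart
  root : W
  parent : W → W
  depth : W → ℕ
  up_injective : ∀ {a b}, (up a).fst = (up b).fst → a = b
  exists_up : ∀ d, ∃ a, d = up a ∨ d = (up a).symm
  snd_eq : ∀ {a}, a ≠ root → (up a).snd = (up (parent a)).fst
  snd_root : ∀ {a}, (up a).snd = (up root).snd → a = root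
  snd_root_ne : ∀ a, (up root).snd ≠ (up a).fst
  depth_root : depth root = 0
  depth_parent : ∀ a, a ≠ root → depth a = depth (parent a) + 1

namespace BrauerTree

section Existence

variable {V : Type v} (Γ : BrauerTree V)

lemma exists_leaf [Nonempty Γ.Edge] :
    ∃ v, (∃ d : Γ.graph.Dart, d.snd = v) ∧ ∀ d d' : Γ.graph.Dart, d.snd = v → d'.snd = v → d = d' := by
  classical
  have := Γ.finite
  have := Fintype.ofFinite V
  obtain ⟨d, -⟩ := Γ.edgeOf_surjective (Classical.arbitrary Γ.Edge)
  have : Nontrivial V := ⟨⟨d.fst, d.snd, d.fst_ne_snd⟩⟩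
  obtain ⟨v, hv⟩ := Γ.isTree.exists_vert_degree_one_of_nontrivial
  obtain ⟨y, hy, huniq⟩ := (SimpleGraph.degree_eq_one_iff_existsUnique_adj).1 hv
  refine ⟨v, ⟨⟨(y, v), hy.symm⟩, rfl⟩, fun d d' h h' => ?_⟩
  ext
  · exact (huniq _ (h ▸ d.adj.symm)).trans (huniq _ (h' ▸ d'.adj.symm)).symm
  · exact h.trans h'.symm

lemma exists_dart_dist (v : V) {x : V} (h : x ≠ v) : ∃ d : Γ.graph.Dart, d.fst = x ∧
    Γ.graph.dist d.snd v + 1 = Γ.graph.dist x v := by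
  obtain ⟨p, hp⟩ := Γ.isTree.connected.exists_walk_length_eq_dist x v
  cases p with
  | nil => exact absurd rfl h
  | cons hadj q =>
    rename_i y
    refine ⟨⟨(x, y), hadj⟩, rfl, ?_⟩
    rw [SimpleGraph.Walk.length_cons] at hp
    have h₁ := SimpleGraph.dist_le q
    have h₂ := Γ.isTree.connected.dist_triangle (u := x) (v := y) (w := v)
    have h₃ : Γ.graph.dist x y = 1 := SimpleGraph.dist_eq_one_iff_adj.2 hadj
    change Γ.graph.dist y v + 1 = _
    omega

lemma dart_eq_of_dist {v : V} {d d' : Γ.graph.Dart} (h : d.fst = d'.fst)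
    (hd : Γ.graph.dist d.snd v + 1 = Γ.graph.dist d.fst v)
    (hd' : Γ.graph.dist d'.snd v + 1 = Γ.graph.dist d'.fst v) : d = d' := by
  obtain ⟨⟨x, y⟩, hxy⟩ := d
  obtain ⟨⟨x', y'⟩, hxy'⟩ := d'
  obtain rfl : x = x' := h
  obtain ⟨p, hp⟩ := Γ.isTree.connected.exists_walk_length_eq_dist y v
  obtain ⟨p', hp'⟩ := Γ.isTree.connected.exists_walk_length_eq_dist y' v
  have h₁ : (SimpleGraph.Walk.cons hxy p).IsPath := SimpleGraph.Walk.isPath_of_length_eq_dist _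
    (by rw [SimpleGraph.Walk.length_cons, hp]; exact hd)
  have h₂ : (SimpleGraph.Walk.cons hxy' p').IsPath := SimpleGraph.Walk.isPath_of_length_eq_dist _
    (by rw [SimpleGraph.Walk.length_cons, hp']; exact hd')
  have h₃ := congrArg Subtype.val ((Γ.isTree.isAcyclic.subsingleton_path _ _).elim ⟨_, h₁⟩ ⟨_, h₂⟩)
  have h₄ := congrArg SimpleGraph.Walk.snd h₃
  simp only [SimpleGraph.Walk.snd_cons] at h₄
  subst h₄
  rfl

lemma dist_or (v : V) (d : Γ.graph.Dart) :
    Γ.graph.dist d.snd v + 1 = Γ.graph.dist d.fst v ∨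
      Γ.graph.dist d.fst v + 1 = Γ.graph.dist d.snd v := by
  rcases Γ.isTree.dist_eq_dist_add_one_of_adj v d.adj with h | h
  · left; rw [Γ.graph.dist_comm, ← h, Γ.graph.dist_comm]
  · right; rw [Γ.graph.dist_comm, ← h, Γ.graph.dist_comm]

open scoped Classical in
theorem nonempty_rooting [Nonempty Γ.Edge] : ∃ m, Nonempty (Γ.Rooting (Fin m)) := by
  have := Γ.finite
  obtain ⟨v, ⟨r, hr⟩, hv⟩ := Γ.exists_leaf
  let θ : {x // x ≠ v} ≃ Fin (Nat.card {x // x ≠ v}) := Finite.equivFin _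
  have hup : ∀ a, ∃ d : Γ.graph.Dart, d.fst = (θ.symm a).1 ∧
      Γ.graph.dist d.snd v + 1 = Γ.graph.dist d.fst v := fun a => by
    obtain ⟨d, h₁, h₂⟩ := Γ.exists_dart_dist v (θ.symm a).2
    exact ⟨d, h₁, by rw [h₂, h₁]⟩
  choose up hfst hdist using hup
  have hrv : r.fst ≠ v := hr ▸ r.fst_ne_snd
  have hdart : ∀ d : Γ.graph.Dart, Γ.graph.dist d.snd v + 1 = Γ.graph.dist d.fst v →
      ∃ a, d = up a := fun d hd => by
    have hne : d.fst ≠ v := fun e => by rw [e, SimpleGraph.dist_self] at hd; omega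
    refine ⟨θ ⟨d.fst, hne⟩, Γ.dart_eq_of_dist ?_ hd (hdist _)⟩
    rw [hfst, θ.symm_apply_apply]
  obtain ⟨t, ht⟩ := hdart r (by
    rw [hr, SimpleGraph.dist_self, SimpleGraph.dist_eq_one_iff_adj.2 (hr ▸ r.adj)])
  have hsnd : ∀ a, a ≠ t → (up a).snd ≠ v := fun a ha e => ha (by
    have h₁ := hv (up a) r e hr
    rw [ht] at h₁
    have h₂ := congrArg (fun d : Γ.graph.Dart => d.fst) h₁
    simp only [hfst] at h₂
    exact θ.symm.injective (Subtype.ext h₂))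
  refine ⟨_, ⟨{ up := up, root := t, depth := fun a => Γ.graph.dist (up a).snd v,
                parent := fun a => if h : a = t then t else θ ⟨(up a).snd, hsnd a h⟩,
                up_injective := ?_, exists_up := ?_, snd_eq := ?_, snd_root := ?_,
                snd_root_ne := ?_, depth_root := ?_, depth_parent := ?_ }⟩⟩
  · intro a b h
    rw [hfst, hfst] at h
    exact θ.symm.injective (Subtype.ext h)
  · intro d
    rcases Γ.dist_or v d with h | h
    · exact (hdart d h).imp fun _ => Or.inl
    · obtain ⟨a, ha⟩ := hdart d.symm h
      exact ⟨a, Or.inr (by rw [← ha, SimpleGraph.Dart.symm_symm])⟩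
  · intro a ha
    rw [dif_neg ha, hfst, θ.symm_apply_apply]
  · intro a h
    by_contra ha
    rw [← ht, hr] at h
    exact hsnd a ha h
  · intro a
    rw [← ht, hr, hfst]
    exact (θ.symm a).2.symm
  · rw [← ht, hr, SimpleGraph.dist_self]
  · intro a ha
    have h := hdist (θ ⟨(up a).snd, hsnd a ha⟩)
    rw [hfst, θ.symm_apply_apply] at h
    rw [dif_neg ha]
    exact h.symm

end Existence

end BrauerTree

namespace BrauerTree

variable {V : Type v} (Γ : BrauerTree V)

lemma iterate_add_period (d : Γ.graph.Dart) (k : ℕ) : Γ.next^[k + Γ.period d] d = Γ.next^[k] d := by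
  rw [Function.iterate_add_apply, iterate_period]

lemma eq_period_of_iterate_eq {d : Γ.graph.Dart} {k : ℕ} (hk : 0 < k) (hk' : k ≤ Γ.period d)
    (h : Γ.next^[k] d = d) : k = Γ.period d := by
  by_contra hne
  exact hk.ne' (Γ.iterate_inj (lt_of_le_of_ne hk' hne) (Γ.period_pos d) h)

lemma period_iterate (d : Γ.graph.Dart) (k : ℕ) : Γ.period (Γ.next^[k] d) = Γ.period d :=
  Γ.period_eq (Γ.iterate_fst d k)

/-- The length of a path is determined by the positions of its ends. -/
lemma length_eq {d : Γ.graph.Dart} {k l j : ℕ} (hk : k < Γ.period d) (hl : l < Γ.period d)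
    (hj : j ≤ Γ.period d) (h : Γ.next^[j] (Γ.next^[k] d) = Γ.next^[l] d) :
    k + j = l ∨ k + j = Γ.period d + l := by
  rw [← Function.iterate_add_apply] at h
  rcases lt_or_ge (j + k) (Γ.period d) with h₁ | h₁
  · left
    rw [add_comm, Γ.iterate_inj h₁ hl h]
  · right
    obtain ⟨q, hq⟩ := Nat.exists_eq_add_of_le h₁
    rw [hq, add_comm, iterate_add_period] at h
    have := Γ.iterate_inj (by omega) hl h
    omega

namespace Rooting

variable {Γ} {W : Type} (ρ : Γ.Rooting W)

lemma fst_eq_of_ne {a : W} (ha : a ≠ ρ.root) : (ρ.up (ρ.parent a)).fst = (ρ.up a).symm.fst :=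
  (ρ.snd_eq ha).symm

open scoped Classical in
/-- The position of the edge of `a` around the parent vertex. -/
noncomputable def pos (a : W) : ℕ :=
  if h : a = ρ.root then 0 else (Γ.exists_iterate (ρ.fst_eq_of_ne h)).choose

lemma pos_lt {a : W} (ha : a ≠ ρ.root) : ρ.pos a < Γ.period (ρ.up (ρ.parent a)) := by
  rw [pos, dif_neg ha]
  exact (Γ.exists_iterate (ρ.fst_eq_of_ne ha)).choose_spec.1

lemma iterate_pos {a : W} (ha : a ≠ ρ.root) :
    Γ.next^[ρ.pos a] (ρ.up (ρ.parent a)) = (ρ.up a).symm := by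
  rw [pos, dif_neg ha]
  exact (Γ.exists_iterate (ρ.fst_eq_of_ne ha)).choose_spec.2

lemma up_ne_symm (a b : W) : ρ.up a ≠ (ρ.up b).symm := fun h => by
  have h₁ : (ρ.up a).fst = (ρ.up b).snd := congrArg (fun d : Γ.graph.Dart => d.fst) h
  have h₂ : (ρ.up a).snd = (ρ.up b).fst := congrArg (fun d : Γ.graph.Dart => d.snd) h
  have hb : b ≠ ρ.root := fun e => ρ.snd_root_ne a (e ▸ h₁.symm)
  have ha : a ≠ ρ.root := fun e => ρ.snd_root_ne b (e ▸ h₂)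
  have h₃ := ρ.up_injective (h₁.trans (ρ.snd_eq hb))
  have h₄ := ρ.up_injective (h₂.symm.trans (ρ.snd_eq ha))
  have h₅ := ρ.depth_parent a ha
  have h₆ := ρ.depth_parent b hb
  rw [← h₃] at h₆
  rw [← h₄] at h₅
  omega

lemma up_inj {a b : W} (h : ρ.up a = ρ.up b) : a = b := ρ.up_injective (by rw [h])

lemma pos_pos {a : W} (ha : a ≠ ρ.root) : 0 < ρ.pos a := by
  by_contra h
  have h₁ := ρ.iterate_pos ha
  rw [Nat.eq_zero_of_not_pos h] at h₁
  exact ρ.up_ne_symm _ _ h₁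

/-- The rooted tree of a rooting. -/
noncomputable def planeTree : PlaneTree W where
  root := ρ.root
  parent := ρ.parent
  depth := ρ.depth
  pos := ρ.pos
  depth_root := ρ.depth_root
  depth_parent := ρ.depth_parent
  pos_inj a b ha hb h h' := by
    have h₁ := ρ.iterate_pos ha
    rw [h, h', ρ.iterate_pos hb] at h₁
    exact ρ.up_inj (SimpleGraph.Dart.symm_involutive.injective h₁.symm)

/-- The edge above a vertex. -/
def edge (a : W) : Γ.Edge := Γ.edgeOf (ρ.up a)

lemma edgeOf_eq_edge_iff {d : Γ.graph.Dart} {a : W} :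
    Γ.edgeOf d = ρ.edge a ↔ d = ρ.up a ∨ d = (ρ.up a).symm := Γ.edgeOf_eq_iff

lemma edge_injective : Function.Injective ρ.edge := fun a b h => by
  rcases ρ.edgeOf_eq_edge_iff.1 h with h | h
  · exact ρ.up_inj h
  · exact absurd h (ρ.up_ne_symm a b)

lemma edge_bijective : Function.Bijective ρ.edge :=
  ⟨ρ.edge_injective, fun e => by
    obtain ⟨d, rfl⟩ := Γ.edgeOf_surjective e
    obtain ⟨a, h⟩ := ρ.exists_up d
    exact ⟨a, (ρ.edgeOf_eq_edge_iff.2 h).symm⟩⟩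

lemma card_eq (ρ : Γ.Rooting W) : Nat.card W = Γ.numEdges :=
  Nat.card_congr (Equiv.ofBijective _ ρ.edge_bijective)

section Algebra

open BrauerTreeAlgebra

variable (K : Type u) [Field K]

/-- The path of length `j` around the vertex `u` that starts at position `k`. -/
noncomputable def slot (u : W) (k j : ℕ) : BrauerTreeAlgebra K Γ :=
  path K Γ (Γ.next^[k] (ρ.up u)) j

/-- The number of edges at a vertex. -/
noncomputable def deg (u : W) : ℕ := Γ.period (ρ.up u)

lemma deg_pos (u : W) : 0 < ρ.deg u := Γ.period_pos _

variable {ρ} {K}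

lemma slot_mul {u : W} {k l j j' : ℕ} (h : k + j = l ∨ k + j = ρ.deg u + l) :
    ρ.slot K u k j * ρ.slot K u l j' = ρ.slot K u k (j + j') := by
  rw [slot, slot, slot, path_add, ← Function.iterate_add_apply]
  rcases h with h | h
  · rw [add_comm j k, h]
  · rw [add_comm j k, h, add_comm, deg, iterate_add_period]

lemma slot_eq_zero {u : W} {k j : ℕ} (h : ρ.deg u < j) : ρ.slot K u k j = 0 :=
  path_eq_zero _ (by rwa [period_iterate])

lemma idem_mul_slot {u a : W} {k j : ℕ} (hj : 0 < j)
    (h : Γ.edgeOf (Γ.next^[k] (ρ.up u)) = ρ.edge a) :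
    idem K Γ (ρ.edge a) * ρ.slot K u k j = ρ.slot K u k j := by
  rw [slot, ← h, idem_mul_path _ hj]

lemma slot_mul_idem {u b : W} {k j : ℕ} (hj : 0 < j)
    (h : Γ.edgeOf (Γ.next^[j + k] (ρ.up u)) = ρ.edge b) :
    ρ.slot K u k j * idem K Γ (ρ.edge b) = ρ.slot K u k j := by
  rw [slot, ← h, Function.iterate_add_apply, path_mul_idem _ hj]

variable (ρ K)

open scoped Classical in
/-- The number of steps from position `k` to position `l` around a vertex. -/
noncomputable def steps (u : W) (k l : ℕ) : ℕ := if k < l then l - k else ρ.deg u + l - k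

open scoped Classical in
/-- The path between the edges of two vertices. -/
noncomputable def elem (a b : W) : BrauerTreeAlgebra K Γ :=
  if a = b then ρ.slot K a 0 (ρ.deg a)
  else if ρ.planeTree.Par a b then ρ.slot K b (ρ.pos a) (ρ.deg b - ρ.pos a)
  else if ρ.planeTree.Par b a then ρ.slot K a 0 (ρ.pos b)
  else if ρ.planeTree.Sib a b then
    ρ.slot K (ρ.parent a) (ρ.pos a) (ρ.steps (ρ.parent a) (ρ.pos a) (ρ.pos b))
  else 0

variable {ρ}

lemma _root_.PlaneTree.Par.ne {R : PlaneTree W} {a b : W} (h : R.Par a b) : a ≠ b := fun e => by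
  have := h.depth
  rw [e] at this
  omega

lemma _root_.PlaneTree.Par.not_par {R : PlaneTree W} {a b : W} (h : R.Par a b) : ¬ R.Par b a :=
  fun h' => by
    have := h.depth
    have := h'.depth
    omega

lemma _root_.PlaneTree.Sib.not_par {R : PlaneTree W} {a b : W} (h : R.Sib a b) : ¬ R.Par a b :=
  fun h' => by
    have := h.depth
    have := h'.depth
    omega

lemma elem_self (a : W) : ρ.elem K a a = ρ.slot K a 0 (ρ.deg a) := if_pos rfl

lemma elem_par {a b : W} (h : ρ.planeTree.Par a b) :
    ρ.elem K a b = ρ.slot K b (ρ.pos a) (ρ.deg b - ρ.pos a) := by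
  rw [elem, if_neg h.ne, if_pos h]

lemma elem_par' {a b : W} (h : ρ.planeTree.Par b a) : ρ.elem K a b = ρ.slot K a 0 (ρ.pos b) := by
  rw [elem, if_neg h.ne.symm, if_neg h.not_par, if_pos h]

lemma elem_sib {a b u : W} (h : ρ.planeTree.Sib a b) (hu : ρ.planeTree.Par a u) :
    ρ.elem K a b = ρ.slot K u (ρ.pos a) (ρ.steps u (ρ.pos a) (ρ.pos b)) := by
  rw [elem, if_neg h.2.2.1, if_neg h.not_par, if_neg h.symm.not_par, if_pos h,
    show ρ.parent a = u from hu.2]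

lemma elem_eq_zero {a b : W} (h : a ≠ b) (h₁ : ¬ ρ.planeTree.Par a b) (h₂ : ¬ ρ.planeTree.Par b a)
    (h₃ : ¬ ρ.planeTree.Sib a b) : ρ.elem K a b = 0 := by
  rw [elem, if_neg h, if_neg h₁, if_neg h₂, if_neg h₃]

lemma pos_lt_deg {a u : W} (h : ρ.planeTree.Par a u) : ρ.pos a < ρ.deg u := by
  obtain ⟨h₁, rfl⟩ := h
  exact ρ.pos_lt h₁

lemma pos_pos_of_par {a u : W} (h : ρ.planeTree.Par a u) : 0 < ρ.pos a := ρ.pos_pos h.1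

lemma iterate_pos_of_par {a u : W} (h : ρ.planeTree.Par a u) :
    Γ.next^[ρ.pos a] (ρ.up u) = (ρ.up a).symm := by
  obtain ⟨h₁, rfl⟩ := h
  exact ρ.iterate_pos h₁

lemma edgeOf_iterate_pos {a u : W} (h : ρ.planeTree.Par a u) :
    Γ.edgeOf (Γ.next^[ρ.pos a] (ρ.up u)) = ρ.edge a := by
  rw [iterate_pos_of_par h, edgeOf_symm, edge]

lemma edgeOf_iterate_deg (u : W) : Γ.edgeOf (Γ.next^[ρ.deg u] (ρ.up u)) = ρ.edge u := by
  rw [deg, iterate_period, edge]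

lemma par_of_fst_eq {a b : W} (h : (ρ.up a).snd = (ρ.up b).fst) : ρ.planeTree.Par a b := by
  have ha : a ≠ ρ.root := fun e => ρ.snd_root_ne b (e ▸ h)
  exact ⟨ha, ρ.up_injective ((ρ.snd_eq ha).symm.trans h)⟩

lemma par_of_snd_eq {a b : W} (hne : a ≠ b) (h : (ρ.up a).snd = (ρ.up b).snd) :
    ρ.planeTree.Sib a b := by
  have ha : a ≠ ρ.root := fun e => hne (e.trans (ρ.snd_root (e ▸ h.symm)).symm)
  have hb : b ≠ ρ.root := fun e => hne ((ρ.snd_root (e ▸ h)).trans e.symm)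
  exact ⟨ha, hb, hne, ρ.up_injective ((ρ.snd_eq ha).symm.trans (h.trans (ρ.snd_eq hb)))⟩

lemma steps_add {u : W} {k l : ℕ} (hk : k < ρ.deg u) :
    k + ρ.steps u k l = l ∨ k + ρ.steps u k l = ρ.deg u + l := by
  rw [steps]
  split_ifs <;> omega

lemma steps_pos {u : W} {k l : ℕ} (hk : k < ρ.deg u) : 0 < ρ.steps u k l := by
  rw [steps]
  split_ifs <;> omega

lemma edgeOf_iterate_steps {u b : W} {k : ℕ} (hk : k < ρ.deg u) (hb : ρ.planeTree.Par b u) :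
    Γ.edgeOf (Γ.next^[ρ.steps u k (ρ.pos b) + k] (ρ.up u)) = ρ.edge b := by
  rcases steps_add (l := ρ.pos b) hk with h | h
  · rw [add_comm, h, edgeOf_iterate_pos hb]
  · rw [add_comm, h, add_comm, deg, iterate_add_period, edgeOf_iterate_pos hb]

lemma idem_mul_elem (a b : W) : idem K Γ (ρ.edge a) * ρ.elem K a b = ρ.elem K a b := by
  by_cases hab : a = b
  · subst hab
    rw [elem_self, idem_mul_slot (ρ.deg_pos a) rfl]
  by_cases h₁ : ρ.planeTree.Par a b
  · have := pos_lt_deg h₁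
    rw [elem_par K h₁, idem_mul_slot (by omega) (edgeOf_iterate_pos h₁)]
  by_cases h₂ : ρ.planeTree.Par b a
  · rw [elem_par' K h₂, idem_mul_slot (pos_pos_of_par h₂) rfl]
  by_cases h₃ : ρ.planeTree.Sib a b
  · have hu := PlaneTree.par_parent h₃.1
    rw [elem_sib K h₃ hu, idem_mul_slot (steps_pos (pos_lt_deg hu)) (edgeOf_iterate_pos hu)]
  · rw [elem_eq_zero K hab h₁ h₂ h₃, mul_zero]

lemma elem_mul_idem (a b : W) : ρ.elem K a b * idem K Γ (ρ.edge b) = ρ.elem K a b := by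
  by_cases hab : a = b
  · subst hab
    rw [elem_self, slot_mul_idem (ρ.deg_pos a) (edgeOf_iterate_deg a)]
  by_cases h₁ : ρ.planeTree.Par a b
  · have := pos_lt_deg h₁
    rw [elem_par K h₁, slot_mul_idem (by omega)]
    rw [Nat.sub_add_cancel this.le, edgeOf_iterate_deg]
  by_cases h₂ : ρ.planeTree.Par b a
  · rw [elem_par' K h₂, slot_mul_idem (pos_pos_of_par h₂) (edgeOf_iterate_pos h₂)]
  by_cases h₃ : ρ.planeTree.Sib a b
  · have hu := PlaneTree.par_parent h₃.1
    rw [elem_sib K h₃ hu, slot_mul_idem (steps_pos (pos_lt_deg hu))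
      (edgeOf_iterate_steps (pos_lt_deg hu) (h₃.par hu))]
  · rw [elem_eq_zero K hab h₁ h₂ h₃, zero_mul]

lemma elem_self_ne_zero (a : W) : ρ.elem K a a ≠ 0 := by
  rw [elem_self]
  exact path_period_ne_zero (ρ.up a)

lemma elem_self_mul (a : W) : ρ.elem K a a * ρ.elem K a a = 0 := by
  have := ρ.deg_pos a
  rw [elem_self, slot_mul (Or.inr (by omega)), slot_eq_zero (by omega)]

lemma elem_par_mul {a b : W} (h : ρ.planeTree.Par a b) :
    ρ.elem K a b * ρ.elem K b a = ρ.elem K a a := by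
  have := pos_lt_deg h
  rw [elem_par K h, elem_par' K h, slot_mul (Or.inr (by omega)), Nat.sub_add_cancel this.le,
    elem_self, slot, slot, iterate_pos_of_par h]
  have h₁ := path_period_symm (K := K) (ρ.up a)
  have h₂ : Γ.period (ρ.up a).symm = ρ.deg b := by
    rw [← iterate_pos_of_par h, period_iterate, deg]
  rw [h₂] at h₁
  exact h₁

lemma elem_par_mul' {a b : W} (h : ρ.planeTree.Par a b) :
    ρ.elem K b a * ρ.elem K a b = ρ.elem K b b := by
  have := pos_lt_deg h
  rw [elem_par K h, elem_par' K h, slot_mul (Or.inl (by omega)), Nat.add_sub_cancel' this.le,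
    elem_self]

lemma steps_of_lt {u : W} {k l : ℕ} (h : k < l) : ρ.steps u k l = l - k := if_pos h

lemma steps_of_gt {u : W} {k l : ℕ} (h : l < k) : ρ.steps u k l = ρ.deg u + l - k :=
  if_neg h.not_gt

lemma elem_up_lt {a b u : W} (h : ρ.planeTree.Sib a b) (hu : ρ.planeTree.Par a u)
    (hp : ρ.pos a < ρ.pos b) : ρ.elem K a b * ρ.elem K b u = ρ.elem K a u := by
  have := pos_lt_deg hu
  have := pos_lt_deg (h.par hu)
  rw [elem_sib K h hu, elem_par K hu, elem_par K (h.par hu), steps_of_lt hp,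
    slot_mul (Or.inl (by omega))]
  congr 1
  omega

lemma elem_up_gt {a b u : W} (h : ρ.planeTree.Sib a b) (hu : ρ.planeTree.Par a u)
    (hp : ρ.pos b < ρ.pos a) : ρ.elem K a b * ρ.elem K b u = 0 := by
  have := pos_lt_deg hu
  have := pos_lt_deg (h.par hu)
  rw [elem_sib K h hu, elem_par K (h.par hu), steps_of_gt hp, slot_mul (Or.inr (by omega)),
    slot_eq_zero (by omega)]

lemma elem_down_lt {a b u : W} (h : ρ.planeTree.Sib a b) (hu : ρ.planeTree.Par a u)
    (hp : ρ.pos a < ρ.pos b) : ρ.elem K u a * ρ.elem K a b = ρ.elem K u b := by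
  rw [elem_sib K h hu, elem_par' K hu, elem_par' K (h.par hu), steps_of_lt hp,
    slot_mul (Or.inl (by omega))]
  congr 1
  omega

lemma elem_down_gt {a b u : W} (h : ρ.planeTree.Sib a b) (hu : ρ.planeTree.Par a u)
    (hp : ρ.pos b < ρ.pos a) : ρ.elem K u a * ρ.elem K a b = 0 := by
  have := pos_lt_deg hu
  have := pos_pos_of_par (h.par hu)
  rw [elem_sib K h hu, elem_par' K hu, steps_of_gt hp, slot_mul (Or.inl (by omega)),
    slot_eq_zero (by omega)]

lemma elem_over_gt {a b u : W} (h : ρ.planeTree.Sib a b) (hu : ρ.planeTree.Par a u)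
    (hp : ρ.pos b < ρ.pos a) : ρ.elem K a u * ρ.elem K u b = ρ.elem K a b := by
  have := pos_lt_deg hu
  rw [elem_sib K h hu, elem_par K hu, elem_par' K (h.par hu), steps_of_gt hp,
    slot_mul (Or.inr (by omega))]
  congr 1
  omega

lemma elem_over_lt {a b u : W} (h : ρ.planeTree.Sib a b) (hu : ρ.planeTree.Par a u)
    (hp : ρ.pos a < ρ.pos b) : ρ.elem K a u * ρ.elem K u b = 0 := by
  have := pos_lt_deg hu
  rw [elem_par K hu, elem_par' K (h.par hu), slot_mul (Or.inr (by omega)),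
    slot_eq_zero (by omega)]

lemma exists_eq_smul_elem {a b : W} (hne : a ≠ b) (x : BrauerTreeAlgebra K Γ) :
    ∃ r : K, idem K Γ (ρ.edge a) * x * idem K Γ (ρ.edge b) = r • ρ.elem K a b := by
  have h := idem_mul_mul_idem_mem (i := ρ.edge a) (j := ρ.edge b)
    (Submodule.span K {ρ.elem K a b}) (fun e => absurd (ρ.edge_injective e) hne)
    (fun d k hk hk' h₁ h₂ => ?_) x
  · obtain ⟨r, hr⟩ := Submodule.mem_span_singleton.1 h
    exact ⟨r, hr.symm⟩
  refine Submodule.subset_span ?_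
  have hfst := Γ.iterate_fst d k
  rcases ρ.edgeOf_eq_edge_iff.1 h₁ with rfl | rfl <;> rcases ρ.edgeOf_eq_edge_iff.1 h₂ with h₃ | h₃
  · rw [h₃] at hfst
    exact absurd (ρ.up_injective hfst.symm) hne
  · rw [h₃] at hfst
    have hp : ρ.planeTree.Par b a := par_of_fst_eq hfst
    rw [← iterate_pos_of_par hp] at h₃
    have := Γ.length_eq (k := 0) (Γ.period_pos _) (pos_lt_deg hp) hk' h₃
    have := pos_pos_of_par hp
    obtain rfl : k = ρ.pos b := by omega
    rw [elem_par' K hp]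
    rfl
  · rw [h₃] at hfst
    have hp : ρ.planeTree.Par a b := par_of_fst_eq hfst.symm
    rw [← iterate_pos_of_par hp] at h₃ hk' ⊢
    rw [period_iterate] at hk'
    have := Γ.length_eq (l := 0) (pos_lt_deg hp) (Γ.period_pos _) hk' h₃
    have := pos_pos_of_par hp
    obtain rfl : k = ρ.deg b - ρ.pos a := by rw [deg]; omega
    rw [elem_par K hp]
    rfl
  · rw [h₃] at hfst
    have hs : ρ.planeTree.Sib a b := par_of_snd_eq hne hfst.symm
    have hu := PlaneTree.par_parent hs.1
    rw [← iterate_pos_of_par hu] at h₃ hk' ⊢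
    rw [← iterate_pos_of_par (hs.par hu)] at h₃
    rw [period_iterate] at hk'
    have h₄ := Γ.length_eq (pos_lt_deg hu) (pos_lt_deg (hs.par hu)) hk' h₃
    have h₅ : k = ρ.steps (ρ.planeTree.parent a) (ρ.pos a) (ρ.pos b) := by
      have := hs.pos_ne
      have := pos_lt_deg (hs.par hu)
      rw [steps, deg]
      rw [deg] at this
      split_ifs <;> omega
    rw [elem_sib K hs hu, ← h₅]
    rfl

lemma exists_eq_smul_add_smul_elem (a : W) (x : BrauerTreeAlgebra K Γ) :
    ∃ r s : K, idem K Γ (ρ.edge a) * x * idem K Γ (ρ.edge a) =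
      r • idem K Γ (ρ.edge a) + s • ρ.elem K a a := by
  have h := idem_mul_mul_idem_mem (i := ρ.edge a) (j := ρ.edge a)
    (Submodule.span K {idem K Γ (ρ.edge a), ρ.elem K a a})
    (fun _ => Submodule.subset_span (Or.inl rfl)) (fun d k hk hk' h₁ h₂ => ?_) x
  · obtain ⟨r, s, hr⟩ := Submodule.mem_span_pair.1 h
    exact ⟨r, s, hr.symm⟩
  refine Submodule.subset_span (Or.inr ?_)
  have hd := Γ.eq_of_fst_eq (h₂.trans h₁.symm) (Γ.iterate_fst d k)
  obtain rfl := Γ.eq_period_of_iterate_eq hk hk' hd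
  rw [elem_self]
  rcases ρ.edgeOf_eq_edge_iff.1 h₁ with rfl | rfl
  · rfl
  · exact path_period_symm (ρ.up a)

open IdempotentModule

variable (ρ)

/-- The Brauer system of the indecomposable projective modules of a Brauer tree algebra. -/
noncomputable def brauerSystem :
    BrauerSystem K ρ.planeTree (ModuleCat.{max u v} (BrauerTreeAlgebra K Γ)) where
  P a := obj (idem K Γ (ρ.edge a))
  c a b := rmul _ _ (ρ.elem K a b)
  span_self {a} f := by
    obtain ⟨x, rfl⟩ := exists_rmul (idem_mul_self _) (idem_mul_self _) f
    obtain ⟨r, s, h⟩ := exists_eq_smul_add_smul_elem K a x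
    exact ⟨r, s, by rw [h, rmul_add, rmul_smul, rmul_smul, rmul_self (idem_mul_self _)]⟩
  span_ne h f := by
    obtain ⟨x, rfl⟩ := exists_rmul (idem_mul_self _) (idem_mul_self _) f
    obtain ⟨r, h⟩ := exists_eq_smul_elem K h x
    exact ⟨r, by rw [h, rmul_smul]⟩
  c_eq_zero h h₁ h₂ h₃ := by rw [elem_eq_zero K h h₁ h₂ h₃, rmul_zero]
  c_self_ne_zero a h := elem_self_ne_zero K a
    (eq_zero_of_rmul_eq_zero (by rw [idem_mul_elem, elem_mul_idem]) h)
  c_self_comp a := by rw [rmul_comp (elem_mul_idem K a a), elem_self_mul, rmul_zero]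
  c_par h := by rw [rmul_comp (elem_mul_idem K _ _), elem_par_mul K h]
  c_par' h := by rw [rmul_comp (elem_mul_idem K _ _), elem_par_mul' K h]
  up_lt h hu hp := by rw [rmul_comp (elem_mul_idem K _ _), elem_up_lt K h hu hp]
  up_gt h hu hp := by rw [rmul_comp (elem_mul_idem K _ _), elem_up_gt K h hu hp, rmul_zero]
  down_lt h hu hp := by rw [rmul_comp (elem_mul_idem K _ _), elem_down_lt K h hu hp]
  down_gt h hu hp := by rw [rmul_comp (elem_mul_idem K _ _), elem_down_gt K h hu hp, rmul_zero]
  over_gt h hu hp := by rw [rmul_comp (elem_mul_idem K _ _), elem_over_gt K h hu hp]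
  over_lt h hu hp := by rw [rmul_comp (elem_mul_idem K _ _), elem_over_lt K h hu hp, rmul_zero]

lemma sum_idem_edge [Fintype W] : ∑ a, idem K Γ (ρ.edge a) = 1 := by
  have := Γ.finite_edge
  have := Fintype.ofFinite Γ.Edge
  rw [← sum_idem]
  exact Fintype.sum_equiv (Equiv.ofBijective _ ρ.edge_bijective) _ _ fun _ => rfl

end Algebra

end Rooting

end BrauerTree

namespace TwoTermTilting

/-- Over the zero ring the zero complex is a tilting complex. -/
lemma exists_of_subsingleton {K : Type u} [Field K] {A : Type w} [Ring A] [Algebra K A]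
    [Subsingleton A] [HasDerivedCategory.{v} (ModuleCat.{w} A)] :
    ∃ T : CochainComplex (ModuleCat.{w} A) ℤ, IsTwoTerm T ∧ IsTilting T ∧
      Nonempty (StarSystem K 0 (EndHomotopy T)) := by
  have hM : ∀ M : ModuleCat.{w} A, IsZero M := fun M => by
    have := Module.subsingleton A M
    exact ModuleCat.isZero_of_subsingleton M
  have hC : ∀ D : CochainComplex (ModuleCat.{w} A) ℤ, IsZero D := fun D => by
    rw [IsZero.iff_id_eq_zero]
    ext1 i
    exact (hM _).eq_of_src _ _
  let T : CochainComplex (ModuleCat.{w} A) ℤ :=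
    (HomologicalComplex.single (ModuleCat.{w} A) (ComplexShape.up ℤ) 0).obj (ModuleCat.of A A)
  have hQ : IsZero (DerivedCategory.Q.obj T) := DerivedCategory.Q.map_isZero (hC T)
  have hH := (HomotopyCategory.quotient (ModuleCat.{w} A) (ComplexShape.up ℤ)).map_isZero (hC T)
  have : Subsingleton (EndHomotopy T) := ⟨fun f g => hH.eq_of_src f g⟩
  refine ⟨T, fun i _ _ => hM _, ⟨⟨fun i => ModuleCat.FGProjective.of_isZero (hM _), 0, 0,
    fun i _ => hM _⟩, fun i _ f => hQ.eq_of_src _ _, ?_⟩, ⟨?_⟩⟩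
  · rintro X ⟨D, -, ⟨e⟩⟩
    have hX : IsZero X := (DerivedCategory.Q.map_isZero (hC D)).of_iso e
    exact ObjectProperty.prop_of_iso _ (hQ.iso hX) (ObjectProperty.le_triangEnvelope _ _
      ((ObjectProperty.singleton_iff _ _).2 rfl))
  · exact
      { H := fun i => i.elim0
        S := fun i => i.elim0
        H_mul_H := fun {i} => i.elim0
        H_mul_S := fun {i} => i.elim0
        S_mul_H := fun {i} => i.elim0
        S_mul_S := fun {i} => i.elim0
        H_mul_ne := fun {i} => i.elim0
        S_lt := fun {i} => i.elim0
        S_self := fun i => i.elim0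
        sum_H := Subsingleton.elim _ _
        span := Subsingleton.elim _ _ }

end TwoTermTilting

lemma BrauerTreeAlgebra.subsingleton (K : Type u) [Field K] {V : Type v} (Γ : BrauerTree V)
    [IsEmpty Γ.Edge] : Subsingleton (BrauerTreeAlgebra K Γ) := by
  refine subsingleton_of_zero_eq_one ?_
  rw [← finsum_idem, finsum_of_isEmpty]

theorem exists_two_term_tilting_with_star_endomorphism_ring
    (K : Type u) [Field K] [IsAlgClosed K] {V : Type v} (Γ : BrauerTree V)
    [HasDerivedCategory.{w} (ModuleCat.{max u v} (BrauerTreeAlgebra K Γ))] :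
    ∃ T : CochainComplex (ModuleCat.{max u v} (BrauerTreeAlgebra K Γ)) ℤ,
      TwoTermTilting.IsTwoTerm T ∧ TwoTermTilting.IsTilting T ∧
        Nonempty (TwoTermTilting.EndHomotopy T ≃ₐ[K]
          BrauerTreeAlgebra K (BrauerTree.star Γ.numEdges)) := by
  rcases isEmpty_or_nonempty Γ.Edge with hE | hE
  · have := BrauerTreeAlgebra.subsingleton K Γ
    obtain ⟨T, h₁, h₂, ⟨σ⟩⟩ :=
      TwoTermTilting.exists_of_subsingleton (K := K) (A := BrauerTreeAlgebra K Γ)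
    have h₀ : Γ.numEdges = 0 := Nat.card_of_isEmpty
    exact ⟨T, h₁, h₂, by rw [h₀]; exact ⟨σ.algEquiv⟩⟩
  · obtain ⟨m, ⟨ρ⟩⟩ := Γ.nonempty_rooting
    have hm : Fintype.card (Fin m) = Γ.numEdges := by rw [← ρ.card_eq, Nat.card_eq_fintype_card]
    let B := ρ.brauerSystem K
    have : HasFiniteBiproducts
        (CochainComplex (ModuleCat.{max u v} (BrauerTreeAlgebra K Γ)) ℤ) :=
      Abelian.hasFiniteBiproducts
    have hP : ∀ a, (B.P a).FGProjective := fun a =>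
      IdempotentModule.fgProjective (BrauerTreeAlgebra.idem_mul_self _)
    obtain ⟨σ⟩ := B.nonempty_starSystem
    refine ⟨B.tilt, B.isTwoTerm_tilt,
      B.isTilting_tilt hP (IdempotentModule.nonempty_retract _ (ρ.sum_idem_edge K)), ?_⟩
    rw [← hm]
    exact ⟨σ.algEquiv⟩
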